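/- arXiv:1803.10832 — 2 statements merged into one kernel-verified Lean document; each statement's English description precedes it below -/
import Mathlib

section
/- Let α ∈ (0,1), let f : (0,1) → ℝ be locally Lipschitz on (0,1) and belong to L¹_{1−α}((0,1)), and let x ∈ (0,1). Then for N sufficiently large the limit S_N := lim_{R→1⁻} Σ_{l=0}^{N} T₁(⌊Nx⌋, l, R) · X_{N,l} exists, and as N → ∞, S_N = N^α · (1/(2^α Γ(α))) ∫₀^x (x−t)^{α−1} f(t) dt + o(N^α). -/
open MeasureTheory Filter Asymptotics

/-- `β^{(α)}_u = Γ(α+u)/(Γ(α) u!)`. -/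
noncomputable def betaC (α : ℝ) (u : ℕ) : ℝ :=
  Real.Gamma (α + u) / (Real.Gamma α * (Nat.factorial u : ℝ))

/-- `β^{(α)}_m` for an integer index, vanishing for `m < 0`. -/
noncomputable def betaCZ (α : ℝ) (m : ℤ) : ℝ :=
  if 0 ≤ m then betaC α m.toNat else 0

/-- `T₁(k,l,R) = Σ_{u=max(0,l-k)}^{l} (-1)^u β^{(α)}_u β^{(α)}_{k-l+u} R^{k-l+2u}`. -/
noncomputable def T1 (α : ℝ) (k l : ℕ) (R : ℝ) : ℝ :=
  ∑ u ∈ Finset.Icc (l - k) l,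
    (-1 : ℝ) ^ u * betaC α u * betaCZ α ((k : ℤ) - (l : ℤ) + u) *
      R ^ ((k : ℤ) - (l : ℤ) + 2 * u)

/-- The discretization vector `X_{N,l}`: `f(l/N)` for `0 < l < N`, and `0` at the endpoints. -/
noncomputable def Xvec (f : ℝ → ℝ) (N l : ℕ) : ℝ :=
  if l = 0 ∨ l = N then 0 else f ((l : ℝ) / (N : ℝ))

/-- `f` is locally Lipschitz (locally contracting) on `(0,1)`. -/
def LocLip01 (f : ℝ → ℝ) : Prop :=
  ∀ a b : ℝ, 0 < a → a ≤ b → b < 1 →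
    ∃ K : ℝ, ∀ z ∈ Set.Icc a b, ∀ z' ∈ Set.Icc a b, |f z - f z'| ≤ K * |z - z'|

/-- `f` belongs to the class `L¹_{1-α}((0,1))`. -/
def MemL1Class (α : ℝ) (f : ℝ → ℝ) : Prop :=
  ∃ γ : ℝ, 0 ≤ γ ∧ γ ≤ 1 - α ∧
    (f =O[nhdsWithin 0 (Set.Ioi 0)] fun t : ℝ => t ^ (-γ)) ∧
    ((fun t : ℝ => f (1 - t)) =O[nhdsWithin 0 (Set.Ioi 0)] fun t : ℝ => t ^ (-γ))

open scoped Topology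

theorem betaC_zero {α : ℝ} (hα : 0 < α) : betaC α 0 = 1 := by
  have := (Real.Gamma_pos_of_pos hα).ne'
  simp [betaC, this]

theorem betaC_succ {α : ℝ} (hα : 0 < α) (u : ℕ) :
    betaC α (u + 1) = betaC α u * ((α + u) / (u + 1)) := by
  have h := (Real.Gamma_pos_of_pos hα).ne'
  have h2 : α + u ≠ 0 := by positivity
  have h3 : (u.factorial : ℝ) ≠ 0 := by positivity
  have h4 : (u : ℝ) + 1 ≠ 0 := by positivity
  have key : Real.Gamma (α + ((u + 1 : ℕ) : ℝ)) = (α + u) * Real.Gamma (α + u) := by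
    rw [← Real.Gamma_add_one h2]
    push_cast
    ring_nf
  unfold betaC
  rw [key, Nat.factorial_succ]
  push_cast
  field_simp

theorem betaC_pos {α : ℝ} (hα : 0 < α) (u : ℕ) : 0 < betaC α u := by
  have := Real.Gamma_pos_of_pos hα
  have : 0 < Real.Gamma (α + u) := Real.Gamma_pos_of_pos (by positivity)
  unfold betaC
  positivity

theorem betaC_antitone {α : ℝ} (hα : α ∈ Set.Ioo (0 : ℝ) 1) : Antitone (betaC α) := by
  refine antitone_nat_of_succ_le fun n => ?_
  rw [betaC_succ hα.1]
  refine mul_le_of_le_one_right (betaC_pos hα.1 n).le ?_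
  rw [div_le_one (by positivity)]
  linarith [hα.2]

theorem betaC_le_rpow {α : ℝ} (hα : α ∈ Set.Ioo (0 : ℝ) 1) (m : ℕ) :
    betaC α m ≤ ((m : ℝ) + 1) ^ (α - 1) := by
  induction m with
  | zero => simp [betaC_zero hα.1]
  | succ m ih =>
    have hm : (0 : ℝ) < m + 1 := by positivity
    have hm2 : (0 : ℝ) < m + 1 + 1 := by positivity
    have hbern := rpow_one_add_le_one_add_mul_self (s := 1 / ((m : ℝ) + 1))
      (by linarith [one_div_pos.2 hm]) (p := 1 - α) (by linarith [hα.2]) (by linarith [hα.1])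
    have e1 : 1 + 1 / ((m : ℝ) + 1) = ((m : ℝ) + 1 + 1) / (m + 1) := by
      field_simp
    rw [e1, Real.div_rpow hm2.le hm.le] at hbern
    rw [betaC_succ hα.1]
    push_cast
    rw [show α - 1 = -(1 - α) by ring, Real.rpow_neg hm2.le]
    rw [show α - 1 = -(1 - α) by ring, Real.rpow_neg hm.le] at ih
    have hp1 := Real.rpow_pos_of_pos hm (1 - α)
    have hp2 := Real.rpow_pos_of_pos hm2 (1 - α)
    set p := ((m : ℝ) + 1) ^ (1 - α)
    set q := ((m : ℝ) + 1 + 1) ^ (1 - α)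
    have hz : 0 < (α + m) / ((m : ℝ) + 1) := div_pos (by linarith [hα.1, hm]) hm
    calc betaC α m * ((α + m) / (m + 1)) ≤ p⁻¹ * ((α + m) / (m + 1)) := by gcongr
      _ = q⁻¹ * (q / p * ((α + m) / (m + 1))) := by field_simp
      _ ≤ q⁻¹ * 1 := by
        gcongr
        refine (mul_le_mul_of_nonneg_right hbern hz.le).trans ?_
        rw [mul_div_assoc', div_le_one hm]
        have : (1 - α) * (1 / ((m : ℝ) + 1)) * (α + m) ≤ 1 - α := by
          rw [mul_one_div, div_mul_eq_mul_div, div_le_iff₀ hm]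
          nlinarith [hα.1, hα.2]
        linarith
      _ = q⁻¹ := mul_one _

theorem tendsto_betaC_zero {α : ℝ} (hα : α ∈ Set.Ioo (0 : ℝ) 1) :
    Tendsto (betaC α) atTop (𝓝 0) := by
  refine squeeze_zero (fun n => (betaC_pos hα.1 n).le) (betaC_le_rpow hα) ?_
  have h : Tendsto (fun x : ℝ => x ^ (-(1 - α))) atTop (𝓝 0) :=
    tendsto_rpow_neg_atTop (by linarith [hα.2])
  have h2 : Tendsto (fun n : ℕ => (n : ℝ) + 1) atTop atTop :=
    tendsto_atTop_add_const_right _ _ tendsto_natCast_atTop_atTop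
  simpa [Function.comp_def] using h.comp h2

theorem betaC_eq_prod {α : ℝ} (hα : 0 < α) (n : ℕ) :
    betaC α n * n.factorial = ∏ j ∈ Finset.range n, (α + j) := by
  induction n with
  | zero => simp [betaC_zero hα]
  | succ n ih =>
    rw [Finset.prod_range_succ, ← ih, betaC_succ hα, Nat.factorial_succ]
    push_cast
    field_simp

theorem tendsto_betaC_mul_rpow {α : ℝ} (hα : 0 < α) :
    Tendsto (fun n : ℕ => betaC α n * (n : ℝ) ^ (1 - α)) atTop (𝓝 (1 / Real.Gamma α)) := by
  have hG := (Real.Gamma_pos_of_pos hα).ne'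
  have h1 : Tendsto (fun n : ℕ => (n : ℝ) / (n + α)) atTop (𝓝 1) := by
    simpa using tendsto_natCast_div_add_atTop (𝕜 := ℝ) α
  refine (h1.div (Real.GammaSeq_tendsto_Gamma α) hG).congr' ?_
  filter_upwards [eventually_gt_atTop 0] with n hn
  have hn' : (0 : ℝ) < n := by exact_mod_cast hn
  have hb := (betaC_pos hα n).ne'
  have hp := (Real.rpow_pos_of_pos hn' α).ne'
  have h3 : (n.factorial : ℝ) ≠ 0 := by positivity
  have h4 : α + n ≠ 0 := by positivity
  simp only [Pi.div_apply]
  rw [Real.GammaSeq, Finset.prod_range_succ, ← betaC_eq_prod hα, Real.rpow_sub hn', Real.rpow_one]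
  rw [add_comm (n : ℝ) α]
  field_simp

theorem sum_neg_one_pow_mul_mem_Icc {a : ℕ → ℝ} (ha : Antitone a) (h0 : ∀ n, 0 ≤ a n) (n : ℕ) :
    ∑ i ∈ Finset.range n, (-1 : ℝ) ^ i * a i ∈ Set.Icc 0 (a 0) := by
  induction n generalizing a with
  | zero => simpa using h0 0
  | succ n ih =>
    have := ih (a := fun i => a (i + 1)) (fun i j h => ha (by omega)) (fun _ => h0 _)
    rw [Finset.sum_range_succ']
    have e : ∑ i ∈ Finset.range n, (-1 : ℝ) ^ (i + 1) * a (i + 1)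
        = - ∑ i ∈ Finset.range n, (-1 : ℝ) ^ i * a (i + 1) := by
      rw [← Finset.sum_neg_distrib]
      exact Finset.sum_congr rfl fun i _ => by ring
    rw [e]
    have h1 := ha (Nat.zero_le 1)
    simp only [Set.mem_Icc, zero_add] at this ⊢
    constructor <;> simp <;> linarith [this.1, this.2]

theorem ringChoose_neg_eq_betaC {α : ℝ} (hα : 0 < α) (n : ℕ) :
    Ring.choose (-α) n = (-1) ^ n * betaC α n := by
  induction n with
  | zero => simp [betaC_zero hα]
  | succ n ih =>
    rw [Ring.choose_eq_smul] at ih ⊢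
    rw [descPochhammer_succ_right, Polynomial.smeval_mul, Polynomial.smeval_sub,
      Polynomial.smeval_X, Polynomial.smeval_natCast, betaC_succ hα, Nat.factorial_succ]
    simp only [smul_eq_mul] at ih ⊢
    rw [inv_mul_eq_iff_eq_mul₀ (by positivity)] at ih
    rw [ih]
    push_cast
    simp
    field_simp
    ring

theorem tendsto_alternating_betaC {α : ℝ} (hα : α ∈ Set.Ioo (0 : ℝ) 1) :
    Tendsto (fun n => ∑ i ∈ Finset.range n, (-1 : ℝ) ^ i * betaC α i) atTop
      (𝓝 ((2 : ℝ) ^ (-α))) := by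
  obtain ⟨l, hl⟩ := (betaC_antitone hα).tendsto_alternating_series_of_tendsto_zero
    (tendsto_betaC_zero hα)
  have h1 := Real.tendsto_tsum_powerSeries_nhdsWithin_lt hl
  have h2 : Tendsto (fun x : ℝ => (1 + x) ^ (-α)) (𝓝[<] 1) (𝓝 ((2 : ℝ) ^ (-α))) := by
    have : ContinuousAt (fun x : ℝ => (1 + x) ^ (-α)) 1 :=
      ContinuousAt.rpow_const (by fun_prop) (by norm_num)
    have h := this.tendsto
    norm_num at h
    exact h.mono_left nhdsWithin_le_nhds
  have h3 : (fun x : ℝ => (1 + x) ^ (-α)) =ᶠ[𝓝[<] 1]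
      fun x => ∑' n, (-1 : ℝ) ^ n * betaC α n * x ^ n := by
    filter_upwards [Ioo_mem_nhdsLT (show (0 : ℝ) < 1 by norm_num)] with x hx
    have h := (Real.one_add_rpow_hasFPowerSeriesOnBall_zero (a := -α)).hasSum (y := x)
      (by
        rw [← ENNReal.ofReal_one, Metric.eball_ofReal]
        simpa [abs_of_pos hx.1] using hx.2)
    rw [zero_add] at h
    rw [← h.tsum_eq]
    refine tsum_congr fun n => ?_
    rw [binomialSeries, FormalMultilinearSeries.ofScalars_apply_eq, smul_eq_mul,
      ringChoose_neg_eq_betaC hα.1]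
  rw [tendsto_nhds_unique (h2.congr' h3) h1]
  exact hl

/-- The alternating correlation sum `∑_{v ≤ n} (-1)^v β_v β_{m+v}`. -/
noncomputable def altCorr (α : ℝ) (m n : ℕ) : ℝ :=
  ∑ v ∈ Finset.range (n + 1), (-1 : ℝ) ^ v * (betaC α v * betaC α (m + v))

theorem antitone_betaC_mul_betaC {α : ℝ} (hα : α ∈ Set.Ioo (0 : ℝ) 1) (a b : ℕ) :
    Antitone fun v => betaC α (a + v) * betaC α (b + v) := fun i j h =>
  mul_le_mul (betaC_antitone hα (by omega)) (betaC_antitone hα (by omega))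
    (betaC_pos hα.1 _).le (betaC_pos hα.1 _).le

theorem altCorr_mem_Icc {α : ℝ} (hα : α ∈ Set.Ioo (0 : ℝ) 1) (m n : ℕ) :
    altCorr α m n ∈ Set.Icc 0 (betaC α m) := by
  have := sum_neg_one_pow_mul_mem_Icc (antitone_betaC_mul_betaC hα 0 m)
    (fun v => (mul_pos (betaC_pos hα.1 _) (betaC_pos hα.1 _)).le) (n + 1)
  simpa [altCorr, betaC_zero hα.1] using this

theorem tendsto_betaC_add_div {α : ℝ} (hα : 0 < α) (v : ℕ) :
    Tendsto (fun m => betaC α (m + v) / betaC α m) atTop (𝓝 1) := by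
  induction v with
  | zero => simp [div_self (betaC_pos hα _).ne']
  | succ v ih =>
    have h : Tendsto (fun m : ℕ => (α + (m + v : ℕ)) / ((m + v : ℕ) + 1)) atTop (𝓝 1) := by
      have : Tendsto (fun m : ℕ => (α + m) / (m + 1)) atTop (𝓝 1) := by
        have h1 : Tendsto (fun m : ℕ => 1 + (α - 1) * (1 / ((m : ℝ) + 1))) atTop
            (𝓝 (1 + (α - 1) * 0)) :=
          (tendsto_one_div_add_atTop_nhds_zero_nat.const_mul _).const_add _
        rw [mul_zero, add_zero] at h1
        refine h1.congr fun m => ?_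
        field_simp
        ring
      exact (tendsto_add_atTop_iff_nat v).2 this
    have h2 := ih.mul h
    rw [mul_one] at h2
    refine h2.congr fun m => ?_
    rw [← add_assoc, betaC_succ hα, mul_div_right_comm]

theorem tendsto_altCorr_div_betaC {α : ℝ} (hα : α ∈ Set.Ioo (0 : ℝ) 1) :
    Tendsto (fun p : ℕ × ℕ => altCorr α p.1 p.2 / betaC α p.1) (atTop ×ˢ atTop)
      (𝓝 ((2 : ℝ) ^ (-α))) := by
  rw [Metric.tendsto_nhds]
  intro ε hε
  obtain ⟨U, hU1, hU2⟩ := (((Metric.tendsto_nhds.1 (tendsto_alternating_betaC hα) (ε / 3)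
    (by positivity))).and ((tendsto_betaC_zero hα).eventually_lt_const
      (show 0 < ε / 3 by positivity))).exists
  have h3 : Tendsto (fun m => ∑ i ∈ Finset.range U,
      (-1 : ℝ) ^ i * (betaC α i * (betaC α (m + i) / betaC α m))) atTop
      (𝓝 (∑ i ∈ Finset.range U, (-1 : ℝ) ^ i * (betaC α i * 1))) :=
    tendsto_finsetSum _ fun i _ => ((tendsto_betaC_add_div hα.1 i).const_mul _).const_mul _
  have h4 := Metric.tendsto_nhds.1 h3 (ε / 3) (by positivity)
  filter_upwards [h4.prod_mk (eventually_ge_atTop U)] with p hp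
  obtain ⟨hp1, hp2⟩ := hp
  obtain ⟨m, n⟩ := p
  simp only at hp1 hp2 ⊢
  obtain ⟨d, rfl⟩ := Nat.exists_eq_add_of_le hp2
  have hb := betaC_pos hα.1 m
  have htail := sum_neg_one_pow_mul_mem_Icc (antitone_betaC_mul_betaC hα U (m + U))
    (fun v => (mul_pos (betaC_pos hα.1 _) (betaC_pos hα.1 _)).le) (d + 1)
  have hsplit : altCorr α m (U + d) / betaC α m =
      ∑ i ∈ Finset.range U, (-1 : ℝ) ^ i * (betaC α i * (betaC α (m + i) / betaC α m)) +
      (-1 : ℝ) ^ U * ((∑ i ∈ Finset.range (d + 1), (-1 : ℝ) ^ i *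
        (betaC α (U + i) * betaC α (m + U + i))) / betaC α m) := by
    rw [altCorr, add_assoc, Finset.sum_range_add, add_div, Finset.sum_div, Finset.sum_div,
      Finset.sum_div, Finset.mul_sum]
    congr 1
    · exact Finset.sum_congr rfl fun i _ => by ring
    · exact Finset.sum_congr rfl fun i _ => by rw [add_assoc]; ring
  have htail2 : |(-1 : ℝ) ^ U * ((∑ i ∈ Finset.range (d + 1), (-1 : ℝ) ^ i *
        (betaC α (U + i) * betaC α (m + U + i))) / betaC α m)| < ε / 3 := by
    rw [abs_mul, abs_pow, abs_neg, abs_one, one_pow, one_mul,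
      abs_of_nonneg (div_nonneg htail.1 hb.le), div_lt_iff₀ hb]
    refine htail.2.trans_lt ?_
    simp only [add_zero]
    exact mul_lt_mul hU2 (betaC_antitone hα (by omega)) (betaC_pos hα.1 _) (by positivity)
  rw [hsplit]
  simp only [mul_one, Real.dist_eq] at hp1 hU1 ⊢
  rw [abs_lt] at *
  constructor <;> linarith [hp1.1, hp1.2, hU1.1, hU1.2, htail2.1, htail2.2]

theorem tendsto_atTop_of_tendsto_div {k : ℕ → ℕ} {x : ℝ} (hx : 0 < x)
    (hk : Tendsto (fun N : ℕ => (k N : ℝ) / (N : ℝ)) atTop (𝓝 x)) : Tendsto k atTop atTop := by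
  have : Tendsto (fun N => (k N : ℝ)) atTop atTop := by
    refine (hk.pos_mul_atTop hx tendsto_natCast_atTop_atTop).congr' ?_
    filter_upwards [eventually_gt_atTop 0] with N hN
    field_simp
  exact tendsto_natCast_atTop_iff.1 this

theorem tendsto_altCorr_mul_rpow {α : ℝ} (hα : α ∈ Set.Ioo (0 : ℝ) 1) {m n : ℕ → ℕ} {y : ℝ}
    (hy : 0 < y) (hn : Tendsto n atTop atTop)
    (hm : Tendsto (fun N => (m N : ℝ) / (N : ℝ)) atTop (𝓝 y)) :
    Tendsto (fun N : ℕ => (N : ℝ) ^ (1 - α) * altCorr α (m N) (n N)) atTop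
      (𝓝 (1 / ((2 : ℝ) ^ α * Real.Gamma α) * y ^ (α - 1))) := by
  have hmt : Tendsto m atTop atTop := tendsto_atTop_of_tendsto_div hy hm
  have h1 := (tendsto_altCorr_div_betaC hα).comp (hmt.prodMk hn)
  have h2 := (tendsto_betaC_mul_rpow hα.1).comp hmt
  have h3 := hm.rpow_const (p := α - 1) (Or.inl hy.ne')
  have h := (h1.mul h2).mul h3
  rw [show (2 : ℝ) ^ (-α) * (1 / Real.Gamma α) = 1 / ((2 : ℝ) ^ α * Real.Gamma α) by
    rw [Real.rpow_neg (by norm_num), one_div, one_div, mul_inv]] at h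
  refine h.congr' ?_
  filter_upwards [eventually_gt_atTop 0, hmt.eventually_gt_atTop 0] with N hN hmN
  have hN' : (0 : ℝ) < N := by exact_mod_cast hN
  have hm' : (0 : ℝ) < m N := by exact_mod_cast hmN
  have hb := (betaC_pos hα.1 (m N)).ne'
  have hp := (Real.rpow_pos_of_pos hm' (1 - α)).ne'
  simp only [Function.comp_apply]
  rw [Real.div_rpow hm'.le hN'.le, show α - 1 = -(1 - α) by ring, Real.rpow_neg hm'.le,
    Real.rpow_neg hN'.le]
  field_simp

theorem T1_one_of_le (α : ℝ) {k l : ℕ} (h : l ≤ k) : T1 α k l 1 = altCorr α (k - l) l := by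
  rw [T1, altCorr, Nat.sub_eq_zero_of_le h, ← Nat.range_succ_eq_Icc_zero]
  refine Finset.sum_congr rfl fun u _ => ?_
  have e : (k : ℤ) - l + u = ((k - l + u : ℕ) : ℤ) := by omega
  rw [e, betaCZ, if_pos (by omega), Int.toNat_natCast, one_zpow, mul_one, mul_assoc]

theorem T1_one_of_ge (α : ℝ) {k l : ℕ} (h : k ≤ l) :
    T1 α k l 1 = (-1) ^ (l - k) * altCorr α (l - k) k := by
  rw [T1, altCorr, ← Finset.Ico_add_one_right_eq_Icc, Finset.sum_Ico_eq_sum_range, Finset.mul_sum,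
    show l + 1 - (l - k) = k + 1 by omega]
  refine Finset.sum_congr rfl fun v _ => ?_
  have e : (k : ℤ) - l + ((l - k + v : ℕ) : ℤ) = (v : ℤ) := by omega
  rw [e, betaCZ, if_pos (by omega), Int.toNat_natCast, one_zpow, pow_add]
  ring

theorem abs_T1_one_le {α : ℝ} (hα : α ∈ Set.Ioo (0 : ℝ) 1) (k l : ℕ) :
    |T1 α k l 1| ≤ (|(k : ℝ) - l| + 1) ^ (α - 1) := by
  rcases le_total l k with h | h
  · have hm := altCorr_mem_Icc hα (k - l) l
    rw [T1_one_of_le α h, abs_of_nonneg hm.1, abs_of_nonneg (by simpa using h), ← Nat.cast_sub h]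
    exact hm.2.trans (betaC_le_rpow hα _)
  · have hm := altCorr_mem_Icc hα (l - k) k
    rw [T1_one_of_ge α h, abs_mul, abs_pow, abs_neg, abs_one, one_pow, one_mul,
      abs_of_nonneg hm.1, abs_sub_comm, abs_of_nonneg (by simpa using h), ← Nat.cast_sub h]
    exact hm.2.trans (betaC_le_rpow hα _)

theorem continuousAt_T1_one (α : ℝ) (k l : ℕ) : ContinuousAt (T1 α k l) 1 := by
  unfold T1
  refine tendsto_finsetSum _ fun u _ => ?_
  exact (continuousAt_zpow₀ (1 : ℝ) _ (Or.inl one_ne_zero)).const_mul _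

theorem LocLip01.continuousAt {f : ℝ → ℝ} (hf : LocLip01 f) {t : ℝ} (ht : t ∈ Set.Ioo (0 : ℝ) 1) :
    ContinuousAt f t := by
  obtain ⟨K, hK⟩ := hf (t / 2) ((1 + t) / 2) (by linarith [ht.1]) (by linarith)
    (by linarith [ht.2])
  rw [ContinuousAt, tendsto_iff_dist_tendsto_zero]
  have h0 : Tendsto (fun z => K * |z - t|) (𝓝 t) (𝓝 0) := by
    have : ContinuousAt (fun z => K * |z - t|) t := by fun_prop
    simpa using this.tendsto
  refine squeeze_zero' (Eventually.of_forall fun _ => dist_nonneg) ?_ h0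
  filter_upwards [Icc_mem_nhds (show t / 2 < t by linarith [ht.1])
    (show t < (1 + t) / 2 by linarith [ht.2])] with z hz
  exact hK z hz t ⟨by linarith [ht.1], by linarith [ht.2]⟩

theorem exists_bound_near_zero {α : ℝ} {γ : ℝ} (hγ : γ ≤ 1 - α)
    {f : ℝ → ℝ} (h : f =O[nhdsWithin 0 (Set.Ioi 0)] fun t : ℝ => t ^ (-γ)) :
    ∃ C > 0, ∃ δ > 0, ∀ t, 0 < t → t < δ → t < 1 → |f t| ≤ C * t ^ (α - 1) := by
  obtain ⟨C, hC, hb⟩ := h.exists_pos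
  obtain ⟨δ, hδ, hs⟩ := mem_nhdsGT_iff_exists_Ioo_subset.1 hb.bound
  refine ⟨C, hC, δ, hδ, fun t h0 h1 h2 => ?_⟩
  have h3 := hs ⟨h0, h1⟩
  simp only [Set.mem_ofPred_eq, Real.norm_eq_abs] at h3
  refine h3.trans ?_
  rw [abs_of_pos (Real.rpow_pos_of_pos h0 _)]
  exact mul_le_mul_of_nonneg_left
    (Real.rpow_le_rpow_of_exponent_ge h0 h2.le (by linarith)) hC.le

theorem exists_bound_of_memL1Class {α : ℝ} (hα : α ∈ Set.Ioo (0 : ℝ) 1) {f : ℝ → ℝ}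
    (hlip : LocLip01 f) (hmem : MemL1Class α f) :
    ∃ C, 0 ≤ C ∧ ∀ t ∈ Set.Ioo (0 : ℝ) 1, |f t| ≤ C * (t ^ (α - 1) + (1 - t) ^ (α - 1)) := by
  obtain ⟨γ, -, hγ, h0, h1⟩ := hmem
  obtain ⟨C0, hC0, δ0, hδ0, hb0⟩ := exists_bound_near_zero hγ h0
  obtain ⟨C1, hC1, δ1, hδ1, hb1⟩ := exists_bound_near_zero hγ h1
  have hcont : ContinuousOn f (Set.Icc (min δ0 (1 / 2)) (1 - min δ1 (1 / 2))) := fun t ht =>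
    (hlip.continuousAt ⟨lt_of_lt_of_le (lt_min hδ0 (by norm_num)) ht.1,
      lt_of_le_of_lt ht.2 (by linarith [lt_min hδ1 (show (0 : ℝ) < 1 / 2 by norm_num)])⟩
      ).continuousWithinAt
  obtain ⟨C2, hC2⟩ := isCompact_Icc.exists_bound_of_continuousOn hcont
  refine ⟨max (max C0 C1) C2, by positivity, fun t ht => ?_⟩
  have hp0 : 1 ≤ t ^ (α - 1) :=
    Real.one_le_rpow_of_pos_of_le_one_of_nonpos ht.1 ht.2.le (by linarith [hα.2])
  have hp1 : 1 ≤ (1 - t) ^ (α - 1) :=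
    Real.one_le_rpow_of_pos_of_le_one_of_nonpos (by linarith [ht.2]) (by linarith [ht.1])
      (by linarith [hα.2])
  have hM : 0 ≤ max (max C0 C1) C2 := by positivity
  by_cases c0 : t < δ0
  · calc |f t| ≤ C0 * t ^ (α - 1) := hb0 t ht.1 c0 ht.2
      _ ≤ max (max C0 C1) C2 * (t ^ (α - 1) + (1 - t) ^ (α - 1)) := by
        gcongr
        · exact (le_max_left _ _).trans (le_max_left _ _)
        · linarith
  by_cases c1 : 1 - t < δ1
  · have := hb1 (1 - t) (by linarith [ht.2]) c1 (by linarith [ht.1])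
    rw [sub_sub_cancel] at this
    calc |f t| ≤ C1 * (1 - t) ^ (α - 1) := this
      _ ≤ max (max C0 C1) C2 * (t ^ (α - 1) + (1 - t) ^ (α - 1)) := by
        gcongr
        · exact (le_max_right _ _).trans (le_max_left _ _)
        · linarith
  have hmem : t ∈ Set.Icc (min δ0 (1 / 2)) (1 - min δ1 (1 / 2)) := by
    rw [not_lt] at c0 c1
    exact ⟨(min_le_left _ _).trans c0, by linarith [min_le_left δ1 (1 / 2)]⟩
  calc |f t| ≤ C2 := hC2 t hmem
    _ ≤ max (max C0 C1) C2 := le_max_right _ _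
    _ ≤ max (max C0 C1) C2 * (t ^ (α - 1) + (1 - t) ^ (α - 1)) :=
      le_mul_of_one_le_right hM (by linarith)

theorem div_two_rpow_le {α u v : ℝ} (hα : α ≤ 1) (hu : 0 < u) (h : u / 2 ≤ v) :
    v ^ (α - 1) ≤ 2 ^ (1 - α) * u ^ (α - 1) := by
  have h1 : v ^ (α - 1) ≤ (u / 2) ^ (α - 1) :=
    Real.rpow_le_rpow_of_nonpos (by positivity) h (by linarith)
  refine h1.trans_eq ?_
  rw [Real.div_rpow hu.le (by norm_num), show 1 - α = -(α - 1) by ring,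
    Real.rpow_neg (by norm_num)]
  ring

theorem abs_Xvec_le {α C : ℝ} (hα : α ∈ Set.Ioo (0 : ℝ) 1) {f : ℝ → ℝ} (hC : 0 ≤ C)
    (hf : ∀ t ∈ Set.Ioo (0 : ℝ) 1, |f t| ≤ C * (t ^ (α - 1) + (1 - t) ^ (α - 1)))
    {N l : ℕ} (hl : l ≤ N) {t : ℝ} (ht : t ∈ Set.Ioo (0 : ℝ) 1) (htl : |N * t - l| ≤ 1) :
    |Xvec f N l| ≤ C * 2 ^ (1 - α) * (t ^ (α - 1) + (1 - t) ^ (α - 1)) := by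
  have ht1 : 0 < 1 - t := by linarith [ht.2]
  have ht0 := ht.1
  unfold Xvec
  split_ifs with h
  · rw [abs_zero]; positivity
  rw [not_or] at h
  have hl1 : (1 : ℝ) ≤ l := by exact_mod_cast Nat.one_le_iff_ne_zero.2 h.1
  have hl2 : (l : ℝ) + 1 ≤ N := by exact_mod_cast lt_of_le_of_ne hl h.2
  have hN : (0 : ℝ) < N := by linarith
  rw [abs_le] at htl
  refine (hf _ ⟨by positivity, by rw [div_lt_one hN]; linarith⟩).trans ?_
  have a1 := div_two_rpow_le (v := (l : ℝ) / N) hα.2.le ht0 (by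
    rw [div_le_div_iff₀ (by norm_num) hN]; linarith)
  have a2 := div_two_rpow_le (v := 1 - (l : ℝ) / N) hα.2.le ht1 (by
    rw [one_sub_div hN.ne', div_le_div_iff₀ (by norm_num) hN]; linarith)
  rw [mul_assoc]
  refine mul_le_mul_of_nonneg_left ?_ hC
  linarith

theorem rpow_mul_abs_T1_le {α : ℝ} (hα : α ∈ Set.Ioo (0 : ℝ) 1) {N k l : ℕ} (hN : 0 < N)
    {x t : ℝ} (hxt : t ≠ x) (hk : |N * x - k| ≤ 1) (hl : |N * t - l| ≤ 1) :
    (N : ℝ) ^ (1 - α) * |T1 α k l 1| ≤ 2 ^ (1 - α) * |x - t| ^ (α - 1) := by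
  have hN' : (0 : ℝ) < N := by exact_mod_cast hN
  have hpos : 0 < |x - t| := abs_pos.2 (sub_ne_zero.2 hxt.symm)
  have h1 : (N : ℝ) * |x - t| ≤ |(k : ℝ) - l| + 2 := by
    have : (N : ℝ) * |x - t| = |(N * x - k) + (k - l) - (N * t - l)| := by
      rw [← abs_of_pos hN', ← abs_mul, abs_of_pos hN']; congr 1; ring
    rw [this]
    have t1 := abs_sub ((N * x - k) + ((k : ℝ) - l)) (N * t - l)
    have t2 := abs_add_le (N * x - k) ((k : ℝ) - l)
    linarith
  have h2 := div_two_rpow_le (v := (|(k : ℝ) - l| + 1) / N) hα.2.le hpos (by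
    rw [div_le_div_iff₀ (by norm_num) hN']
    linarith [abs_nonneg ((k : ℝ) - l)])
  refine le_trans ?_ h2
  rw [Real.div_rpow (by positivity) hN'.le, show α - 1 = -(1 - α) by ring, Real.rpow_neg hN'.le,
    div_inv_eq_mul, mul_comm]
  refine mul_le_mul_of_nonneg_right ?_ (by positivity)
  have := abs_T1_one_le hα k l
  rwa [show α - 1 = -(1 - α) by ring] at this

theorem intervalIntegrable_abs_sub_rpow {r : ℝ} (hr : -1 < r) (c a b : ℝ) :
    IntervalIntegrable (fun t : ℝ => |c - t| ^ r) volume a b := by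
  have hpos : ∀ d : ℝ, 0 ≤ d → IntervalIntegrable (fun t : ℝ => |t| ^ r) volume 0 d := by
    intro d hd
    refine (intervalIntegral.intervalIntegrable_rpow' (a := 0) (b := d) hr).congr ?_
    intro t ht
    rw [Set.uIoc_of_le hd] at ht
    simp [abs_of_pos ht.1]
  have hz : ∀ d : ℝ, IntervalIntegrable (fun t : ℝ => |t| ^ r) volume 0 d := by
    intro d
    rcases le_total 0 d with hd | hd
    · exact hpos d hd
    · rw [IntervalIntegrable.iff_comp_neg]
      simpa using hpos (-d) (by linarith)
  have h := ((hz (c - a)).symm.trans (hz (c - b))).comp_sub_left c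
  simpa using h

theorem integrableOn_abs_sub_rpow_mul {r : ℝ} (hr : r ∈ Set.Ioo (-1 : ℝ) 0) {c d : ℝ}
    (hcd : c ≠ d) : IntegrableOn (fun t : ℝ => |c - t| ^ r * |d - t| ^ r) (Set.Ioo 0 1) := by
  have hint : ∀ e : ℝ, IntegrableOn (fun t : ℝ => |e - t| ^ r) (Set.Ioo 0 1) := fun e =>
    ((intervalIntegrable_iff_integrableOn_Ioc_of_le zero_le_one).1
      (intervalIntegrable_abs_sub_rpow hr.1 e 0 1)).mono_set Set.Ioo_subset_Ioc_self
  have hpos : 0 < |c - d| / 2 := by have := abs_pos.2 (sub_ne_zero.2 hcd); positivity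
  refine Integrable.mono' (((hint c).add (hint d)).const_mul ((|c - d| / 2) ^ r))
    ((hint c).aestronglyMeasurable.mul (hint d).aestronglyMeasurable) ?_
  refine Eventually.of_forall fun t => ?_
  have hc : 0 ≤ |c - t| ^ r := by positivity
  have hd : 0 ≤ |d - t| ^ r := by positivity
  have he : 0 ≤ (|c - d| / 2) ^ r := by positivity
  rw [Real.norm_of_nonneg (mul_nonneg hc hd)]
  simp only [Pi.add_apply]
  have htri : |c - d| ≤ |c - t| + |d - t| := by
    have := abs_sub_le c t d
    rwa [abs_sub_comm t d] at this
  rcases le_total (|c - d| / 2) (|c - t|) with h | h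
  · have := Real.rpow_le_rpow_of_nonpos hpos h hr.2.le
    nlinarith
  · have := Real.rpow_le_rpow_of_nonpos hpos (show |c - d| / 2 ≤ |d - t| by linarith) hr.2.le
    nlinarith

theorem integral_comp_floor_mul {N : ℕ} (hN : 0 < N) (h : ℕ → ℝ) :
    ∫ t in Set.Ioo (0 : ℝ) 1, h ⌊(N : ℝ) * t⌋₊ = (1 / N) * ∑ l ∈ Finset.range N, h l := by
  have hN' : (0 : ℝ) < N := by exact_mod_cast hN
  have hae : ∀ l : ℕ, ∀ t ∈ Set.Ioo ((l : ℝ) / N) ((l + 1 : ℕ) / N), h ⌊(N : ℝ) * t⌋₊ = h l := by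
    intro l t ht
    rw [Set.mem_Ioo, div_lt_iff₀ hN', lt_div_iff₀ hN'] at ht
    push_cast at ht
    congr 1
    rw [Nat.floor_eq_iff (by nlinarith [(Nat.cast_nonneg l : (0 : ℝ) ≤ l), ht.1])]
    constructor <;> linarith
  have hle : ∀ l : ℕ, (l : ℝ) / N ≤ ((l + 1 : ℕ) : ℝ) / N := fun l => by gcongr; omega
  have hint : ∀ l < N, IntervalIntegrable (fun t : ℝ => h ⌊(N : ℝ) * t⌋₊) volume
      ((l : ℝ) / N) ((l + 1 : ℕ) / N) := by
    intro l _
    rw [intervalIntegrable_iff_integrableOn_Ioo_of_le (hle l)]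
    refine IntegrableOn.congr_fun (f := fun _ => h l) ?_ (fun t ht => (hae l t ht).symm)
      measurableSet_Ioo
    simp
  have h1 := intervalIntegral.sum_integral_adjacent_intervals (a := fun l : ℕ => (l : ℝ) / N) hint
  rw [← integral_Ioc_eq_integral_Ioo, ← intervalIntegral.integral_of_le zero_le_one]
  simp only [Nat.cast_zero, zero_div, div_self hN'.ne'] at h1
  rw [← h1, Finset.mul_sum]
  refine Finset.sum_congr rfl fun l _ => ?_
  rw [intervalIntegral.integral_of_le (hle l), integral_Ioc_eq_integral_Ioo,
    setIntegral_congr_fun measurableSet_Ioo (hae l)]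
  simp only [setIntegral_const, smul_eq_mul]
  rw [Measure.real, Real.volume_Ioo, ENNReal.toReal_ofReal (by linarith [hle l])]
  push_cast
  field_simp
  ring

theorem tendsto_floor_add_div {y : ℝ} (hy : 0 ≤ y) (i : ℕ) :
    Tendsto (fun N : ℕ => ((⌊(N : ℝ) * y⌋₊ + i : ℕ) : ℝ) / (N : ℝ)) atTop (𝓝 y) := by
  have h1 := (tendsto_nat_floor_mul_div_atTop hy).comp (tendsto_natCast_atTop_atTop (R := ℝ))
  have h2 := h1.add (tendsto_const_div_atTop_nhds_zero_nat (i : ℝ))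
  rw [add_zero] at h2
  refine h2.congr fun N => ?_
  simp only [Function.comp_apply]
  push_cast
  rw [add_div, mul_comm]

theorem tendsto_nat_sub_div {k l : ℕ → ℕ} {x t : ℝ} (hxt : t < x)
    (hk : Tendsto (fun N : ℕ => (k N : ℝ) / (N : ℝ)) atTop (𝓝 x))
    (hl : Tendsto (fun N : ℕ => (l N : ℝ) / (N : ℝ)) atTop (𝓝 t)) :
    (∀ᶠ N in atTop, l N ≤ k N) ∧
      Tendsto (fun N : ℕ => ((k N - l N : ℕ) : ℝ) / (N : ℝ)) atTop (𝓝 (x - t)) := by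
  have h1 : ∀ᶠ N in atTop, l N ≤ k N := by
    filter_upwards [hl.eventually_lt hk hxt, eventually_gt_atTop 0] with N h hN
    have hN' : (0 : ℝ) < N := by exact_mod_cast hN
    rw [div_lt_div_iff_of_pos_right hN'] at h
    exact_mod_cast h.le
  refine ⟨h1, (hk.sub hl).congr' ?_⟩
  filter_upwards [h1] with N h
  rw [Nat.cast_sub h, sub_div]

theorem tendsto_Xvec {f : ℝ → ℝ} (hf : LocLip01 f) {l : ℕ → ℕ} {t : ℝ}
    (ht : t ∈ Set.Ioo (0 : ℝ) 1)
    (hl : Tendsto (fun N : ℕ => (l N : ℝ) / (N : ℝ)) atTop (𝓝 t)) :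
    Tendsto (fun N => Xvec f N (l N)) atTop (𝓝 (f t)) := by
  refine ((hf.continuousAt ht).tendsto.comp hl).congr' ?_
  filter_upwards [hl.eventually_mem (Ioo_mem_nhds ht.1 ht.2)] with N h
  rw [Xvec, if_neg]
  · rfl
  rintro (h0 | h0)
  · simp [h0] at h
  · rw [h0] at h
    rcases eq_or_ne (N : ℝ) 0 with h' | h' <;> simp [h'] at h

theorem tendsto_T1_mul_Xvec_of_lt {α : ℝ} (hα : α ∈ Set.Ioo (0 : ℝ) 1) {f : ℝ → ℝ}
    (hf : LocLip01 f) {k l : ℕ → ℕ} {x t : ℝ} (ht : t ∈ Set.Ioo (0 : ℝ) 1) (htx : t < x)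
    (hk : Tendsto (fun N : ℕ => (k N : ℝ) / (N : ℝ)) atTop (𝓝 x))
    (hl : Tendsto (fun N : ℕ => (l N : ℝ) / (N : ℝ)) atTop (𝓝 t)) :
    Tendsto (fun N : ℕ => (N : ℝ) ^ (1 - α) * (T1 α (k N) (l N) 1 * Xvec f N (l N))) atTop
      (𝓝 (1 / ((2 : ℝ) ^ α * Real.Gamma α) * (x - t) ^ (α - 1) * f t)) := by
  obtain ⟨hle, hm⟩ := tendsto_nat_sub_div htx hk hl
  refine ((tendsto_altCorr_mul_rpow hα (sub_pos.2 htx)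
    (tendsto_atTop_of_tendsto_div ht.1 hl) hm).mul (tendsto_Xvec hf ht hl)).congr' ?_
  filter_upwards [hle] with N h
  rw [T1_one_of_le α h, mul_assoc]

theorem tendsto_T1_mul_Xvec_add_succ_of_gt {α : ℝ} (hα : α ∈ Set.Ioo (0 : ℝ) 1) {f : ℝ → ℝ}
    (hf : LocLip01 f) {k l : ℕ → ℕ} {x t : ℝ} (ht : t ∈ Set.Ioo (0 : ℝ) 1) (hx : 0 < x)
    (hxt : x < t)
    (hk : Tendsto (fun N : ℕ => (k N : ℝ) / (N : ℝ)) atTop (𝓝 x))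
    (hl : Tendsto (fun N : ℕ => (l N : ℝ) / (N : ℝ)) atTop (𝓝 t))
    (hl' : Tendsto (fun N : ℕ => ((l N + 1 : ℕ) : ℝ) / (N : ℝ)) atTop (𝓝 t)) :
    Tendsto (fun N : ℕ => (N : ℝ) ^ (1 - α) * (T1 α (k N) (l N) 1 * Xvec f N (l N) +
      T1 α (k N) (l N + 1) 1 * Xvec f N (l N + 1))) atTop (𝓝 0) := by
  obtain ⟨hle, hm⟩ := tendsto_nat_sub_div hxt hl hk
  obtain ⟨-, hm'⟩ := tendsto_nat_sub_div hxt hl' hk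
  have hkt := tendsto_atTop_of_tendsto_div hx hk
  have h := ((tendsto_altCorr_mul_rpow hα (sub_pos.2 hxt) hkt hm).mul (tendsto_Xvec hf ht hl)).sub
    ((tendsto_altCorr_mul_rpow hα (sub_pos.2 hxt) hkt hm').mul (tendsto_Xvec hf ht hl'))
  rw [sub_self] at h
  rw [tendsto_zero_iff_abs_tendsto_zero] at h ⊢
  refine h.congr' ?_
  filter_upwards [hle] with N hN
  simp only [Function.comp_apply]
  rw [T1_one_of_ge α hN, T1_one_of_ge α (hN.trans (Nat.le_succ _)),
    show l N + 1 - k N = (l N - k N) + 1 by omega, pow_succ]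
  have e : (N : ℝ) ^ (1 - α) * ((-1) ^ (l N - k N) * altCorr α (l N - k N) (k N) * Xvec f N (l N) +
      (-1) ^ (l N - k N) * -1 * altCorr α (l N - k N + 1) (k N) * Xvec f N (l N + 1)) =
      (-1) ^ (l N - k N) * ((N : ℝ) ^ (1 - α) * altCorr α (l N - k N) (k N) * Xvec f N (l N) -
        (N : ℝ) ^ (1 - α) * altCorr α (l N - k N + 1) (k N) * Xvec f N (l N + 1)) := by ring
  rw [e, abs_mul, abs_pow, abs_neg, abs_one, one_pow, one_mul]

theorem sum_range_succ_eq_half_sum_pairs {g : ℕ → ℝ} {N : ℕ} (h0 : g 0 = 0) (hN : g N = 0) :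
    ∑ l ∈ Finset.range (N + 1), g l = ∑ l ∈ Finset.range N, 1 / 2 * (g l + g (l + 1)) := by
  have h1 := Finset.sum_range_succ g N
  have h2 := Finset.sum_range_succ' g N
  rw [← Finset.mul_sum, Finset.sum_add_distrib]
  linarith

/-- Dominated convergence for the normalised step functions whose integrals are the sums
`N^{-α} ∑_l T₁(k,l,1) X_{N,l}`; neighbouring terms are averaged to cancel the oscillation. -/
theorem tendsto_integral_step {α : ℝ} (hα : α ∈ Set.Ioo (0 : ℝ) 1) {f : ℝ → ℝ}
    (hlip : LocLip01 f) (hmem : MemL1Class α f) {x : ℝ} (hx : x ∈ Set.Ioo (0 : ℝ) 1) :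
    Tendsto (fun N : ℕ => ∫ t in Set.Ioo (0 : ℝ) 1, (N : ℝ) ^ (1 - α) * (1 / 2 *
      (T1 α ⌊(N : ℝ) * x⌋₊ ⌊(N : ℝ) * t⌋₊ 1 * Xvec f N ⌊(N : ℝ) * t⌋₊ +
        T1 α ⌊(N : ℝ) * x⌋₊ (⌊(N : ℝ) * t⌋₊ + 1) 1 * Xvec f N (⌊(N : ℝ) * t⌋₊ + 1)))) atTop
      (𝓝 (1 / ((2 : ℝ) ^ α * Real.Gamma α) * ∫ t in (0 : ℝ)..x, (x - t) ^ (α - 1) * f t)) := by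
  obtain ⟨C, hC, hbd⟩ := exists_bound_of_memL1Class hα hlip hmem
  have hlim : (1 / ((2 : ℝ) ^ α * Real.Gamma α) * ∫ t in (0 : ℝ)..x, (x - t) ^ (α - 1) * f t) =
      ∫ t in Set.Ioo (0 : ℝ) 1, (Set.Iio x).indicator
        (fun t => 1 / ((2 : ℝ) ^ α * Real.Gamma α) * (x - t) ^ (α - 1) * f t) t := by
    rw [setIntegral_indicator measurableSet_Iio, intervalIntegral.integral_of_le hx.1.le,
      integral_Ioc_eq_integral_Ioo, ← integral_const_mul, Set.Ioo_inter_Iio, min_eq_right hx.2.le]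
    simp only [mul_assoc]
  rw [hlim]
  set M : ℝ := 2 ^ (1 - α) * (C * 2 ^ (1 - α)) with hM
  have hα' : α - 1 ∈ Set.Ioo (-1 : ℝ) 0 := ⟨by linarith [hα.1], by linarith [hα.2]⟩
  have hx_ne : ∀ᵐ t ∂(volume.restrict (Set.Ioo (0 : ℝ) 1)), t ≠ x :=
    ae_restrict_of_ae (Measure.ae_ne volume x)
  refine tendsto_integral_filter_of_dominated_convergence
    (fun t => M * (|x - t| ^ (α - 1) * |0 - t| ^ (α - 1) +
      |x - t| ^ (α - 1) * |1 - t| ^ (α - 1))) ?_ ?_ ?_ ?_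
  · refine Eventually.of_forall fun N => Measurable.aestronglyMeasurable ?_
    have hfl : Measurable fun t : ℝ => ⌊(N : ℝ) * t⌋₊ :=
      Nat.measurable_floor.comp (measurable_const_mul _)
    exact (measurable_from_nat (f := fun l => (N : ℝ) ^ (1 - α) * (1 / 2 *
      (T1 α ⌊(N : ℝ) * x⌋₊ l 1 * Xvec f N l +
        T1 α ⌊(N : ℝ) * x⌋₊ (l + 1) 1 * Xvec f N (l + 1))))).comp hfl
  · filter_upwards [eventually_gt_atTop 0] with N hN
    filter_upwards [hx_ne, ae_restrict_mem measurableSet_Ioo] with t htx ht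
    have hN' : (0 : ℝ) < N := by exact_mod_cast hN
    have hfl1 := Nat.floor_le (mul_pos hN' ht.1).le
    have hfl2 := Nat.lt_floor_add_one ((N : ℝ) * t)
    have hk : |(N : ℝ) * x - ⌊(N : ℝ) * x⌋₊| ≤ 1 := by
      have h1 := Nat.floor_le (mul_pos hN' hx.1).le
      have h2 := Nat.lt_floor_add_one ((N : ℝ) * x)
      rw [abs_le]; constructor <;> linarith
    have hlN : ⌊(N : ℝ) * t⌋₊ < N := by
      rw [Nat.floor_lt (mul_pos hN' ht.1).le]
      nlinarith [ht.2]
    have hterm : ∀ l ≤ N, |N * t - l| ≤ 1 →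
        |(N : ℝ) ^ (1 - α) * (T1 α ⌊(N : ℝ) * x⌋₊ l 1 * Xvec f N l)| ≤
        M * (|x - t| ^ (α - 1) * |0 - t| ^ (α - 1) + |x - t| ^ (α - 1) * |1 - t| ^ (α - 1)) := by
      intro l hl htl
      have a1 := rpow_mul_abs_T1_le hα hN htx hk htl
      have a2 := abs_Xvec_le hα hC hbd hl ht htl
      rw [← mul_assoc, abs_mul, abs_mul, abs_of_nonneg (Real.rpow_nonneg hN'.le (1 - α)), zero_sub,
        abs_neg, abs_of_pos ht.1, abs_of_pos (sub_pos.2 ht.2)]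
      refine (mul_le_mul a1 a2 (abs_nonneg _) (by positivity)).trans_eq ?_
      rw [hM]; ring
    have b1 := hterm _ hlN.le (by rw [abs_le]; constructor <;> linarith)
    have b2 := hterm (⌊(N : ℝ) * t⌋₊ + 1) hlN
      (by push_cast; rw [abs_le]; constructor <;> linarith)
    rw [Real.norm_eq_abs]
    rw [abs_le] at *
    constructor <;> linarith [b1.1, b1.2, b2.1, b2.2]
  · exact ((integrableOn_abs_sub_rpow_mul hα' hx.1.ne').add
      (integrableOn_abs_sub_rpow_mul hα' hx.2.ne)).const_mul M
  · filter_upwards [hx_ne, ae_restrict_mem measurableSet_Ioo] with t htx ht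
    have hk := tendsto_floor_add_div hx.1.le 0
    have hl := tendsto_floor_add_div ht.1.le 0
    have hl' := tendsto_floor_add_div ht.1.le 1
    simp only [add_zero] at hk hl
    rcases lt_or_gt_of_ne htx with h | h
    · rw [Set.indicator_of_mem (Set.mem_Iio.2 h)]
      have := ((tendsto_T1_mul_Xvec_of_lt hα hlip ht h hk hl).add
        (tendsto_T1_mul_Xvec_of_lt hα hlip ht h hk hl')).const_mul (1 / 2)
      convert! this using 2 <;> ring
    · rw [Set.indicator_of_notMem (by simpa using h.le)]
      have := (tendsto_T1_mul_Xvec_add_succ_of_gt hα hlip ht hx.1 h hk hl hl').const_mul (1 / 2)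
      convert! this using 2 <;> ring

/-- For `N` large, `S_N = lim_{R→1⁻} Σ_l T₁(⌊Nx⌋,l,R) X_{N,l}` exists and
`S_N = N^α (1/(2^α Γ(α))) ∫₀^x (x-t)^{α-1} f(t) dt + o(N^α)`. -/
theorem T1_sum_limit (α : ℝ) (hα : α ∈ Set.Ioo (0 : ℝ) 1) (f : ℝ → ℝ)
    (hlip : LocLip01 f) (hmem : MemL1Class α f) (x : ℝ) (hx : x ∈ Set.Ioo (0 : ℝ) 1) :
    ∃ S : ℕ → ℝ,
      (∀ᶠ N : ℕ in atTop,
        Tendsto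
          (fun R : ℝ => ∑ l ∈ Finset.range (N + 1), T1 α (⌊(N : ℝ) * x⌋).toNat l R * Xvec f N l)
          (nhdsWithin 1 (Set.Iio 1)) (nhds (S N))) ∧
      (fun N : ℕ => S N -
          (N : ℝ) ^ α * (1 / ((2 : ℝ) ^ α * Real.Gamma α)) *
            ∫ t in (0 : ℝ)..x, (x - t) ^ (α - 1) * f t)
        =o[atTop] fun N : ℕ => (N : ℝ) ^ α := by
  refine ⟨fun N => ∑ l ∈ Finset.range (N + 1), T1 α ⌊(N : ℝ) * x⌋.toNat l 1 * Xvec f N l,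
    Eventually.of_forall fun N => ?_, ?_⟩
  · exact (tendsto_finsetSum _ fun l _ =>
      (continuousAt_T1_one α _ l).tendsto.mul_const _).mono_left nhdsWithin_le_nhds
  · refine (isLittleO_iff_tendsto' ?_).2 ?_
    · filter_upwards [eventually_gt_atTop 0] with N hN h
      have : (0 : ℝ) < (N : ℝ) ^ α := Real.rpow_pos_of_pos (by exact_mod_cast hN) α
      exact absurd h this.ne'
    have h := (tendsto_integral_step hα hlip hmem hx).sub_const
      (1 / ((2 : ℝ) ^ α * Real.Gamma α) * ∫ t in (0 : ℝ)..x, (x - t) ^ (α - 1) * f t)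
    rw [sub_self] at h
    refine h.congr' ?_
    filter_upwards [eventually_gt_atTop 0] with N hN
    have hN' : (0 : ℝ) < N := by exact_mod_cast hN
    have hp : (0 : ℝ) < (N : ℝ) ^ α := Real.rpow_pos_of_pos hN' α
    rw [integral_comp_floor_mul hN (fun l => (N : ℝ) ^ (1 - α) * (1 / 2 *
      (T1 α ⌊(N : ℝ) * x⌋₊ l 1 * Xvec f N l +
        T1 α ⌊(N : ℝ) * x⌋₊ (l + 1) 1 * Xvec f N (l + 1)))), ← Finset.mul_sum, Int.floor_toNat,
      sum_range_succ_eq_half_sum_pairs (by simp [Xvec]) (by simp [Xvec]), Real.rpow_sub hN',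
      Real.rpow_one]
    field_simp
end

section
/- Let α ∈ (0,1) and let f : (0,1) → ℝ be locally Lipschitz on (0,1) and belong to L¹_{1−α}((0,1)). Then for every x ∈ (0,1): for N sufficiently large the inner limit L_N := lim_{R→1⁻} N^{−α} Σ_{l=0}^{N} (T_{N,α,R}^{−1})_{⌊Nx⌋+1, l+1} · X_{N,l} exists, and lim_{N→∞} L_N = (1/(2^α Γ(α))) ∫₀^x (x−t)^{α−1} f(t) dt. In other words, the fractional integral J_α(f)(x) exists and equals (1/(2^α Γ(α))) ∫₀^x f(t)/(x−t)^{1−α} dt. -/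
open MeasureTheory Filter Asymptotics

/-- The `n`-th Fourier coefficient of `φ_{α,R}(θ) = (1-Re^{iθ})^α (1+Re^{-iθ})^α`. -/
noncomputable def phiHatR (α R : ℝ) (n : ℤ) : ℂ :=
  (1 / (2 * (Real.pi : ℂ))) * ∫ θ in (-Real.pi)..Real.pi,
    (1 - (R : ℂ) * Complex.exp ((θ : ℂ) * Complex.I)) ^ (α : ℂ) *
      (1 + (R : ℂ) * Complex.exp (-(θ : ℂ) * Complex.I)) ^ (α : ℂ) *
      Complex.exp (-(n : ℂ) * (θ : ℂ) * Complex.I)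

/-- The `(N+1) × (N+1)` Toeplitz matrix `T_{N,α,R}` with symbol `φ_{α,R}`. -/
noncomputable def TNmat (α R : ℝ) (N : ℕ) : Matrix (Fin (N + 1)) (Fin (N + 1)) ℂ :=
  fun k l => phiHatR α R ((k : ℤ) - (l : ℤ))

/-- The row index `⌊Nx⌋` as an element of `Fin (N+1)` (for `x ∈ (0,1)` and `N ≥ 1`
this is exactly `⌊Nx⌋`). -/
noncomputable def rowIdx (N : ℕ) (x : ℝ) : Fin (N + 1) :=
  ⟨min (⌊(N : ℝ) * x⌋).toNat N, Nat.lt_succ_of_le (min_le_right _ _)⟩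

namespace FractionalToeplitz

open Finset

/-- The Taylor coefficients of `(1 - z) ^ (-β)`. -/
noncomputable def binCoef (β : ℝ) (n : ℕ) : ℝ := ∏ j ∈ range n, (β + j) / (j + 1)

@[simp] lemma binCoef_zero (β : ℝ) : binCoef β 0 = 1 := by simp [binCoef]

lemma binCoef_succ (β : ℝ) (n : ℕ) :
    binCoef β (n + 1) = binCoef β n * ((β + n) / (n + 1)) := by
  rw [binCoef, prod_range_succ, ← binCoef]

lemma succ_mul_binCoef_succ (β : ℝ) (n : ℕ) :
    ((n : ℝ) + 1) * binCoef β (n + 1) = (β + n) * binCoef β n := by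
  rw [binCoef_succ]; field_simp

lemma binCoef_pos {β : ℝ} (hβ : 0 < β) (n : ℕ) : 0 < binCoef β n :=
  prod_pos fun j _ => by positivity

lemma binCoef_antitone {β : ℝ} (hβ : 0 < β) (hβ1 : β ≤ 1) : Antitone (binCoef β) := by
  refine antitone_nat_of_succ_le fun n => ?_
  rw [binCoef_succ]
  refine mul_le_of_le_one_right (binCoef_pos hβ n).le ?_
  rw [div_le_one (by positivity)]
  linarith

lemma binCoef_neg_succ (α : ℝ) (n : ℕ) :
    binCoef (-α) (n + 1) = -(α / (n + 1)) * binCoef (1 - α) n := by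
  induction n with
  | zero => simp [binCoef]
  | succ n ih =>
    rw [binCoef_succ, ih, binCoef_succ]
    push_cast
    field_simp
    ring

lemma Gamma_mul_binCoef {β : ℝ} (hβ : 0 < β) (n : ℕ) :
    Real.Gamma β * binCoef β n = Real.Gamma (n + β) / Real.Gamma (n + 1) := by
  induction n with
  | zero => simp
  | succ n ih =>
    have h1 : Real.Gamma (((n + 1 : ℕ) : ℝ) + β) = (n + β) * Real.Gamma (n + β) := by
      rw [← Real.Gamma_add_one (by positivity)]; push_cast; ring_nf
    have h2 : Real.Gamma (((n + 1 : ℕ) : ℝ) + 1) = (n + 1) * Real.Gamma (n + 1) := by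
      rw [← Real.Gamma_add_one (by positivity)]; push_cast; ring_nf
    have h3 : Real.Gamma (n + 1) ≠ 0 := (Real.Gamma_pos_of_pos (by positivity)).ne'
    rw [binCoef_succ, ← mul_assoc, ih, h1, h2]
    field_simp
    ring

lemma Gamma_mul_binCoef_le {β : ℝ} (hβ : 0 < β) (hβ1 : β < 1) {n : ℕ} (hn : 0 < n) :
    Real.Gamma β * binCoef β n ≤ (n : ℝ) ^ (β - 1) := by
  have hn' : (0 : ℝ) < n := by exact_mod_cast hn
  have hG := Real.Gamma_pos_of_pos hn'
  rw [Gamma_mul_binCoef hβ, Real.Gamma_add_one hn'.ne', div_le_iff₀ (by positivity)]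
  have h := Real.Gamma_mul_add_mul_le_rpow_Gamma_mul_rpow_Gamma hn'
    (by positivity : (0 : ℝ) < n + 1) (by linarith : 0 < 1 - β) hβ (by ring)
  have e : (1 - β) * n + β * (n + 1) = n + β := by ring
  rw [e, Real.Gamma_add_one hn'.ne', Real.mul_rpow hn'.le hG.le] at h
  refine h.trans_eq ?_
  rw [Real.rpow_sub hG, Real.rpow_one, Real.rpow_sub hn', Real.rpow_one]
  have := (Real.rpow_pos_of_pos hG β).ne'
  field_simp

lemma le_Gamma_mul_binCoef {β : ℝ} (hβ : 0 < β) (hβ1 : β < 1) (n : ℕ) :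
    ((n : ℝ) + 1) ^ (β - 1) ≤ Real.Gamma β * binCoef β n := by
  have hn : (0 : ℝ) < n + β := by positivity
  have hG := Real.Gamma_pos_of_pos hn
  have hG1 : 0 < Real.Gamma ((n : ℝ) + 1) := Real.Gamma_pos_of_pos (by positivity)
  rw [Gamma_mul_binCoef hβ, le_div_iff₀ hG1]
  have h := Real.Gamma_mul_add_mul_le_rpow_Gamma_mul_rpow_Gamma hn
    (by positivity : (0 : ℝ) < (n + β) + 1) hβ (by linarith : 0 < 1 - β) (by ring)
  have e : β * (n + β) + (1 - β) * ((n + β) + 1) = n + 1 := by ring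
  rw [e, Real.Gamma_add_one hn.ne', Real.mul_rpow hn.le hG.le] at h
  have h2 : Real.Gamma ((n : ℝ) + 1) ≤ (n + β) ^ (1 - β) * Real.Gamma (n + β) := by
    refine h.trans_eq ?_
    rw [mul_left_comm, ← Real.rpow_add hG]; simp
  have h3 : ((n : ℝ) + β) ^ (1 - β) ≤ (n + 1) ^ (1 - β) :=
    Real.rpow_le_rpow hn.le (by linarith) (by linarith)
  calc ((n : ℝ) + 1) ^ (β - 1) * Real.Gamma (n + 1)
      ≤ ((n : ℝ) + 1) ^ (β - 1) * (((n : ℝ) + 1) ^ (1 - β) * Real.Gamma (n + β)) := by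
        gcongr; exact h2.trans (by gcongr)
    _ = Real.Gamma (n + β) := by
        rw [← mul_assoc, ← Real.rpow_add (by positivity)]; simp

lemma binCoef_le_rpow {β : ℝ} (hβ : 0 < β) (hβ1 : β < 1) {n : ℕ} (hn : 0 < n) :
    binCoef β n ≤ (Real.Gamma β)⁻¹ * (n : ℝ) ^ (β - 1) := by
  rw [← div_eq_inv_mul, le_div_iff₀' (Real.Gamma_pos_of_pos hβ)]
  exact Gamma_mul_binCoef_le hβ hβ1 hn

lemma tendsto_binCoef {β : ℝ} (hβ : 0 < β) (hβ1 : β < 1) :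
    Tendsto (binCoef β) atTop (nhds 0) := by
  have h : Tendsto (fun n : ℕ => (Real.Gamma β)⁻¹ * (n : ℝ) ^ (-(1 - β))) atTop (nhds 0) := by
    simpa using ((tendsto_rpow_neg_atTop (by linarith : 0 < 1 - β)).comp
      tendsto_natCast_atTop_atTop).const_mul (Real.Gamma β)⁻¹
  refine tendsto_of_tendsto_of_tendsto_of_le_of_le' tendsto_const_nhds h
    (Eventually.of_forall fun n => (binCoef_pos hβ n).le) ?_
  filter_upwards [eventually_gt_atTop 0] with n hn
  simpa using binCoef_le_rpow hβ hβ1 hn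

lemma sum_binCoef {β : ℝ} (hβ : β ≠ 0) (n : ℕ) :
    ∑ j ∈ range (n + 1), binCoef β j = binCoef β n * (n + β) / β := by
  induction n with
  | zero => simp [hβ]
  | succ n ih =>
    rw [sum_range_succ, ih, binCoef_succ]
    push_cast
    field_simp
    ring

/-- The partial sums of the coefficients of `(1 - z) ^ (-β)` grow like `n ^ β`. -/
lemma sum_binCoef_le {β : ℝ} (hβ : 0 < β) (hβ1 : β < 1) {n : ℕ} (hn : 0 < n) :
    ∑ j ∈ range (n + 1), binCoef β j ≤ 2 / (β * Real.Gamma β) * (n : ℝ) ^ β := by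
  have hn' : (1 : ℝ) ≤ n := by exact_mod_cast hn
  have hG := Real.Gamma_pos_of_pos hβ
  rw [sum_binCoef hβ.ne']
  calc binCoef β n * (n + β) / β
      ≤ ((Real.Gamma β)⁻¹ * (n : ℝ) ^ (β - 1)) * (2 * n) / β := by
        gcongr
        · exact binCoef_le_rpow hβ hβ1 hn
        · linarith
    _ = _ := by
        rw [Real.rpow_sub (by linarith), Real.rpow_one]
        field_simp

lemma binCoef_neg_succ_nonpos {α : ℝ} (hα : 0 < α) (hα1 : α < 1) (n : ℕ) :
    binCoef (-α) (n + 1) ≤ 0 := by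
  rw [binCoef_neg_succ, neg_mul]
  have := binCoef_pos (sub_pos.2 hα1) n
  exact neg_nonpos.2 (by positivity)

/-- The partial sums of `|[zⁿ] (1 - z) ^ α|`, `n ≥ 1`, are bounded by `1`. -/
lemma sum_neg_binCoef_neg_le {α : ℝ} (hα1 : α < 1) (n : ℕ) :
    ∑ j ∈ range n, -binCoef (-α) (j + 1) ≤ 1 := by
  suffices ∑ j ∈ range n, -binCoef (-α) (j + 1) = 1 - binCoef (1 - α) n by
    rw [this]; linarith [binCoef_pos (sub_pos.2 hα1) n]
  induction n with
  | zero => simp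
  | succ n ih =>
    rw [sum_range_succ, ih, binCoef_neg_succ, binCoef_succ]
    field_simp
    ring

lemma summable_abs_binCoef_neg {α : ℝ} (hα : 0 < α) (hα1 : α < 1) :
    Summable fun n => |binCoef (-α) n| := by
  rw [← summable_nat_add_iff 1]
  refine summable_of_sum_range_le (c := 1) (fun n => abs_nonneg _) fun n => ?_
  refine (sum_le_sum fun j _ => ?_).trans (sum_neg_binCoef_neg_le hα1 n)
  rw [abs_of_nonpos (binCoef_neg_succ_nonpos hα hα1 j)]

lemma neg_binCoef_neg_antitone {α : ℝ} (hα : 0 < α) (hα1 : α < 1) :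
    Antitone fun n => -binCoef (-α) (n + 1) := by
  refine antitone_nat_of_succ_le fun n => ?_
  have h := binCoef_neg_succ_nonpos hα hα1 n
  rw [binCoef_succ (-α) (n + 1)]
  have h2 : (-α + (n + 1 : ℕ)) / ((n + 1 : ℕ) + 1) ≤ (1 : ℝ) := by
    rw [div_le_one (by positivity)]; push_cast; linarith
  nlinarith

lemma neg_binCoef_neg_le {α : ℝ} (hα : 0 < α) (hα1 : α < 1) {n : ℕ} (hn : 0 < n) :
    -binCoef (-α) (n + 1) ≤ (Real.Gamma (1 - α))⁻¹ * (n : ℝ) ^ (-α - 1) := by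
  have hn' : (0 : ℝ) < n := by exact_mod_cast hn
  have h := binCoef_le_rpow (sub_pos.2 hα1) (by linarith) hn
  have hG := Real.Gamma_pos_of_pos (sub_pos.2 hα1)
  rw [binCoef_neg_succ, neg_mul, neg_neg]
  calc α / (n + 1) * binCoef (1 - α) n
      ≤ 1 / n * ((Real.Gamma (1 - α))⁻¹ * (n : ℝ) ^ (1 - α - 1)) := by
        have hle : α / (n + 1) ≤ 1 / (n : ℝ) := by
          rw [div_le_div_iff₀ (by positivity) hn']; nlinarith
        exact mul_le_mul hle h (binCoef_pos (sub_pos.2 hα1) n).le (by positivity)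
    _ = _ := by
        rw [show 1 - α - 1 = -α by ring, Real.rpow_sub hn' (-α) 1, Real.rpow_one]
        field_simp

/-- The coefficients of `(1 - z) ^ (-α)` and `(1 - z) ^ α` are convolution inverses. -/
lemma sum_binCoef_mul_binCoef_neg (α : ℝ) (n : ℕ) :
    ∑ p ∈ antidiagonal n, binCoef α p.1 * binCoef (-α) p.2 = if n = 0 then 1 else 0 := by
  set e : ℕ → ℝ := fun n => ∑ p ∈ antidiagonal n, binCoef α p.1 * binCoef (-α) p.2 with he
  have key : ∀ n : ℕ, ((n : ℝ) + 1) * e (n + 1) = n * e n := by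
    intro n
    have h1 : ((n : ℝ) + 1) * e (n + 1) =
        ∑ p ∈ antidiagonal (n + 1), ((p.1 : ℝ) * binCoef α p.1) * binCoef (-α) p.2 +
        ∑ p ∈ antidiagonal (n + 1), binCoef α p.1 * ((p.2 : ℝ) * binCoef (-α) p.2) := by
      rw [he, mul_sum, ← sum_add_distrib]
      refine sum_congr rfl fun p hp => ?_
      have : ((p.1 : ℝ) + p.2) = n + 1 := by exact_mod_cast mem_antidiagonal.1 hp
      rw [← this]; ring
    rw [h1, Nat.sum_antidiagonal_succ, Nat.sum_antidiagonal_succ', he, mul_sum]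
    simp only [Nat.cast_zero, zero_mul, zero_add, mul_zero, Nat.cast_add, Nat.cast_one,
      succ_mul_binCoef_succ]
    rw [← sum_add_distrib]
    refine sum_congr rfl fun p hp => ?_
    have : ((p.1 : ℝ) + p.2) = n := by exact_mod_cast mem_antidiagonal.1 hp
    rw [← this]; ring
  have hz : ∀ n, e (n + 1) = 0 := by
    intro n
    induction n with
    | zero => simpa using key 0
    | succ n ih =>
      have := key (n + 1)
      rw [ih, mul_zero] at this
      exact (mul_eq_zero.1 this).resolve_left (by positivity)
  rcases n with _ | n
  · simp
  · simpa using hz n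

lemma binCoef_eq_choose (β : ℝ) (n : ℕ) :
    (binCoef β n : ℂ) = Ring.choose ((β : ℂ) + n - 1) n := by
  rw [← Ring.multichoose_eq]
  have h : ∀ n : ℕ, (n.factorial : ℂ) * binCoef β n = (ascPochhammer ℕ n).smeval (β : ℂ) := by
    intro n
    induction n with
    | zero => simp
    | succ n ih =>
      rw [ascPochhammer_succ_right, Polynomial.smeval_mul, ← ih, binCoef_succ, Nat.factorial_succ,
        Polynomial.smeval_add, Polynomial.smeval_X, Polynomial.smeval_natCast]
      have : (n : ℂ) + 1 ≠ 0 := by exact_mod_cast n.succ_ne_zero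
      push_cast
      field_simp
      simp
  have h2 := Ring.factorial_nsmul_multichoose_eq_ascPochhammer (β : ℂ) n
  rw [nsmul_eq_mul, ← h n] at h2
  exact (mul_left_cancel₀ (by exact_mod_cast n.factorial_ne_zero) h2).symm

lemma hasSum_binCoef (β : ℝ) {z : ℂ} (hz : ‖z‖ < 1) :
    HasSum (fun n => (binCoef β n : ℂ) * z ^ n) ((1 - z) ^ (-β : ℂ)) := by
  have h := (Complex.one_div_one_sub_cpow_hasFPowerSeriesOnBall_zero (β : ℂ)).hasSum
    (y := z) (by simpa [enorm_eq_nnnorm, ← NNReal.coe_lt_coe] using hz)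
  simp only [zero_add, FormalMultilinearSeries.ofScalars_apply_eq, ← binCoef_eq_choose,
    smul_eq_mul] at h
  rw [Complex.cpow_neg]
  simpa using h

lemma integral_exp_int (m : ℤ) :
    ∫ θ in (-Real.pi)..Real.pi, Complex.exp ((m : ℂ) * (θ : ℂ) * Complex.I) =
      if m = 0 then 2 * (Real.pi : ℂ) else 0 := by
  split_ifs with h
  · simp [h]; ring
  · have hc : (m : ℂ) * Complex.I ≠ 0 := by simp [h]
    have e : ∀ θ : ℝ, Complex.exp ((m : ℂ) * (θ : ℂ) * Complex.I) =
        Complex.exp ((m * Complex.I) * θ) := fun θ => by ring_nf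
    simp_rw [e]
    rw [integral_exp_mul_complex hc]
    have : Complex.exp (m * Complex.I * (Real.pi : ℂ)) =
        Complex.exp (m * Complex.I * ((-Real.pi : ℝ) : ℂ)) := by
      rw [Complex.exp_eq_exp_iff_exists_int]
      exact ⟨m, by push_cast; ring⟩
    rw [this]; simp

/-- The summand of the double series for the Fourier coefficients of the symbol at `R = 1`. -/
noncomputable def limTerm (α : ℝ) (n : ℤ) (p : ℕ × ℕ) : ℝ :=
  if (p.1 : ℤ) - p.2 = n then binCoef (-α) p.1 * ((-1) ^ p.2 * binCoef (-α) p.2) else 0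

/-- The limit of the Fourier coefficients of `φ_{α,R}` as `R → 1⁻`. -/
noncomputable def limCoef (α : ℝ) (n : ℤ) : ℝ := ∑' p, limTerm α n p

lemma summable_abs_mul_abs {α : ℝ} (hα : 0 < α) (hα1 : α < 1) :
    Summable fun p : ℕ × ℕ => |binCoef (-α) p.1| * |binCoef (-α) p.2| :=
  (summable_abs_binCoef_neg hα hα1).mul_of_nonneg (summable_abs_binCoef_neg hα hα1)
    (fun _ => abs_nonneg _) (fun _ => abs_nonneg _)

lemma abs_limTerm_le (α : ℝ) (n : ℤ) (p : ℕ × ℕ) :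
    |limTerm α n p| ≤ |binCoef (-α) p.1| * |binCoef (-α) p.2| := by
  unfold limTerm
  split_ifs
  · simp [abs_mul]
  · simpa using by positivity

lemma summable_norm_binCoef_neg_mul_pow {α : ℝ} (hα : 0 < α) (hα1 : α < 1) {z : ℂ}
    (hz : ‖z‖ < 1) : Summable fun k => ‖(binCoef (-α) k : ℂ) * z ^ k‖ := by
  refine Summable.of_nonneg_of_le (fun _ => norm_nonneg _) (fun k => ?_)
    (summable_abs_binCoef_neg hα hα1)
  rw [norm_mul, norm_pow, Complex.norm_real, Real.norm_eq_abs]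
  exact mul_le_of_le_one_right (abs_nonneg _) (pow_le_one₀ (norm_nonneg _) hz.le)

lemma HasSum.mul_of_norm {f g : ℕ → ℂ} {s t : ℂ} (hf : HasSum f s) (hg : HasSum g t)
    (hf' : Summable fun k => ‖f k‖) (hg' : Summable fun k => ‖g k‖) :
    HasSum (fun p : ℕ × ℕ => f p.1 * g p.2) (s * t) :=
  hf.mul hg (summable_mul_of_summable_norm hf' hg')

lemma hasSum_binCoef_neg_mul {α : ℝ} (hα : 0 < α) (hα1 : α < 1) {z w : ℂ} (hz : ‖z‖ < 1)
    (hw : ‖w‖ < 1) :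
    HasSum (fun p : ℕ × ℕ => (binCoef (-α) p.1 : ℂ) * z ^ p.1 * ((binCoef (-α) p.2 : ℂ) * w ^ p.2))
      ((1 - z) ^ (α : ℂ) * (1 - w) ^ (α : ℂ)) := by
  have h := HasSum.mul_of_norm (hasSum_binCoef (-α) hz) (hasSum_binCoef (-α) hw)
    (summable_norm_binCoef_neg_mul_pow hα hα1 hz) (summable_norm_binCoef_neg_mul_pow hα hα1 hw)
  have e : -((-α : ℝ) : ℂ) = α := by push_cast; ring
  rwa [e] at h

lemma hasSum_symbol (α : ℝ) (hα : 0 < α) (hα1 : α < 1) {R : ℝ} (hR0 : 0 ≤ R) (hR : R < 1)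
    (n : ℤ) (θ : ℝ) :
    HasSum (fun p : ℕ × ℕ => ((binCoef (-α) p.1 * ((-1) ^ p.2 * binCoef (-α) p.2) *
        R ^ (p.1 + p.2) : ℝ) : ℂ) *
        Complex.exp ((((p.1 : ℤ) - p.2 - n : ℤ) : ℂ) * (θ : ℂ) * Complex.I))
      ((1 - (R : ℂ) * Complex.exp ((θ : ℂ) * Complex.I)) ^ (α : ℂ) *
      (1 + (R : ℂ) * Complex.exp (-(θ : ℂ) * Complex.I)) ^ (α : ℂ) *
      Complex.exp (-(n : ℂ) * (θ : ℂ) * Complex.I)) := by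
  have n1 : ‖(R : ℂ) * Complex.exp ((θ : ℂ) * Complex.I)‖ = R := by
    rw [norm_mul, Complex.norm_exp_ofReal_mul_I]; simp [abs_of_nonneg hR0]
  have n2 : ‖-((R : ℂ) * Complex.exp (-(θ : ℂ) * Complex.I))‖ = R := by
    rw [norm_neg, norm_mul, ← Complex.ofReal_neg, Complex.norm_exp_ofReal_mul_I]
    simp [abs_of_nonneg hR0]
  have e1 (p : ℕ × ℕ) : Complex.exp ((((p.1 : ℤ) - p.2 - n : ℤ) : ℂ) * (θ : ℂ) * Complex.I) =
      Complex.exp ((θ : ℂ) * Complex.I) ^ p.1 * Complex.exp (-(θ : ℂ) * Complex.I) ^ p.2 *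
        Complex.exp (-(n : ℂ) * (θ : ℂ) * Complex.I) := by
    rw [← Complex.exp_nat_mul, ← Complex.exp_nat_mul, ← Complex.exp_add, ← Complex.exp_add]
    congr 1; push_cast; ring
  have h3 := (hasSum_binCoef_neg_mul hα hα1 (n1.trans_lt hR) (n2.trans_lt hR)).mul_right
    (Complex.exp (-(n : ℂ) * (θ : ℂ) * Complex.I))
  rw [sub_neg_eq_add] at h3
  simp_rw [e1]
  generalize Complex.exp ((θ : ℂ) * Complex.I) = z at *
  generalize Complex.exp (-(θ : ℂ) * Complex.I) = w at *
  generalize Complex.exp (-(n : ℂ) * (θ : ℂ) * Complex.I) = v at *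
  have e : (fun p : ℕ × ℕ => ((binCoef (-α) p.1 * ((-1) ^ p.2 * binCoef (-α) p.2) *
        R ^ (p.1 + p.2) : ℝ) : ℂ) * (z ^ p.1 * w ^ p.2 * v)) = fun p : ℕ × ℕ =>
      (binCoef (-α) p.1 : ℂ) * ((R : ℂ) * z) ^ p.1 *
        ((binCoef (-α) p.2 : ℂ) * (-((R : ℂ) * w)) ^ p.2) * v := by
    funext p
    rw [neg_pow ((R : ℂ) * w), mul_pow, mul_pow]
    push_cast
    rw [pow_add]
    ring
  rw [e]
  exact h3

lemma hasSum_phiHatR (α : ℝ) (hα : 0 < α) (hα1 : α < 1) {R : ℝ} (hR0 : 0 ≤ R) (hR : R < 1)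
    (n : ℤ) :
    HasSum (fun p : ℕ × ℕ => ((limTerm α n p * R ^ (p.1 + p.2) : ℝ) : ℂ)) (phiHatR α R n) := by
  have hpi : (2 * (Real.pi : ℂ)) ≠ 0 := by simp [Real.pi_ne_zero]
  have h := intervalIntegral.hasSum_integral_of_dominated_convergence (μ := volume)
    (a := -Real.pi) (b := Real.pi)
    (F := fun (p : ℕ × ℕ) (θ : ℝ) => ((binCoef (-α) p.1 * ((-1) ^ p.2 * binCoef (-α) p.2) *
        R ^ (p.1 + p.2) : ℝ) : ℂ) *
        Complex.exp ((((p.1 : ℤ) - p.2 - n : ℤ) : ℂ) * (θ : ℂ) * Complex.I))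
    (f := fun θ : ℝ => (1 - (R : ℂ) * Complex.exp ((θ : ℂ) * Complex.I)) ^ (α : ℂ) *
      (1 + (R : ℂ) * Complex.exp (-(θ : ℂ) * Complex.I)) ^ (α : ℂ) *
      Complex.exp (-(n : ℂ) * (θ : ℂ) * Complex.I))
    (fun p _ => |binCoef (-α) p.1| * |binCoef (-α) p.2|)
    (fun p => (by fun_prop : Continuous _).aestronglyMeasurable) ?_
    (Eventually.of_forall fun θ _ => summable_abs_mul_abs hα hα1) (by simp)
    (Eventually.of_forall fun θ _ => hasSum_symbol α hα hα1 hR0 hR n θ)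
  · have h2 := h.mul_left (1 / (2 * (Real.pi : ℂ)))
    unfold phiHatR
    refine (funext fun p => ?_ : (fun p : ℕ × ℕ => ((limTerm α n p * R ^ (p.1 + p.2) : ℝ) : ℂ)) =
      _) ▸ h2
    rw [intervalIntegral.integral_const_mul, integral_exp_int, limTerm]
    by_cases hp : (p.1 : ℤ) - p.2 = n
    · rw [if_pos hp, if_pos (by lia)]; field_simp
    · rw [if_neg hp, if_neg (by lia)]; simp
  · refine fun p => Eventually.of_forall fun θ _ => ?_
    have : Complex.exp ((((p.1 : ℤ) - p.2 - n : ℤ) : ℂ) * (θ : ℂ) * Complex.I) =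
      Complex.exp (((((p.1 : ℤ) - p.2 - n : ℤ) * θ : ℝ) : ℂ) * Complex.I) := by push_cast; rfl
    rw [norm_mul, this, Complex.norm_exp_ofReal_mul_I, mul_one, Complex.norm_real,
      Real.norm_eq_abs]
    simp only [abs_mul, abs_pow, abs_neg, abs_one, one_pow, one_mul, abs_of_nonneg hR0]
    exact mul_le_of_le_one_right (by positivity) (pow_le_one₀ hR0 hR.le)

lemma tendsto_phiHatR (α : ℝ) (hα : 0 < α) (hα1 : α < 1) (n : ℤ) :
    Tendsto (fun R => phiHatR α R n) (nhdsWithin 1 (Set.Iio 1)) (nhds (limCoef α n : ℂ)) := by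
  have hI : Set.Ioo (0 : ℝ) 1 ∈ nhdsWithin (1 : ℝ) (Set.Iio 1) := Ioo_mem_nhdsLT one_pos
  have h : Tendsto (fun R : ℝ => ∑' p : ℕ × ℕ, limTerm α n p * R ^ (p.1 + p.2))
      (nhdsWithin 1 (Set.Iio 1)) (nhds (∑' p, limTerm α n p)) := by
    refine tendsto_tsum_of_dominated_convergence (summable_abs_mul_abs hα hα1) (fun p => ?_) ?_
    · have : Continuous fun R : ℝ => limTerm α n p * R ^ (p.1 + p.2) := by fun_prop
      simpa using (this.tendsto 1).mono_left nhdsWithin_le_nhds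
    · filter_upwards [hI] with R hR p
      rw [norm_mul, norm_pow, Real.norm_eq_abs, Real.norm_eq_abs, abs_of_pos hR.1]
      exact (mul_le_of_le_one_right (abs_nonneg _) (pow_le_one₀ hR.1.le hR.2.le)).trans
        (abs_limTerm_le α n p)
  have h2 := (Complex.continuous_ofReal.tendsto _).comp h
  refine h2.congr' ?_
  filter_upwards [hI] with R hR
  rw [← (hasSum_phiHatR α hα hα1 hR.1.le hR.2 n).tsum_eq]
  simp [Complex.ofReal_tsum]

/-- The Toeplitz matrix which is the limit of `T_{N,α,R}` as `R → 1⁻`. -/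
noncomputable def limMat (α : ℝ) (N : ℕ) : Matrix (Fin (N + 1)) (Fin (N + 1)) ℂ :=
  fun k l => (limCoef α ((k : ℤ) - (l : ℤ)) : ℂ)

lemma tendsto_TNmat (α : ℝ) (hα : 0 < α) (hα1 : α < 1) (N : ℕ) :
    Tendsto (fun R => TNmat α R N) (nhdsWithin 1 (Set.Iio 1)) (nhds (limMat α N)) := by
  refine tendsto_pi_nhds.2 fun k => tendsto_pi_nhds.2 fun l => ?_
  exact tendsto_phiHatR α hα hα1 _

lemma tendsto_inv_TNmat (α : ℝ) (hα : 0 < α) (hα1 : α < 1) (N : ℕ)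
    (h : (limMat α N).det ≠ 0) (i j : Fin (N + 1)) :
    Tendsto (fun R => (TNmat α R N)⁻¹ i j) (nhdsWithin 1 (Set.Iio 1))
      (nhds ((limMat α N)⁻¹ i j)) := by
  have ht := tendsto_TNmat α hα hα1 N
  simp only [Matrix.inv_def, Ring.inverse_eq_inv', Matrix.smul_apply, smul_eq_mul]
  have hd : Continuous fun A : Matrix (Fin (N + 1)) (Fin (N + 1)) ℂ => A.det :=
    continuous_id.matrix_det
  have ha : Continuous fun A : Matrix (Fin (N + 1)) (Fin (N + 1)) ℂ => A.adjugate i j :=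
    continuous_id.matrix_adjugate.matrix_elem i j
  exact (((hd.tendsto _).comp ht).inv₀ h).mul ((ha.tendsto _).comp ht)

lemma cos_mul_rpow_le_re_cpow_mul_cpow {α : ℝ} (hα : 0 < α) (hα1 : α < 1) {z w : ℂ}
    (hz : 0 < z.re) (hw : 0 < w.re) (hzw : 0 ≤ (z * w).re) :
    Real.cos (Real.pi / 2 * α) * ‖z * w‖ ^ α ≤ (z ^ (α : ℂ) * w ^ (α : ℂ)).re := by
  have hz0 : z ≠ 0 := fun h => by simp [h] at hz
  have hw0 : w ≠ 0 := fun h => by simp [h] at hw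
  have az := abs_lt.1 (Complex.abs_arg_lt_pi_div_two_iff.2 (Or.inl hz))
  have aw := abs_lt.1 (Complex.abs_arg_lt_pi_div_two_iff.2 (Or.inl hw))
  have ha := Complex.arg_mul hz0 hw0 ⟨by linarith [az.1, aw.1], by linarith [az.2, aw.2]⟩
  have hle := Complex.abs_arg_le_pi_div_two_iff.2 hzw
  have hre : (z ^ (α : ℂ) * w ^ (α : ℂ)).re =
      ‖z * w‖ ^ α * Real.cos (Complex.arg (z * w) * α) := by
    rw [Complex.mul_re, Complex.cpow_ofReal_re, Complex.cpow_ofReal_re, Complex.cpow_ofReal_im,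
      Complex.cpow_ofReal_im, norm_mul, Real.mul_rpow (norm_nonneg _) (norm_nonneg _), ha,
      add_mul, Real.cos_add]
    ring
  rw [hre, mul_comm]
  refine mul_le_mul_of_nonneg_left ?_ (by positivity)
  rw [← Real.cos_abs (Complex.arg (z * w) * α), abs_mul, abs_of_pos hα]
  refine Real.cos_le_cos_of_nonneg_of_le_pi (by positivity) ?_ (by gcongr)
  nlinarith [Real.pi_pos]

lemma cos_mul_abs_sin_rpow_le_re_symbol {α : ℝ} (hα : 0 < α) (hα1 : α < 1) {R : ℝ}
    (hR0 : 1 / 2 ≤ R) (hR : R < 1) (θ : ℝ) :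
    Real.cos (Real.pi / 2 * α) * |Real.sin θ| ^ α ≤
      ((1 - (R : ℂ) * Complex.exp ((θ : ℂ) * Complex.I)) ^ (α : ℂ) *
        (1 + (R : ℂ) * Complex.exp (-(θ : ℂ) * Complex.I)) ^ (α : ℂ)).re := by
  have hc : 0 ≤ Real.cos (Real.pi / 2 * α) :=
    Real.cos_nonneg_of_mem_Icc ⟨by nlinarith [Real.pi_pos], by nlinarith [Real.pi_pos]⟩
  have hcos := Real.cos_le_one θ
  have hcos' := Real.neg_one_le_cos θ
  have hp : (1 - (R : ℂ) * Complex.exp ((θ : ℂ) * Complex.I)) *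
      (1 + (R : ℂ) * Complex.exp (-(θ : ℂ) * Complex.I)) =
      ⟨1 - R ^ 2, -(2 * R * Real.sin θ)⟩ := by
    rw [← Complex.ofReal_neg, Complex.exp_mul_I, Complex.exp_mul_I]
    apply Complex.ext <;>
      simp [Complex.cos_ofReal_re, Complex.sin_ofReal_re, Complex.cos_ofReal_im,
        Complex.sin_ofReal_im]
    · nlinarith [Real.sin_sq_add_cos_sq θ]
    · ring
  have h1 : (Complex.exp ((θ : ℂ) * Complex.I)).re = Real.cos θ := Complex.exp_ofReal_mul_I_re θ
  have h2 : (Complex.exp (-(θ : ℂ) * Complex.I)).re = Real.cos θ := by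
    rw [← Complex.ofReal_neg, Complex.exp_ofReal_mul_I_re, Real.cos_neg]
  refine le_trans ?_ (cos_mul_rpow_le_re_cpow_mul_cpow hα hα1 ?_ ?_ ?_)
  · refine mul_le_mul_of_nonneg_left (Real.rpow_le_rpow (abs_nonneg _) ?_ hα.le) hc
    refine le_trans ?_ (Complex.abs_im_le_norm _)
    rw [hp]
    simp only [abs_neg, abs_mul]
    rw [abs_of_pos (two_pos : (0 : ℝ) < 2), abs_of_pos (by linarith : 0 < R)]
    nlinarith [abs_nonneg (Real.sin θ)]
  · rw [Complex.sub_re, Complex.re_ofReal_mul, h1, Complex.one_re]; nlinarith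
  · rw [Complex.add_re, Complex.re_ofReal_mul, h2, Complex.one_re]; nlinarith
  · rw [hp]; simp only; nlinarith

lemma intervalIntegrable_abs_sin_rpow {β : ℝ} (hβ : 0 < β) (hβ1 : β < 1) :
    IntervalIntegrable (fun θ => |Real.sin θ| ^ (-β)) volume (-Real.pi) Real.pi := by
  have hpi := Real.pi_pos
  have hm : Measurable fun θ => |Real.sin θ| ^ (-β) := by fun_prop
  have h1 : IntervalIntegrable (fun θ => |Real.sin θ| ^ (-β)) volume 0 (Real.pi / 2) := by
    refine ((intervalIntegral.intervalIntegrable_rpow' (a := 0) (b := Real.pi / 2)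
      (by linarith : -1 < -β)).const_mul ((2 / Real.pi) ^ (-β))).mono_fun
      hm.aestronglyMeasurable ?_
    refine (ae_restrict_iff' measurableSet_uIoc).2 (Eventually.of_forall fun θ hθ => ?_)
    rw [Set.uIoc_of_le (by positivity)] at hθ
    have := Real.mul_le_sin hθ.1.le hθ.2
    beta_reduce
    rw [← Real.mul_rpow (by positivity) hθ.1.le, Real.norm_of_nonneg (by positivity),
      Real.norm_of_nonneg (by have := hθ.1; positivity)]
    exact Real.rpow_le_rpow_of_nonpos (by have := hθ.1; positivity)
      (this.trans (le_abs_self _)) (by linarith)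
  have h2 : IntervalIntegrable (fun θ => |Real.sin θ| ^ (-β)) volume (Real.pi / 2) Real.pi := by
    have := (h1.comp_sub_left Real.pi).symm
    simp only [Real.sin_pi_sub, sub_zero] at this
    convert this using 1; ring
  have h3 := h1.trans h2
  have h4 : IntervalIntegrable (fun θ => |Real.sin θ| ^ (-β)) volume (-Real.pi) 0 := by
    have := (h3.comp_sub_left 0).symm
    simpa using this
  exact h4.trans h3

lemma ae_sin_ne_zero : ∀ᵐ θ : ℝ, Real.sin θ ≠ 0 := by
  filter_upwards [(Set.countable_range fun n : ℤ => (n : ℝ) * Real.pi).ae_notMem volume] with θ h h0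
  exact h (Real.sin_eq_zero_iff.1 h0)

/-- The trigonometric polynomial with coefficients `w`. -/
noncomputable def trigPoly {N : ℕ} (w : Fin (N + 1) → ℂ) (θ : ℝ) : ℂ :=
  ∑ l, w l * Complex.exp (((l : ℤ) : ℂ) * (θ : ℂ) * Complex.I)

@[fun_prop]
lemma continuous_trigPoly {N : ℕ} (w : Fin (N + 1) → ℂ) : Continuous (trigPoly w) := by
  unfold trigPoly; fun_prop

lemma integral_trigPoly_mul_exp {N : ℕ} (w : Fin (N + 1) → ℂ) (k : Fin (N + 1)) :
    ∫ θ in (-Real.pi)..Real.pi, trigPoly w θ * Complex.exp (((-k : ℤ) : ℂ) * (θ : ℂ) * Complex.I) =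
      2 * Real.pi * w k := by
  have e (θ : ℝ) : trigPoly w θ * Complex.exp (((-k : ℤ) : ℂ) * (θ : ℂ) * Complex.I) =
      ∑ l, w l * Complex.exp (((l - k : ℤ) : ℂ) * (θ : ℂ) * Complex.I) := by
    rw [trigPoly, sum_mul]
    refine sum_congr rfl fun l _ => ?_
    rw [mul_assoc, ← Complex.exp_add]
    congr 2; push_cast; ring
  simp_rw [e]
  rw [intervalIntegral.integral_finsetSum fun l _ =>
    (by fun_prop : Continuous _).intervalIntegrable _ _]
  simp_rw [intervalIntegral.integral_const_mul, integral_exp_int]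
  rw [sum_eq_single k]
  · simp; ring
  · intro l _ hl
    rw [if_neg, mul_zero]
    intro h; exact hl (Fin.ext (by lia))
  · simp

lemma conj_trigPoly {N : ℕ} (w : Fin (N + 1) → ℂ) (θ : ℝ) :
    (starRingEnd ℂ) (trigPoly w θ) =
      ∑ k, (starRingEnd ℂ) (w k) * Complex.exp (((-k : ℤ) : ℂ) * (θ : ℂ) * Complex.I) := by
  rw [trigPoly, map_sum]
  refine sum_congr rfl fun k _ => ?_
  rw [map_mul, ← Complex.exp_conj]
  congr 2
  simp

lemma integral_norm_sq_trigPoly {N : ℕ} (w : Fin (N + 1) → ℂ) :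
    ∫ θ in (-Real.pi)..Real.pi, ‖trigPoly w θ‖ ^ 2 = 2 * Real.pi * ∑ l, ‖w l‖ ^ 2 := by
  apply Complex.ofReal_injective
  rw [← intervalIntegral.integral_ofReal]
  have e (θ : ℝ) : ((‖trigPoly w θ‖ ^ 2 : ℝ) : ℂ) = ∑ k, (starRingEnd ℂ) (w k) *
      (trigPoly w θ * Complex.exp (((-k : ℤ) : ℂ) * (θ : ℂ) * Complex.I)) := by
    rw [Complex.ofReal_pow, ← Complex.mul_conj', conj_trigPoly, mul_sum]
    exact sum_congr rfl fun k _ => by ring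
  simp_rw [e]
  rw [intervalIntegral.integral_finsetSum fun l _ =>
    (by fun_prop : Continuous _).intervalIntegrable _ _]
  simp_rw [intervalIntegral.integral_const_mul, integral_trigPoly_mul_exp]
  push_cast
  rw [mul_sum]
  refine sum_congr rfl fun k _ => ?_
  rw [← Complex.mul_conj']; ring

lemma norm_sq_trigPoly_le {N : ℕ} (w : Fin (N + 1) → ℂ) (θ : ℝ) :
    ‖trigPoly w θ‖ ^ 2 ≤ (N + 1) * ∑ l, ‖w l‖ ^ 2 := by
  have h : ‖trigPoly w θ‖ ≤ ∑ l, ‖w l‖ := by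
    refine (norm_sum_le _ _).trans (sum_le_sum fun l _ => ?_)
    rw [norm_mul]
    have : ((l : ℤ) : ℂ) * (θ : ℂ) * Complex.I = ((((l : ℤ) : ℝ) * θ : ℝ) : ℂ) * Complex.I := by
      push_cast; rfl
    rw [this, Complex.norm_exp_ofReal_mul_I, mul_one]
  refine (pow_le_pow_left₀ (norm_nonneg _) h 2).trans ?_
  simpa using sq_sum_le_card_mul_sum_sq (s := univ) (f := fun l => ‖w l‖)

/-- The weighted energy of the trigonometric polynomial with coefficients `w`. -/
noncomputable def energy (α : ℝ) {N : ℕ} (w : Fin (N + 1) → ℂ) : ℝ :=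
  ∫ θ in (-Real.pi)..Real.pi, |Real.sin θ| ^ α * ‖trigPoly w θ‖ ^ 2

lemma continuous_energy_integrand {α : ℝ} (hα : 0 < α) {N : ℕ} (w : Fin (N + 1) → ℂ) :
    Continuous fun θ => |Real.sin θ| ^ α * ‖trigPoly w θ‖ ^ 2 :=
  ((Real.continuous_sin.abs).rpow_const fun _ => Or.inr hα.le).mul (by fun_prop)

lemma energy_nonneg (α : ℝ) {N : ℕ} (w : Fin (N + 1) → ℂ) : 0 ≤ energy α w :=
  intervalIntegral.integral_nonneg (by linarith [Real.pi_pos]) fun _ _ => by positivity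

lemma norm_sq_le_energy {α : ℝ} (hα : 0 < α) (hα1 : α < 1) {N : ℕ} (w : Fin (N + 1) → ℂ)
    (l : Fin (N + 1)) :
    (2 * Real.pi * ‖w l‖) ^ 2 ≤
      energy α w * ∫ θ in (-Real.pi)..Real.pi, |Real.sin θ| ^ (-α) := by
  have hpi : -Real.pi ≤ Real.pi := by linarith [Real.pi_pos]
  have hI1 : IntervalIntegrable (fun θ => |Real.sin θ| ^ α * ‖trigPoly w θ‖ ^ 2) volume
    (-Real.pi) Real.pi := (continuous_energy_integrand hα w).intervalIntegrable _ _
  have hI2 : IntervalIntegrable (fun θ => ‖trigPoly w θ‖) volume (-Real.pi) Real.pi :=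
    (by fun_prop : Continuous _).intervalIntegrable _ _
  have hI3 := intervalIntegrable_abs_sin_rpow hα hα1
  have h0 : 2 * Real.pi * ‖w l‖ ≤ ∫ θ in (-Real.pi)..Real.pi, ‖trigPoly w θ‖ := by
    have := intervalIntegral.norm_integral_le_integral_norm (μ := volume) hpi
      (f := fun θ => trigPoly w θ * Complex.exp (((-l : ℤ) : ℂ) * (θ : ℂ) * Complex.I))
    rw [integral_trigPoly_mul_exp] at this
    have e (θ : ℝ) : ‖trigPoly w θ * Complex.exp (((-l : ℤ) : ℂ) * (θ : ℂ) * Complex.I)‖ =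
        ‖trigPoly w θ‖ := by
      have : ((-l : ℤ) : ℂ) * (θ : ℂ) * Complex.I =
        ((((-l : ℤ) : ℝ) * θ : ℝ) : ℂ) * Complex.I := by push_cast; rfl
      rw [norm_mul, this, Complex.norm_exp_ofReal_mul_I, mul_one]
    simp_rw [e] at this
    simpa [abs_of_pos Real.pi_pos] using this
  set P := ∫ θ in (-Real.pi)..Real.pi, ‖trigPoly w θ‖
  set J := ∫ θ in (-Real.pi)..Real.pi, |Real.sin θ| ^ (-α)
  have hq : ∀ t : ℝ, 0 ≤ energy α w * (t * t) + (-2 * P) * t + J := by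
    intro t
    have e : energy α w * (t * t) + (-2 * P) * t + J = ∫ θ in (-Real.pi)..Real.pi,
        ((|Real.sin θ| ^ α * ‖trigPoly w θ‖ ^ 2) * (t * t) + ‖trigPoly w θ‖ * (-2 * t) +
          |Real.sin θ| ^ (-α)) := by
      rw [intervalIntegral.integral_add ((hI1.mul_const _).add (hI2.mul_const _)) hI3,
        intervalIntegral.integral_add (hI1.mul_const _) (hI2.mul_const _),
        intervalIntegral.integral_mul_const, intervalIntegral.integral_mul_const]
      simp only [energy, P, J]; ring
    rw [e]
    refine intervalIntegral.integral_nonneg_of_ae hpi ?_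
    filter_upwards [ae_sin_ne_zero] with θ h
    have hs : 0 < |Real.sin θ| ^ α := Real.rpow_pos_of_pos (abs_pos.2 h) _
    rw [Pi.zero_apply, Real.rpow_neg (abs_nonneg _)]
    generalize |Real.sin θ| ^ α = u at hs
    have : u * ‖trigPoly w θ‖ ^ 2 * (t * t) + ‖trigPoly w θ‖ * (-2 * t) + u⁻¹ =
        u * (‖trigPoly w θ‖ * t - u⁻¹) ^ 2 := by field_simp; ring
    rw [this]; positivity
  have := discrim_le_zero hq
  rw [discrim] at this
  nlinarith [norm_nonneg (w l), Real.pi_pos, pow_le_pow_left₀ (by positivity) h0 2]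

lemma continuous_symbol (α : ℝ) {R : ℝ} (hR0 : 0 ≤ R) (hR : R < 1) :
    Continuous fun θ : ℝ => (1 - (R : ℂ) * Complex.exp ((θ : ℂ) * Complex.I)) ^ (α : ℂ) *
      (1 + (R : ℂ) * Complex.exp (-(θ : ℂ) * Complex.I)) ^ (α : ℂ) := by
  refine .mul (.cpow (by fun_prop) continuous_const fun θ => Or.inl ?_)
    (.cpow (by fun_prop) continuous_const fun θ => Or.inl ?_)
  · rw [Complex.sub_re, Complex.re_ofReal_mul, Complex.exp_ofReal_mul_I_re, Complex.one_re]
    nlinarith [Real.cos_le_one θ, Real.neg_one_le_cos θ]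
  · rw [Complex.add_re, Complex.re_ofReal_mul, ← Complex.ofReal_neg,
      Complex.exp_ofReal_mul_I_re, Complex.one_re, Real.cos_neg]
    nlinarith [Real.cos_le_one θ, Real.neg_one_le_cos θ]

lemma integral_symbol_mul (α : ℝ) {R : ℝ} (hR0 : 0 ≤ R) (hR : R < 1) {N : ℕ}
    (w : Fin (N + 1) → ℂ) :
    ∫ θ in (-Real.pi)..Real.pi, (1 - (R : ℂ) * Complex.exp ((θ : ℂ) * Complex.I)) ^ (α : ℂ) *
      (1 + (R : ℂ) * Complex.exp (-(θ : ℂ) * Complex.I)) ^ (α : ℂ) *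
        ((‖trigPoly w θ‖ ^ 2 : ℝ) : ℂ) =
      2 * Real.pi * (star w ⬝ᵥ (TNmat α R N).mulVec w) := by
  have hc := continuous_symbol α hR0 hR
  set φ := fun θ : ℝ => (1 - (R : ℂ) * Complex.exp ((θ : ℂ) * Complex.I)) ^ (α : ℂ) *
      (1 + (R : ℂ) * Complex.exp (-(θ : ℂ) * Complex.I)) ^ (α : ℂ) with hφ
  have hT (k l : Fin (N + 1)) : TNmat α R N k l = (1 / (2 * (Real.pi : ℂ))) *
      ∫ θ in (-Real.pi)..Real.pi,
        φ θ * Complex.exp (-(((k : ℤ) - (l : ℤ) : ℤ) : ℂ) * (θ : ℂ) * Complex.I) := rfl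
  have e (θ : ℝ) : φ θ * ((‖trigPoly w θ‖ ^ 2 : ℝ) : ℂ) =
      ∑ k, ∑ l, ((starRingEnd ℂ) (w k) * w l) *
        (φ θ * Complex.exp (-(((k : ℤ) - (l : ℤ) : ℤ) : ℂ) * (θ : ℂ) * Complex.I)) := by
    rw [Complex.ofReal_pow, ← Complex.mul_conj', conj_trigPoly, mul_comm (trigPoly w θ),
      trigPoly, sum_mul_sum, mul_sum]
    refine sum_congr rfl fun k _ => ?_
    rw [mul_sum]
    refine sum_congr rfl fun l _ => ?_
    have : Complex.exp (-(((k : ℤ) - (l : ℤ) : ℤ) : ℂ) * (θ : ℂ) * Complex.I) =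
        Complex.exp (((-k : ℤ) : ℂ) * (θ : ℂ) * Complex.I) *
        Complex.exp (((l : ℤ) : ℂ) * (θ : ℂ) * Complex.I) := by
      rw [← Complex.exp_add]; congr 1; push_cast; ring
    rw [this]; ring
  change ∫ θ in (-Real.pi)..Real.pi, φ θ * ((‖trigPoly w θ‖ ^ 2 : ℝ) : ℂ) = _
  simp_rw [e]
  clear_value φ
  rw [intervalIntegral.integral_finsetSum fun k _ =>
    (by fun_prop : Continuous _).intervalIntegrable _ _]
  simp only [dotProduct, Matrix.mulVec, mul_sum]
  refine sum_congr rfl fun k _ => ?_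
  rw [intervalIntegral.integral_finsetSum fun k _ =>
    (by fun_prop : Continuous _).intervalIntegrable _ _]
  refine sum_congr rfl fun l _ => ?_
  rw [intervalIntegral.integral_const_mul, hT]
  have hpi : (Real.pi : ℂ) ≠ 0 := by simp [Real.pi_ne_zero]
  simp only [Pi.star_apply, RCLike.star_def]
  generalize (∫ θ in (-Real.pi)..Real.pi,
        φ θ * Complex.exp (-(((k : ℤ) - (l : ℤ) : ℤ) : ℂ) * (θ : ℂ) * Complex.I)) = I
  field_simp

lemma cos_mul_energy_le {α : ℝ} (hα : 0 < α) (hα1 : α < 1) {N : ℕ} (w : Fin (N + 1) → ℂ) :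
    Real.cos (Real.pi / 2 * α) * energy α w ≤
      2 * Real.pi * (star w ⬝ᵥ (limMat α N).mulVec w).re := by
  have hI : Set.Ioo (1 / 2 : ℝ) 1 ∈ nhdsWithin (1 : ℝ) (Set.Iio 1) :=
    Ioo_mem_nhdsLT (by norm_num)
  have hc : Continuous fun M : Matrix (Fin (N + 1)) (Fin (N + 1)) ℂ =>
      2 * Real.pi * (star w ⬝ᵥ M.mulVec w).re := by
    refine continuous_const.mul (Complex.continuous_re.comp ?_)
    exact continuous_const.dotProduct (continuous_id.matrix_mulVec continuous_const)
  refine ge_of_tendsto ((hc.tendsto _).comp (tendsto_TNmat α hα hα1 N)) ?_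
  filter_upwards [hI] with R hR
  have hR0 : 0 ≤ R := by linarith [hR.1]
  have h := congrArg Complex.re (integral_symbol_mul α hR0 hR.2 w)
  have hcs : Continuous fun θ : ℝ => (1 - (R : ℂ) * Complex.exp ((θ : ℂ) * Complex.I)) ^ (α : ℂ) *
      (1 + (R : ℂ) * Complex.exp (-(θ : ℂ) * Complex.I)) ^ (α : ℂ) *
        ((‖trigPoly w θ‖ ^ 2 : ℝ) : ℂ) :=
    (continuous_symbol α hR0 hR.2).mul (by fun_prop)
  have hre : (2 * (Real.pi : ℂ) * (star w ⬝ᵥ (TNmat α R N).mulVec w)).re =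
      2 * Real.pi * (star w ⬝ᵥ (TNmat α R N).mulVec w).re := by
    rw [← Complex.re_ofReal_mul]; push_cast; rfl
  rw [hre] at h
  rw [Function.comp_apply, ← h, energy, ← intervalIntegral.integral_const_mul]
  have h2 := Complex.reCLM.intervalIntegral_comp_comm (μ := volume)
    (hcs.intervalIntegrable (-Real.pi) Real.pi)
  simp only [Complex.reCLM_apply] at h2
  rw [← h2]
  refine intervalIntegral.integral_mono_on (by linarith [Real.pi_pos])
    (((continuous_energy_integrand hα w).const_mul _).intervalIntegrable _ _)
    ((Complex.continuous_re.comp hcs).intervalIntegrable _ _) fun θ _ => ?_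
  rw [Complex.re_mul_ofReal, ← mul_assoc]
  exact mul_le_mul_of_nonneg_right (cos_mul_abs_sin_rpow_le_re_symbol hα hα1 hR.1.le hR.2 θ)
    (by positivity)

lemma sum_norm_sq_le_energy {α : ℝ} (hα : 0 < α) (hα1 : α < 1) :
    ∃ C : ℝ, 0 < C ∧ ∀ (N : ℕ) (w : Fin (N + 1) → ℂ),
      ∑ l, ‖w l‖ ^ 2 ≤ C * (N + 1 : ℝ) ^ (2 * α / (1 + α)) * energy α w := by
  have hpi := Real.pi_pos
  have hpi' : -Real.pi ≤ Real.pi := by linarith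
  set β := (1 + α) / 2 with hβ
  have hβ0 : 0 < β := by positivity
  have hI3 := intervalIntegrable_abs_sin_rpow hβ0 (by linarith : β < 1)
  set J₀ := ∫ θ in (-Real.pi)..Real.pi, |Real.sin θ| ^ (-β) with hJ₀
  have hJ₀0 : 0 ≤ J₀ := intervalIntegral.integral_nonneg hpi' fun _ _ => by positivity
  set J := J₀ + 1 with hJ
  have hJ0 : 0 < J := by positivity
  refine ⟨(J / Real.pi) ^ (2 * α / (1 + α)) / Real.pi, by positivity, fun N w => ?_⟩
  have hI1 : IntervalIntegrable (fun θ => |Real.sin θ| ^ α * ‖trigPoly w θ‖ ^ 2) volume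
    (-Real.pi) Real.pi := (continuous_energy_integrand hα w).intervalIntegrable _ _
  have hI2 : IntervalIntegrable (fun θ => ‖trigPoly w θ‖ ^ 2) volume (-Real.pi) Real.pi :=
    (by fun_prop : Continuous _).intervalIntegrable _ _
  set S := ∑ l, ‖w l‖ ^ 2 with hS
  have hS0 : 0 ≤ S := sum_nonneg fun _ _ => by positivity
  set D := J / Real.pi * (N + 1 : ℝ) with hD
  have hD0 : 0 < D := by positivity
  set δ := D ^ (-β⁻¹) with hδ
  have hδ0 : 0 < δ := Real.rpow_pos_of_pos hD0 _
  have hδα : δ ^ (-α) = D ^ (2 * α / (1 + α)) := by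
    rw [hδ, ← Real.rpow_mul hD0.le, hβ]; congr 1; field_simp
  have hδβ : δ ^ β = D⁻¹ := by
    rw [hδ, ← Real.rpow_mul hD0.le, neg_mul, inv_mul_cancel₀ hβ0.ne', Real.rpow_neg_one]
  have key : 2 * Real.pi * S ≤ δ ^ (-α) * energy α w + δ ^ β * ((N + 1) * S) * J₀ := by
    rw [hS, ← integral_norm_sq_trigPoly, energy, hJ₀, ← intervalIntegral.integral_const_mul,
      ← intervalIntegral.integral_const_mul,
      ← intervalIntegral.integral_add (hI1.const_mul _) (hI3.const_mul _)]
    refine intervalIntegral.integral_mono_ae hpi' hI2 ((hI1.const_mul _).add (hI3.const_mul _)) ?_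
    filter_upwards [ae_sin_ne_zero] with θ h
    have hs : 0 < |Real.sin θ| := abs_pos.2 h
    have hb := norm_sq_trigPoly_le w θ
    generalize |Real.sin θ| = s at hs ⊢
    rcases le_total δ s with h' | h'
    · have : 1 ≤ δ ^ (-α) * s ^ α := by
        rw [Real.rpow_neg hδ0.le, ← div_eq_inv_mul, ← Real.div_rpow hs.le hδ0.le]
        exact Real.one_le_rpow ((one_le_div hδ0).2 h') hα.le
      have h3 : 0 ≤ δ ^ β * ((N + 1) * S) * s ^ (-β) := by positivity
      nlinarith [sq_nonneg ‖trigPoly w θ‖]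
    · have : 1 ≤ δ ^ β * s ^ (-β) := by
        rw [Real.rpow_neg hs.le, ← div_eq_mul_inv, ← Real.div_rpow hδ0.le hs.le]
        exact Real.one_le_rpow ((one_le_div hs).2 h') hβ0.le
      have h3 : 0 ≤ δ ^ (-α) * (s ^ α * ‖trigPoly w θ‖ ^ 2) := by positivity
      have h4 : 0 ≤ (N + 1) * S := by positivity
      nlinarith
  have e1 : δ ^ β * ((N + 1) * S) * J = Real.pi * S := by
    rw [hδβ, hD]; field_simp
  have e2 : δ ^ β * ((N + 1) * S) * J₀ ≤ δ ^ β * ((N + 1) * S) * J := by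
    gcongr; linarith
  rw [hδα, hD, Real.mul_rpow (by positivity) (by positivity)] at key
  have : (J / Real.pi) ^ (2 * α / (1 + α)) / Real.pi * (N + 1 : ℝ) ^ (2 * α / (1 + α)) *
      energy α w = ((J / Real.pi) ^ (2 * α / (1 + α)) * (N + 1 : ℝ) ^ (2 * α / (1 + α)) *
      energy α w) / Real.pi := by ring
  rw [this, le_div_iff₀ hpi]
  linarith

/-- A priori bound for solutions of the limiting Toeplitz system. -/
theorem exists_norm_sq_le {α : ℝ} (hα : 0 < α) (hα1 : α < 1) :
    ∃ C : ℝ, 0 < C ∧ ∀ (N : ℕ) (w X : Fin (N + 1) → ℂ), (limMat α N).mulVec w = X → ∀ l,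
      ‖w l‖ ^ 2 ≤ C * (N + 1 : ℝ) ^ (2 * α / (1 + α)) * ∑ k, ‖X k‖ ^ 2 := by
  have hpi := Real.pi_pos
  obtain ⟨C, hC, hCw⟩ := sum_norm_sq_le_energy hα hα1
  have hcos : 0 < Real.cos (Real.pi / 2 * α) :=
    Real.cos_pos_of_mem_Ioo ⟨by nlinarith, by nlinarith⟩
  set κ := Real.cos (Real.pi / 2 * α)
  set J := ∫ θ in (-Real.pi)..Real.pi, |Real.sin θ| ^ (-α)
  have hJ : 0 ≤ J :=
    intervalIntegral.integral_nonneg (by linarith) fun _ _ => by positivity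
  refine ⟨(J + 1) * (C / κ ^ 2), by positivity, fun N w X hwX l => ?_⟩
  have h1 := norm_sq_le_energy hα hα1 w l
  have h2 := cos_mul_energy_le hα hα1 w
  have hE := energy_nonneg α w
  rw [hwX] at h2
  have h3 := hCw N w
  set E := energy α w
  set M := (N + 1 : ℝ) ^ (2 * α / (1 + α))
  have hM : 0 ≤ M := by positivity
  have h4 : ((star w ⬝ᵥ X).re) ^ 2 ≤ (∑ l, ‖w l‖ ^ 2) * ∑ l, ‖X l‖ ^ 2 := by
    refine le_trans ?_ (sum_mul_sq_le_sq_mul_sq univ (fun l => ‖w l‖) (fun l => ‖X l‖))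
    rw [← sq_abs]
    refine pow_le_pow_left₀ (abs_nonneg _) ((Complex.abs_re_le_norm _).trans ?_) 2
    refine (norm_sum_le _ _).trans (sum_le_sum fun k _ => ?_)
    simp
  set S := ∑ l, ‖w l‖ ^ 2
  set Y := ∑ l, ‖X l‖ ^ 2
  have hY : 0 ≤ Y := sum_nonneg fun _ _ => by positivity
  have h5 : (κ * E) ^ 2 ≤ (2 * Real.pi) ^ 2 * (C * M * E * Y) :=
    calc (κ * E) ^ 2 ≤ (2 * Real.pi * (star w ⬝ᵥ X).re) ^ 2 :=
          pow_le_pow_left₀ (by positivity) h2 2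
      _ = (2 * Real.pi) ^ 2 * (star w ⬝ᵥ X).re ^ 2 := by ring
      _ ≤ (2 * Real.pi) ^ 2 * (S * Y) := by gcongr
      _ ≤ _ := by gcongr
  have h6 : κ ^ 2 * E ≤ (2 * Real.pi) ^ 2 * (C * M * Y) := by
    rcases hE.eq_or_lt with h0 | h0
    · rw [← h0, mul_zero]; positivity
    · refine le_of_mul_le_mul_right ?_ h0
      linarith
  have h7 : (2 * Real.pi) ^ 2 * (κ ^ 2 * ‖w l‖ ^ 2) ≤
      (2 * Real.pi) ^ 2 * ((J + 1) * (C * M * Y)) :=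
    calc (2 * Real.pi) ^ 2 * (κ ^ 2 * ‖w l‖ ^ 2) = κ ^ 2 * (2 * Real.pi * ‖w l‖) ^ 2 := by ring
      _ ≤ κ ^ 2 * (E * (J + 1)) := by gcongr; exact h1.trans (by gcongr; linarith)
      _ = κ ^ 2 * E * (J + 1) := by ring
      _ ≤ (2 * Real.pi) ^ 2 * (C * M * Y) * (J + 1) := by gcongr
      _ = _ := by ring
  have h8 := le_of_mul_le_mul_left h7 (by positivity)
  have e : (J + 1) * (C / κ ^ 2) * M * Y = ((J + 1) * (C * M * Y)) / κ ^ 2 := by ring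
  rw [e, le_div_iff₀ (by positivity)]
  linarith

lemma det_limMat_ne_zero {α : ℝ} (hα : 0 < α) (hα1 : α < 1) (N : ℕ) :
    (limMat α N).det ≠ 0 := by
  intro h
  obtain ⟨v, hv, hv0⟩ := Matrix.exists_mulVec_eq_zero_iff.2 h
  obtain ⟨C, -, hC⟩ := exists_norm_sq_le hα hα1
  refine hv (funext fun l => ?_)
  have := hC N v 0 hv0 l
  simpa using this

lemma alternating_sum_mem {u : ℕ → ℝ} (hu : Antitone u) (h0 : ∀ n, 0 ≤ u n) (n : ℕ) :
    0 ≤ ∑ s ∈ range n, (-1) ^ s * u s ∧ ∑ s ∈ range n, (-1) ^ s * u s ≤ u 0 := by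
  induction n generalizing u with
  | zero => simpa using h0 0
  | succ n ih =>
    obtain ⟨h1, h2⟩ := ih (u := fun n => u (n + 1)) (fun a b h => hu (by lia)) fun n => h0 _
    rw [sum_range_succ']
    have e : ∑ s ∈ range n, (-1) ^ (s + 1) * u (s + 1) =
        -∑ s ∈ range n, (-1) ^ s * u (s + 1) := by
      rw [← sum_neg_distrib]; exact sum_congr rfl fun s _ => by ring
    have := hu (zero_le_one : (0 : ℕ) ≤ 1)
    rw [e]
    simp only [zero_add] at h2
    constructor <;> simp <;> linarith

lemma abs_alternating_sum_le {u : ℕ → ℝ} (hu : Antitone u) (h0 : ∀ n, 0 ≤ u n) (n : ℕ) :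
    |∑ s ∈ range n, (-1) ^ s * u s| ≤ u 0 := by
  obtain ⟨h1, h2⟩ := alternating_sum_mem hu h0 n
  rwa [abs_of_nonneg h1]

/-- The lower triangular Toeplitz array with first column `a`. -/
def lowerToeplitz (a : ℕ → ℝ) (j i : ℕ) : ℝ := if i ≤ j then a (j - i) else 0

lemma lowerToeplitz_add (a : ℕ → ℝ) (i n : ℕ) : lowerToeplitz a (i + n) i = a n := by
  simp [lowerToeplitz]

lemma lowerToeplitz_of_le (a : ℕ → ℝ) {i j : ℕ} (h : i ≤ j) :
    lowerToeplitz a j i = a (j - i) := if_pos h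

lemma lowerToeplitz_of_lt (a : ℕ → ℝ) {i j : ℕ} (h : j < i) : lowerToeplitz a j i = 0 :=
  if_neg (by lia)

lemma sum_lowerToeplitz_mul {f g : ℕ → ℝ}
    (hfg : ∀ n, ∑ p ∈ antidiagonal n, f p.1 * g p.2 = if n = 0 then 1 else 0)
    {n k : ℕ} (hk : k < n) (m : ℕ) :
    ∑ i ∈ range n, lowerToeplitz f k i * lowerToeplitz g i m = if k = m then 1 else 0 := by
  have h1 : ∑ i ∈ range n, lowerToeplitz f k i * lowerToeplitz g i m =
      ∑ i ∈ range (k + 1), lowerToeplitz f k i * lowerToeplitz g i m := by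
    symm
    refine sum_subset (range_subset_range.2 hk) fun i _ hi => ?_
    rw [lowerToeplitz_of_lt f (by simpa using hi), zero_mul]
  rw [h1]
  rcases lt_or_ge k m with hkm | hkm
  · rw [if_neg hkm.ne]
    refine sum_eq_zero fun i hi => ?_
    rw [lowerToeplitz_of_lt g (by simp at hi; lia), mul_zero]
  · obtain ⟨d, rfl⟩ := Nat.exists_eq_add_of_le hkm
    rw [add_assoc, sum_range_add, sum_eq_zero, zero_add]
    · have := hfg d
      rw [← Nat.sum_antidiagonal_swap] at this
      simp only [Prod.fst_swap, Prod.snd_swap] at this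
      rw [Nat.sum_antidiagonal_eq_sum_range_succ (fun i j => f j * g i)] at this
      simp only [lowerToeplitz_add, add_eq_left] at this ⊢
      rw [← this]
      refine sum_congr rfl fun t ht => ?_
      rw [lowerToeplitz_of_le f (by simp at ht; lia)]
      congr 2; lia
    · intro i hi
      rw [lowerToeplitz_of_lt g (by simpa using hi), mul_zero]

lemma sum_binCoef_neg_mul_binCoef (α : ℝ) (n : ℕ) :
    ∑ p ∈ antidiagonal n, binCoef (-α) p.1 * binCoef α p.2 = if n = 0 then 1 else 0 := by
  rw [← sum_binCoef_mul_binCoef_neg α n, ← Nat.sum_antidiagonal_swap]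
  exact sum_congr rfl fun p _ => mul_comm _ _

lemma neg_one_pow_add {j l : ℕ} (h : l ≤ j) : (-1 : ℝ) ^ (j + l) = (-1) ^ (j - l) := by
  obtain ⟨d, rfl⟩ := Nat.exists_eq_add_of_le h
  rw [show l + d + l = 2 * l + d by ring, pow_add, pow_mul]; simp

lemma hasSum_limCoef {α : ℝ} (hα : 0 < α) (hα1 : α < 1) (l m : ℕ) :
    HasSum (fun j => (-1) ^ (j + l) * lowerToeplitz (binCoef (-α)) j l *
      lowerToeplitz (binCoef (-α)) j m) (limCoef α ((l : ℤ) - m)) := by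
  have hs : HasSum (limTerm α ((l : ℤ) - m)) (limCoef α ((l : ℤ) - m)) := by
    refine Summable.hasSum ?_
    exact Summable.of_norm_bounded (summable_abs_mul_abs hα hα1) (abs_limTerm_le α _)
  have i1 : Function.Injective fun t : ℕ => (max l m + t - m, max l m + t - l) := by
    intro s t h; simp only [Prod.mk.injEq] at h; lia
  have i2 : Function.Injective fun t : ℕ => max l m + t := fun s t h => by simpa using h
  rw [← i1.hasSum_iff] at hs
  · rw [← i2.hasSum_iff]
    · convert hs using 1
      funext t
      rw [Function.comp_apply, Function.comp_apply, limTerm]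
      rw [if_pos (by simp only; lia), lowerToeplitz_of_le _ (by lia),
        lowerToeplitz_of_le _ (by lia), neg_one_pow_add (by lia)]
      ring
    · intro j hj
      have : j < l ∨ j < m := by
        by_contra! h
        exact hj ⟨j - max l m, by simp only; lia⟩
      rcases this with h | h <;> simp [lowerToeplitz_of_lt _ h]
  · rintro ⟨p, q⟩ hp
    rw [limTerm, if_neg]
    intro h
    simp only at h
    exact hp ⟨l + q - max l m, by simp only [Prod.mk.injEq]; lia⟩

/-- The contribution of the indices `j > N` to the series for `limCoef α (l - m)`. -/
noncomputable def tailCoef (α : ℝ) (N l m : ℕ) : ℝ :=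
  limCoef α ((l : ℤ) - m) - ∑ j ∈ range (N + 1), (-1) ^ (j + l) *
    lowerToeplitz (binCoef (-α)) j l * lowerToeplitz (binCoef (-α)) j m

lemma abs_tailCoef_le {α : ℝ} (hα : 0 < α) (hα1 : α < 1) {N l m : ℕ} (hl : l ≤ N) (hm : m ≤ N) :
    |tailCoef α N l m| ≤ |binCoef (-α) (N + 1 - l)| * |binCoef (-α) (N + 1 - m)| := by
  have h := (hasSum_nat_add_iff' (N + 1)).2 (hasSum_limCoef hα hα1 l m)
  change HasSum _ (tailCoef α N l m) at h
  have h' := h.tendsto_sum_nat.abs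
  refine le_of_tendsto h' (Eventually.of_forall fun n => ?_)
  set u : ℕ → ℝ := fun t => (-binCoef (-α) (N - l + t + 1)) * (-binCoef (-α) (N - m + t + 1))
  have h0 : ∀ n, 0 ≤ -binCoef (-α) (n + 1) := fun n => by
    linarith [binCoef_neg_succ_nonpos hα hα1 n]
  have hu : Antitone u := fun s t hst =>
    mul_le_mul (neg_binCoef_neg_antitone hα hα1 (by lia)) (neg_binCoef_neg_antitone hα hα1 (by lia))
      (h0 _) (h0 _)
  have hsum := abs_alternating_sum_le hu (fun t => mul_nonneg (h0 _) (h0 _)) n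
  have e : ∑ i ∈ range n, (-1) ^ (i + (N + 1) + l) * lowerToeplitz (binCoef (-α)) (i + (N + 1)) l *
      lowerToeplitz (binCoef (-α)) (i + (N + 1)) m =
      (-1) ^ (N + 1 + l) * ∑ s ∈ range n, (-1) ^ s * u s := by
    rw [mul_sum]
    refine sum_congr rfl fun i _ => ?_
    rw [lowerToeplitz_of_le _ (by lia), lowerToeplitz_of_le _ (by lia),
      show i + (N + 1) - l = N - l + i + 1 by lia, show i + (N + 1) - m = N - m + i + 1 by lia]
    simp only [u]; ring
  rw [e, abs_mul, abs_pow, abs_neg, abs_one, one_pow, one_mul]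
  refine hsum.trans (le_of_eq ?_)
  simp only [u, add_zero]
  rw [show N - l + 1 = N + 1 - l by lia, show N - m + 1 = N + 1 - m by lia, ← abs_mul,
    neg_mul_neg, abs_of_nonneg]
  rw [show N + 1 - l = N - l + 1 by lia, show N + 1 - m = N - m + 1 by lia]
  simpa using mul_nonneg (h0 (N - l)) (h0 (N - m))

/-- The kernel of the approximate inverse of `limMat`. -/
noncomputable def invKer (α : ℝ) (k l : ℕ) : ℝ :=
  ∑ i ∈ range (k + 1), lowerToeplitz (binCoef α) k i *
    ((-1) ^ (l + i) * lowerToeplitz (binCoef α) l i)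

lemma abs_invKer_le {α : ℝ} (hα : 0 < α) (hα1 : α < 1) (k l : ℕ) :
    |invKer α k l| ≤ binCoef α (k - l + (l - k)) := by
  have h0 : ∀ n, 0 ≤ binCoef α n := fun n => (binCoef_pos hα n).le
  have ha := binCoef_antitone hα hα1.le
  set d := min k l with hd
  set u : ℕ → ℝ := fun t => binCoef α (k - d + t) * binCoef α (l - d + t)
  have hu : Antitone u := fun s t hst =>
    mul_le_mul (ha (by lia)) (ha (by lia)) (h0 _) (h0 _)
  have hsum := abs_alternating_sum_le hu (fun t => mul_nonneg (h0 _) (h0 _)) (d + 1)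
  have e : invKer α k l = (-1) ^ (l - d) * ∑ s ∈ range (d + 1), (-1) ^ s * u s := by
    have e1 : invKer α k l = ∑ i ∈ range (d + 1), lowerToeplitz (binCoef α) k i *
        ((-1) ^ (l + i) * lowerToeplitz (binCoef α) l i) := by
      symm
      refine sum_subset (range_subset_range.2 (by lia)) fun i hi hi' => ?_
      rw [lowerToeplitz_of_lt _ (show l < i by simp at hi hi'; lia), mul_zero, mul_zero]
    rw [e1, ← sum_range_reflect, mul_sum]
    refine sum_congr rfl fun s hs => ?_
    have hs' : s ≤ d := by simpa [Nat.lt_succ_iff] using hs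
    rw [lowerToeplitz_of_le _ (by lia), lowerToeplitz_of_le _ (by lia), neg_one_pow_add (by lia),
      show k - (d + 1 - 1 - s) = k - d + s by lia, show l - (d + 1 - 1 - s) = l - d + s by lia]
    simp only [u]; ring
  rw [e, abs_mul, abs_pow, abs_neg, abs_one, one_pow, one_mul]
  refine hsum.trans ?_
  simp only [u, add_zero]
  rcases le_total k l with h | h
  · rw [show k - d = 0 by lia, binCoef_zero, one_mul, show l - d = k - l + (l - k) by lia]
  · rw [show l - d = 0 by lia, binCoef_zero, mul_one, show k - d = k - l + (l - k) by lia]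

lemma sum_invKer_mul {α : ℝ} {N k : ℕ} (hk : k ≤ N) (m : ℕ) :
    ∑ l ∈ range (N + 1), invKer α k l * (∑ j ∈ range (N + 1), (-1) ^ (j + l) *
      lowerToeplitz (binCoef (-α)) j l * lowerToeplitz (binCoef (-α)) j m) =
      if k = m then 1 else 0 := by
  set a := binCoef α
  set c := binCoef (-α)
  rw [← sum_lowerToeplitz_mul (sum_binCoef_mul_binCoef_neg α) (Nat.lt_succ_self k) m]
  have h1 : ∀ l ∈ range (N + 1), invKer α k l * (∑ j ∈ range (N + 1), (-1) ^ (j + l) *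
      lowerToeplitz c j l * lowerToeplitz c j m) = ∑ i ∈ range (k + 1), ∑ j ∈ range (N + 1),
        lowerToeplitz a k i * (-1) ^ (i + j) * lowerToeplitz c j m *
          (lowerToeplitz c j l * lowerToeplitz a l i) := by
    intro l _
    rw [invKer, sum_mul_sum]
    refine sum_congr rfl fun i _ => sum_congr rfl fun j _ => ?_
    have : (-1 : ℝ) ^ (l + i) * (-1) ^ (j + l) = (-1) ^ (i + j) := by
      rw [← pow_add, show l + i + (j + l) = 2 * l + (i + j) by ring, pow_add, pow_mul]; simp
    rw [← this]; ring
  rw [sum_congr rfl h1, sum_comm]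
  refine sum_congr rfl fun i hi => ?_
  have hi' : i < N + 1 := by simp at hi; lia
  rw [sum_comm]
  have h2 : ∀ j ∈ range (N + 1), ∑ l ∈ range (N + 1), lowerToeplitz a k i * (-1) ^ (i + j) *
      lowerToeplitz c j m * (lowerToeplitz c j l * lowerToeplitz a l i) =
      if j = i then lowerToeplitz a k i * lowerToeplitz c i m else 0 := by
    intro j hj
    rw [← mul_sum, sum_lowerToeplitz_mul (sum_binCoef_neg_mul_binCoef α) (mem_range.1 hj) i]
    split_ifs with h
    · subst h; rw [← two_mul, pow_mul]; simp
    · simp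
  rw [sum_congr rfl h2, sum_ite_eq' (range (N + 1)) i]
  rw [if_pos (mem_range.2 hi')]

lemma abs_sum_invKer_mul_limCoef_sub_le {α : ℝ} (hα : 0 < α) (hα1 : α < 1) {N k m : ℕ}
    (hk : k ≤ N) (hm : m ≤ N) :
    |∑ l ∈ range (N + 1), invKer α k l * limCoef α ((l : ℤ) - m) - if k = m then 1 else 0| ≤
      (∑ l ∈ range (N + 1), binCoef α (k - l + (l - k)) * |binCoef (-α) (N + 1 - l)|) *
        |binCoef (-α) (N + 1 - m)| := by
  rw [← sum_invKer_mul hk m, ← sum_sub_distrib, sum_mul]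
  refine (abs_sum_le_sum_abs _ _).trans (sum_le_sum fun l hl => ?_)
  rw [← mul_sub, abs_mul, mul_assoc]
  exact mul_le_mul (abs_invKer_le hα hα1 k l)
    (abs_tailCoef_le hα hα1 (by simp at hl; lia) hm) (abs_nonneg _) (binCoef_pos hα _).le

lemma sum_abs_binCoef_neg_reflect_le {α : ℝ} (hα : 0 < α) (hα1 : α < 1) (N : ℕ) :
    ∑ m ∈ range (N + 1), |binCoef (-α) (N + 1 - m)| ≤ 1 := by
  refine le_trans (le_of_eq ?_) (sum_neg_binCoef_neg_le hα1 (N + 1))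
  rw [← sum_range_reflect]
  refine sum_congr rfl fun m hm => ?_
  rw [show N + 1 - (N + 1 - 1 - m) = m + 1 by simp at hm; lia,
    abs_of_nonpos (binCoef_neg_succ_nonpos hα hα1 m)]

lemma norm_sub_sum_invKer_le {α : ℝ} (hα : 0 < α) (hα1 : α < 1) {N : ℕ}
    {w X : Fin (N + 1) → ℂ} (h : (limMat α N).mulVec w = X) (k : Fin (N + 1)) {B : ℝ}
    (hB : ∀ l, ‖w l‖ ≤ B) :
    ‖w k - ∑ l : Fin (N + 1), (invKer α k l : ℂ) * X l‖ ≤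
      (∑ l ∈ range (N + 1), binCoef α (k - l + (l - k)) * |binCoef (-α) (N + 1 - l)|) * B := by
  set ρ := ∑ l ∈ range (N + 1), binCoef α (k - l + (l - k)) * |binCoef (-α) (N + 1 - l)|
  have hρ : 0 ≤ ρ := sum_nonneg fun _ _ => mul_nonneg (binCoef_pos hα _).le (abs_nonneg _)
  have hB0 : 0 ≤ B := (norm_nonneg _).trans (hB 0)
  set e : ℕ → ℝ := fun m => ∑ l ∈ range (N + 1), invKer α k l * limCoef α ((l : ℤ) - m) -
    if (k : ℕ) = m then 1 else 0 with he
  have h1 : w k - ∑ l : Fin (N + 1), (invKer α k l : ℂ) * X l =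
      -∑ m : Fin (N + 1), ((e m : ℝ) : ℂ) * w m := by
    have h2 (m : Fin (N + 1)) : ((e m : ℝ) : ℂ) * w m =
        ∑ l : Fin (N + 1), (invKer α k l : ℂ) * ((limMat α N) l m * w m) -
          if k = m then w m else 0 := by
      simp only [he]
      rw [← Fin.sum_univ_eq_sum_range (fun l => invKer α k l * limCoef α ((l : ℤ) - m))]
      push_cast
      rw [sub_mul, sum_mul]
      congr 1
      · exact sum_congr rfl fun l _ => by simp only [limMat]; ring
      · simp only [Fin.ext_iff]; split_ifs <;> simp
    simp_rw [h2]
    rw [sum_sub_distrib, sum_comm, sum_ite_eq univ k]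
    simp only [← h, Matrix.mulVec, dotProduct, mul_sum, mem_univ, if_true]
    ring
  rw [h1, norm_neg]
  refine (norm_sum_le _ _).trans ?_
  calc ∑ m : Fin (N + 1), ‖((e m : ℝ) : ℂ) * w m‖
      ≤ ∑ m : Fin (N + 1), ρ * |binCoef (-α) (N + 1 - m)| * B := by
        refine sum_le_sum fun m _ => ?_
        rw [norm_mul, Complex.norm_real, Real.norm_eq_abs]
        exact mul_le_mul (abs_sum_invKer_mul_limCoef_sub_le hα hα1 (by lia) (by lia)) (hB m)
          (norm_nonneg _) (by positivity)
    _ = ρ * B * ∑ m ∈ range (N + 1), |binCoef (-α) (N + 1 - m)| := by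
        rw [Fin.sum_univ_eq_sum_range (fun m => ρ * |binCoef (-α) (N + 1 - m)| * B), mul_sum]
        exact sum_congr rfl fun _ _ => by ring
    _ ≤ ρ * B * 1 := by gcongr; exact sum_abs_binCoef_neg_reflect_le hα hα1 N
    _ = ρ * B := mul_one _

lemma sum_binCoef_dist_le {α : ℝ} (hα : 0 < α) {N k : ℕ} (hk : k ≤ N) :
    ∑ l ∈ range (N + 1), binCoef α (k - l + (l - k)) ≤ 2 * ∑ j ∈ range (N + 1), binCoef α j := by
  have h0 : ∀ n, 0 ≤ binCoef α n := fun n => (binCoef_pos hα n).le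
  have hsub : ∀ n ≤ N + 1, ∑ j ∈ range n, binCoef α j ≤ ∑ j ∈ range (N + 1), binCoef α j :=
    fun n hn => sum_le_sum_of_subset_of_nonneg (range_subset_range.2 hn) fun _ _ _ => h0 _
  rw [show N + 1 = k + (N + 1 - k) by lia, sum_range_add, two_mul,
    show k + (N + 1 - k) = N + 1 by lia]
  refine add_le_add ?_ ?_
  · refine le_trans (le_of_eq ?_) (le_trans (le_add_of_nonneg_right (h0 0)) (le_of_eq_of_le
      (sum_range_succ' (binCoef α) k).symm (hsub (k + 1) (by lia))))
    rw [← sum_range_reflect]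
    refine sum_congr rfl fun j hj => ?_
    simp at hj
    congr 1; lia
  · refine le_trans (le_of_eq (sum_congr rfl fun j _ => ?_)) (hsub (N + 1 - k) (by lia))
    congr 1; lia

lemma sum_dist_mul_le {α : ℝ} (hα : 0 < α) (hα1 : α < 1) {x : ℝ} (hx0 : 0 < x) (hx1 : x < 1) :
    ∃ C : ℝ, 0 < C ∧ ∀ N k : ℕ, 0 < N → (k : ℝ) ≤ N * x →
      ∑ l ∈ range (N + 1), binCoef α (k - l + (l - k)) * |binCoef (-α) (N + 1 - l)| ≤
        C * (N : ℝ) ^ (α - 1) := by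
  have hG := Real.Gamma_pos_of_pos hα
  have hG1 := Real.Gamma_pos_of_pos (by linarith : 0 < 1 - α)
  set h := (1 - x) / 2 with hh
  have hh0 : 0 < h := by simp only [hh]; linarith
  refine ⟨(Real.Gamma (1 - α))⁻¹ * h ^ (-α - 1) * (2 * (2 / (α * Real.Gamma α))) +
    (Real.Gamma α)⁻¹ * h ^ (α - 1), by positivity, fun N k hN hk => ?_⟩
  have hN0 : (0 : ℝ) < N := by exact_mod_cast hN
  have hkN : k ≤ N := by
    have : (k : ℝ) ≤ N := hk.trans (by nlinarith)
    exact_mod_cast this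
  set A1 := (Real.Gamma (1 - α))⁻¹ * (N * h) ^ (-α - 1) with hA1
  set A2 := (Real.Gamma α)⁻¹ * (N * h) ^ (α - 1) with hA2
  have hterm : ∀ l ∈ range (N + 1),
      binCoef α (k - l + (l - k)) * |binCoef (-α) (N + 1 - l)| ≤
        A1 * binCoef α (k - l + (l - k)) + A2 * |binCoef (-α) (N + 1 - l)| := by
    intro l hl
    have hlN : l ≤ N := by simp at hl; lia
    have ha := (binCoef_pos hα (k - l + (l - k))).le
    have hc := abs_nonneg (binCoef (-α) (N + 1 - l))
    have hA1' : 0 ≤ A1 := by positivity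
    have hA2' : 0 ≤ A2 := by positivity
    rcases le_or_gt ((N : ℝ) * h) (N - l) with hl' | hl'
    · have hlt : 0 < N - l := by
        have : (l : ℝ) < N := by nlinarith
        have : l < N := by exact_mod_cast this
        lia
      have : |binCoef (-α) (N + 1 - l)| ≤ A1 := by
        rw [show N + 1 - l = N - l + 1 by lia, abs_of_nonpos (binCoef_neg_succ_nonpos hα hα1 _)]
        refine (neg_binCoef_neg_le hα hα1 hlt).trans ?_
        rw [hA1, Nat.cast_sub hlN]
        refine mul_le_mul_of_nonneg_left ?_ (by positivity)
        exact Real.rpow_le_rpow_of_nonpos (by positivity) hl' (by linarith)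
      nlinarith
    · have hd : (N : ℝ) * h ≤ l - k := by nlinarith
      have hlt : k < l := by
        have : (k : ℝ) < l := by nlinarith
        exact_mod_cast this
      have : binCoef α (k - l + (l - k)) ≤ A2 := by
        refine (binCoef_le_rpow hα hα1 (by lia)).trans ?_
        rw [hA2, show k - l + (l - k) = l - k by lia, Nat.cast_sub hlt.le]
        refine mul_le_mul_of_nonneg_left ?_ (by positivity)
        exact Real.rpow_le_rpow_of_nonpos (by positivity) hd (by linarith)
      nlinarith
  refine (sum_le_sum hterm).trans ?_
  rw [sum_add_distrib, ← mul_sum, ← mul_sum, add_mul]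
  have h1 := sum_binCoef_dist_le hα hkN
  have h2 := sum_binCoef_le hα hα1 hN
  have h3 := sum_abs_binCoef_neg_reflect_le hα hα1 N
  refine add_le_add ?_ ?_
  · calc A1 * ∑ l ∈ range (N + 1), binCoef α (k - l + (l - k))
        ≤ A1 * (2 * (2 / (α * Real.Gamma α) * (N : ℝ) ^ α)) := by gcongr; linarith
      _ = (Real.Gamma (1 - α))⁻¹ * h ^ (-α - 1) * (2 * (2 / (α * Real.Gamma α))) *
          ((N : ℝ) ^ (-α - 1) * (N : ℝ) ^ α) := by
        rw [hA1, Real.mul_rpow hN0.le hh0.le]; ring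
      _ ≤ _ := by
        rw [← Real.rpow_add hN0]
        gcongr
        · exact_mod_cast hN
        · linarith
  · calc A2 * ∑ m ∈ range (N + 1), |binCoef (-α) (N + 1 - m)| ≤ A2 * 1 := by gcongr
      _ = _ := by rw [hA2, Real.mul_rpow hN0.le hh0.le]; ring

lemma tendsto_alternating_binCoef {α : ℝ} (hα : 0 < α) (hα1 : α < 1) :
    Tendsto (fun n => ∑ s ∈ range n, (-1) ^ s * binCoef α s) atTop (nhds ((2 : ℝ) ^ (-α))) := by
  obtain ⟨L, hL⟩ := (binCoef_antitone hα hα1.le).tendsto_alternating_series_of_tendsto_zero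
    (tendsto_binCoef hα hα1)
  have h1 := Real.tendsto_tsum_powerSeries_nhdsWithin_lt hL
  have h2 : Tendsto (fun z : ℝ => (1 + z) ^ (-α)) (nhdsWithin 1 (Set.Iio 1))
      (nhds ((2 : ℝ) ^ (-α))) := by
    have : ContinuousAt (fun z : ℝ => (1 + z) ^ (-α)) 1 :=
      ContinuousAt.rpow_const (by fun_prop) (Or.inl (by norm_num))
    have h := this.tendsto
    norm_num at h
    exact h.mono_left nhdsWithin_le_nhds
  have h3 : L = (2 : ℝ) ^ (-α) := by
    refine tendsto_nhds_unique h1 (h2.congr' ?_)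
    filter_upwards [Ioo_mem_nhdsLT (one_pos : (0 : ℝ) < 1)] with z hz
    have hz' : ‖(-z : ℂ)‖ < 1 := by
      rw [norm_neg, Complex.norm_real, Real.norm_eq_abs, abs_of_pos hz.1]; exact hz.2
    have h := (hasSum_binCoef α hz').tsum_eq
    have e : (1 - (-z : ℂ)) ^ (-α : ℂ) = (((1 + z) ^ (-α) : ℝ) : ℂ) := by
      rw [Complex.ofReal_cpow (by linarith [hz.1])]; push_cast; ring_nf
    rw [e] at h
    apply Complex.ofReal_injective
    rw [← h, Complex.ofReal_tsum]
    refine tsum_congr fun n => ?_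
    push_cast
    rw [neg_pow (z : ℂ)]; ring
  rwa [h3] at hL

lemma abs_alternating_binCoef_sub_le {α : ℝ} (hα : 0 < α) (hα1 : α < 1) (n : ℕ) :
    |∑ s ∈ range n, (-1) ^ s * binCoef α s - (2 : ℝ) ^ (-α)| ≤ binCoef α n := by
  have h := ((tendsto_alternating_binCoef hα hα1).comp (tendsto_add_atTop_nat n)).const_sub
    (∑ s ∈ range n, (-1) ^ s * binCoef α s)
  refine le_of_tendsto h.abs (Eventually.of_forall fun m => ?_)
  have hu : Antitone fun s => binCoef α (n + s) := fun s t hst =>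
    binCoef_antitone hα hα1.le (by lia)
  have h2 := abs_alternating_sum_le hu (fun s => (binCoef_pos hα _).le) m
  have e : ∑ s ∈ range n, (-1) ^ s * binCoef α s - ∑ s ∈ range (m + n), (-1) ^ s * binCoef α s =
      -((-1) ^ n * ∑ s ∈ range m, (-1) ^ s * binCoef α (n + s)) := by
    rw [add_comm m n, sum_range_add, mul_sum, sub_add_cancel_left]
    congr 1
    exact sum_congr rfl fun s _ => by rw [pow_add]; ring
  simp only [Function.comp_apply]
  rw [e, abs_neg, abs_mul, abs_pow, abs_neg, abs_one, one_pow, one_mul]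
  exact h2

/-- Summation by parts against the alternating binomial coefficients. -/
lemma abs_alternating_binCoef_mul_sub_le {α : ℝ} (hα : 0 < α) (hα1 : α < 1) {G : ℕ → ℝ}
    {M δ : ℝ} (hM : ∀ s, |G s| ≤ M) (hδ : ∀ s, |G (s + 1) - G s| ≤ δ) (n : ℕ) :
    |∑ s ∈ range n, (-1) ^ s * binCoef α s * G s - (2 : ℝ) ^ (-α) * G 0| ≤
      M * binCoef α n + δ * ∑ s ∈ range n, binCoef α s := by
  set r : ℕ → ℝ := fun n => ∑ s ∈ range n, (-1) ^ s * binCoef α s - (2 : ℝ) ^ (-α) with hr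
  have hra : ∀ n, |r n| ≤ binCoef α n := abs_alternating_binCoef_sub_le hα hα1
  have h1 : ∑ s ∈ range n, (-1) ^ s * binCoef α s * G s - (2 : ℝ) ^ (-α) * G 0 =
      r n * G n - ∑ s ∈ range n, r (s + 1) * (G (s + 1) - G s) := by
    induction n with
    | zero => simp [hr]
    | succ n ih =>
      have : r (n + 1) = r n + (-1) ^ n * binCoef α n := by simp only [hr, sum_range_succ]; ring
      rw [sum_range_succ, sum_range_succ, add_sub_right_comm, ih, this]; ring
  rw [h1]
  refine (abs_sub _ _).trans (add_le_add ?_ ?_)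
  · rw [abs_mul, mul_comm]
    exact mul_le_mul (hM n) (hra n) (abs_nonneg _) ((abs_nonneg _).trans (hM 0))
  · rw [mul_sum]
    refine (abs_sum_le_sum_abs _ _).trans (sum_le_sum fun s _ => ?_)
    rw [abs_mul, mul_comm]
    exact mul_le_mul (hδ s) ((hra _).trans (binCoef_antitone hα hα1.le (by lia)))
      (abs_nonneg _) ((abs_nonneg _).trans (hδ 0))

lemma sum_invKer_mul_eq (α : ℝ) {N k : ℕ} (hk : k ≤ N) (X : ℕ → ℝ) :
    ∑ l ∈ range (N + 1), invKer α k l * X l = ∑ i ∈ range (k + 1), binCoef α (k - i) *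
      ∑ s ∈ range (N + 1 - i), (-1) ^ s * binCoef α s * X (i + s) := by
  simp_rw [invKer, sum_mul]
  rw [sum_comm]
  refine sum_congr rfl fun i hi => ?_
  have hi' : i ≤ k := by simpa [Nat.lt_succ_iff] using hi
  rw [show N + 1 = i + (N + 1 - i) by lia, sum_range_add, sum_eq_zero, zero_add,
    show i + (N + 1 - i) - i = N + 1 - i by lia, mul_sum]
  · refine sum_congr rfl fun s _ => ?_
    rw [lowerToeplitz_of_le _ hi', lowerToeplitz_add, neg_one_pow_add (by lia),
      Nat.add_sub_cancel_left]
    ring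
  · intro l hl
    rw [lowerToeplitz_of_lt _ (mem_range.1 hl)]; ring

lemma abs_sum_invKer_mul_sub_le {α : ℝ} (hα : 0 < α) (hα1 : α < 1) {F : ℝ → ℝ} {M K : ℝ}
    (hM : ∀ t, |F t| ≤ M) (hK : ∀ s t, |F s - F t| ≤ K * |s - t|) {N k : ℕ} (hN : 0 < N)
    (hk : k ≤ N) :
    |∑ l ∈ range (N + 1), invKer α k l * F (l / N) -
      (2 : ℝ) ^ (-α) * ∑ i ∈ range (k + 1), binCoef α (k - i) * F (i / N)| ≤
      (M * binCoef α (N + 1 - k) + K / N * ∑ s ∈ range (N + 1), binCoef α s) *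
        ∑ s ∈ range (N + 1), binCoef α s := by
  have h0 : ∀ n, 0 ≤ binCoef α n := fun n => (binCoef_pos hα n).le
  have hM0 : 0 ≤ M := (abs_nonneg _).trans (hM 0)
  have hK0 : 0 ≤ K := by simpa using (abs_nonneg _).trans (hK 1 0)
  have hN0 : (0 : ℝ) < N := by exact_mod_cast hN
  have hsub : ∀ n ≤ N + 1, ∑ j ∈ range n, binCoef α j ≤ ∑ j ∈ range (N + 1), binCoef α j :=
    fun n hn => sum_le_sum_of_subset_of_nonneg (range_subset_range.2 hn) fun _ _ _ => h0 _
  have hS0 : 0 ≤ ∑ j ∈ range (N + 1), binCoef α j := sum_nonneg fun _ _ => h0 _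
  rw [sum_invKer_mul_eq α hk (fun l => F (l / N)), mul_sum, ← sum_sub_distrib]
  have h1 : ∑ i ∈ range (k + 1), binCoef α (k - i) ≤ ∑ s ∈ range (N + 1), binCoef α s := by
    have := sum_range_reflect (binCoef α) (k + 1)
    simp only [Nat.add_sub_cancel] at this
    rw [this]
    exact hsub _ (by lia)
  refine le_trans ?_ (mul_le_mul_of_nonneg_left h1 (by have := h0 (N + 1 - k); positivity))
  rw [mul_sum]
  refine (abs_sum_le_sum_abs _ _).trans (sum_le_sum fun i hi => ?_)
  have hi' : i ≤ k := by simpa [Nat.lt_succ_iff] using hi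
  rw [show ∀ a b c d : ℝ, a * b - c * (a * d) = a * (b - c * d) by intros; ring, abs_mul,
    abs_of_nonneg (h0 _), mul_comm]
  refine mul_le_mul_of_nonneg_right ?_ (h0 _)
  have := abs_alternating_binCoef_mul_sub_le hα hα1 (G := fun s => F ((i + s : ℕ) / N))
    (M := M) (δ := K / N) (fun s => hM _) (fun s => (hK _ _).trans (le_of_eq ?_)) (N + 1 - i)
  · simp only [add_zero] at this
    refine this.trans ?_
    exact add_le_add (mul_le_mul_of_nonneg_left (binCoef_antitone hα hα1.le (by omega)) hM0)
      (mul_le_mul_of_nonneg_left (hsub _ (by omega)) (by positivity))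
  · rw [← sub_div, abs_div, abs_of_pos hN0]; push_cast
    rw [show (i : ℝ) + (s + 1) - (i + s) = 1 by ring]; simp [div_eq_mul_inv]

/-- The increments `((n+1)^α - n^α)/α` of the antiderivative of `u^(α-1)`. -/
noncomputable def powIncr (α : ℝ) (n : ℕ) : ℝ := ((n + 1 : ℝ) ^ α - (n : ℝ) ^ α) / α

lemma integral_rpow_cell {α : ℝ} (hα : 0 < α) {N : ℕ} (hN : 0 < N) (n : ℕ) :
    ∫ u in ((n : ℝ) / N)..((n + 1 : ℕ) / N : ℝ), u ^ (α - 1) = (N : ℝ) ^ (-α) * powIncr α n := by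
  have hN0 : (0 : ℝ) < N := by exact_mod_cast hN
  rw [integral_rpow (Or.inl (by linarith)), sub_add_cancel, Real.div_rpow (by positivity) hN0.le,
    Real.div_rpow (by positivity) hN0.le, Real.rpow_neg hN0.le, powIncr]
  push_cast; field_simp

lemma powIncr_mem {α : ℝ} (hα : 0 < α) (hα1 : α < 1) {n : ℕ} (hn : 0 < n) :
    (n + 1 : ℝ) ^ (α - 1) ≤ powIncr α n ∧ powIncr α n ≤ (n : ℝ) ^ (α - 1) := by
  have hn0 : (0 : ℝ) < n := by exact_mod_cast hn
  have e := integral_rpow_cell hα one_pos n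
  simp only [Nat.cast_one, div_one, Real.one_rpow, one_mul] at e
  have hi : IntervalIntegrable (fun u : ℝ => u ^ (α - 1)) volume (n : ℝ) ((n + 1 : ℕ) : ℝ) :=
    intervalIntegral.intervalIntegrable_rpow' (by linarith)
  have hle : (n : ℝ) ≤ ((n + 1 : ℕ) : ℝ) := by push_cast; linarith
  rw [← e]
  constructor
  · have := intervalIntegral.integral_mono_on (μ := volume) hle
      (f := fun _ => (n + 1 : ℝ) ^ (α - 1)) (by simp) hi fun u hu =>
        Real.rpow_le_rpow_of_nonpos (hn0.trans_le hu.1) (by simpa using hu.2) (by linarith)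
    simpa using this
  · have := intervalIntegral.integral_mono_on (μ := volume) hle
      (g := fun _ => (n : ℝ) ^ (α - 1)) hi (by simp) fun u hu =>
        Real.rpow_le_rpow_of_nonpos hn0 hu.1 (by linarith)
    simpa using this

lemma powIncr_le {α : ℝ} (hα : 0 < α) (hα1 : α < 1) (n : ℕ) : powIncr α n ≤ 1 / α := by
  rcases n.eq_zero_or_pos with rfl | hn
  · simp [powIncr, Real.zero_rpow hα.ne']
  · refine (powIncr_mem hα hα1 hn).2.trans ?_
    have : (n : ℝ) ^ (α - 1) ≤ 1 :=
      Real.rpow_le_one_of_one_le_of_nonpos (by exact_mod_cast hn) (by linarith)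
    exact this.trans ((one_le_div hα).2 hα1.le)

lemma sum_powIncr {α : ℝ} (hα : 0 < α) (n : ℕ) :
    ∑ j ∈ range n, powIncr α j = (n : ℝ) ^ α / α := by
  simp_rw [powIncr, ← sum_div]
  congr 1
  have := sum_range_sub (fun j : ℕ => (j : ℝ) ^ α) n
  simp only [Nat.cast_add, Nat.cast_one, Nat.cast_zero, Real.zero_rpow hα.ne', sub_zero] at this
  exact this

lemma sum_abs_Gamma_mul_binCoef_sub_le {α : ℝ} (hα : 0 < α) (hα1 : α < 1) (n : ℕ) :
    ∑ j ∈ range (n + 1), |Real.Gamma α * binCoef α j - powIncr α j| ≤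
      |Real.Gamma α - 1 / α| + 1 := by
  have h : ∀ n : ℕ, ∑ j ∈ range (n + 1), |Real.Gamma α * binCoef α j - powIncr α j| ≤
      |Real.Gamma α - 1 / α| + 1 - (n + 1 : ℝ) ^ (α - 1) := by
    intro n
    induction n with
    | zero => simp [powIncr, Real.zero_rpow hα.ne']
    | succ n ih =>
      rw [sum_range_succ]
      have h1 := powIncr_mem hα hα1 n.succ_pos
      have h2 := Gamma_mul_binCoef_le hα hα1 n.succ_pos
      have h3 := le_Gamma_mul_binCoef hα hα1 n.succ
      have h4 : |Real.Gamma α * binCoef α (n + 1) - powIncr α (n + 1)| ≤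
          ((n + 1 : ℕ) : ℝ) ^ (α - 1) - (((n + 1 : ℕ) : ℝ) + 1) ^ (α - 1) := by
        rw [abs_le]; constructor <;> linarith
      push_cast at h4 ⊢
      linarith
  exact (h n).trans (by linarith [Real.rpow_nonneg (by positivity : (0 : ℝ) ≤ n + 1) (α - 1)])

lemma abs_integral_rpow_mul_le {α : ℝ} (hα : 0 < α) {G : ℝ → ℝ} {a b C : ℝ} (ha : 0 ≤ a)
    (hab : a ≤ b) (hG : ∀ u ∈ Set.Ioc a b, |G u| ≤ C) :
    |∫ u in a..b, u ^ (α - 1) * G u| ≤ C * ∫ u in a..b, u ^ (α - 1) := by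
  rw [← intervalIntegral.integral_const_mul, ← Real.norm_eq_abs]
  refine intervalIntegral.norm_integral_le_of_norm_le hab (ae_of_all _ fun u hu => ?_)
    ((intervalIntegral.intervalIntegrable_rpow' (by linarith)).const_mul C)
  have h0 : 0 ≤ u ^ (α - 1) := Real.rpow_nonneg (ha.trans hu.1.le) _
  rw [Real.norm_eq_abs, abs_mul, abs_of_nonneg h0, mul_comm]
  exact mul_le_mul_of_nonneg_right (hG u hu) h0

lemma continuous_of_abs_sub_le {F : ℝ → ℝ} {K : ℝ} (hK : ∀ s t, |F s - F t| ≤ K * |s - t|) :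
    Continuous F :=
  (LipschitzWith.of_dist_le' (K := K) fun s t => by simpa [Real.dist_eq] using hK s t).continuous

lemma intervalIntegrable_rpow_mul {α : ℝ} (hα : 0 < α) {G : ℝ → ℝ} (hG : Continuous G) (a b : ℝ) :
    IntervalIntegrable (fun u => u ^ (α - 1) * G u) volume a b :=
  (intervalIntegral.intervalIntegrable_rpow' (by linarith)).mul_continuousOn hG.continuousOn

lemma integral_sub_rpow_mul (α x : ℝ) (F : ℝ → ℝ) :
    ∫ t in (0 : ℝ)..x, (x - t) ^ (α - 1) * F t =
      ∫ u in (0 : ℝ)..x, u ^ (α - 1) * F (x - u) := by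
  have := intervalIntegral.integral_comp_sub_left (a := 0) (b := x)
    (fun u : ℝ => u ^ (α - 1) * F (x - u)) x
  simpa using this

lemma abs_cell_sub_le {α : ℝ} (hα : 0 < α) {F : ℝ → ℝ} {M K x : ℝ}
    (hM : ∀ t, |F t| ≤ M) (hK : ∀ s t, |F s - F t| ≤ K * |s - t|) {N k n : ℕ} (hN : 0 < N)
    (hkx : (k : ℝ) ≤ N * x) (hxk : N * x < k + 1) (hn : n ≤ k) :
    |(N : ℝ) ^ (-α) * (Real.Gamma α * binCoef α n * F ((k - n : ℕ) / N)) -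
        ∫ u in ((n : ℝ) / N)..((n + 1 : ℕ) / N : ℝ), u ^ (α - 1) * F (x - u)| ≤
      (N : ℝ) ^ (-α) * (M * |Real.Gamma α * binCoef α n - powIncr α n|) +
        K / N * ((N : ℝ) ^ (-α) * powIncr α n) := by
  have hN0 : (0 : ℝ) < N := by exact_mod_cast hN
  have hK0 : 0 ≤ K := by simpa using (abs_nonneg _).trans (hK 1 0)
  have hNa : 0 ≤ (N : ℝ) ^ (-α) := by positivity
  set y : ℝ := ((k - n : ℕ) / N : ℝ) with hy
  have hcell := integral_rpow_cell hα hN n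
  have hle : (n : ℝ) / N ≤ ((n + 1 : ℕ) : ℝ) / N := by gcongr; omega
  have hFc := continuous_of_abs_sub_le hK
  have e : ∫ u in ((n : ℝ) / N)..((n + 1 : ℕ) / N : ℝ), u ^ (α - 1) * F (x - u) =
      (N : ℝ) ^ (-α) * powIncr α n * F y +
      ∫ u in ((n : ℝ) / N)..((n + 1 : ℕ) / N : ℝ), u ^ (α - 1) * (F (x - u) - F y) := by
    rw [← hcell, ← intervalIntegral.integral_mul_const, ← intervalIntegral.integral_add]
    · exact intervalIntegral.integral_congr fun u _ => by ring
    · exact intervalIntegrable_rpow_mul hα continuous_const _ _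
    · exact intervalIntegrable_rpow_mul hα (by fun_prop) _ _
  have h2 := abs_integral_rpow_mul_le hα (G := fun u => F (x - u) - F y) (C := K / N)
    (by positivity) hle fun u hu => by
      refine (hK _ _).trans ?_
      rw [div_eq_mul_inv]
      refine mul_le_mul_of_nonneg_left ?_ hK0
      have h3 := (div_lt_iff₀ hN0).1 hu.1
      have h4 := (le_div_iff₀ hN0).1 hu.2
      have h5 : (x - u - y) * N = N * x - u * N - (k - n) := by
        rw [hy, sub_mul, div_mul_cancel₀ _ hN0.ne', Nat.cast_sub hn]; ring
      rw [← one_div, le_div_iff₀ hN0]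
      rw [show |x - u - y| * (N : ℝ) = |(x - u - y) * N| by rw [abs_mul, abs_of_pos hN0], h5,
        abs_le]
      push_cast at h4
      constructor <;> linarith
  rw [hcell] at h2
  rw [e, show (N : ℝ) ^ (-α) * (Real.Gamma α * binCoef α n * F y) -
    ((N : ℝ) ^ (-α) * powIncr α n * F y + ∫ u in ((n : ℝ) / N)..((n + 1 : ℕ) / N : ℝ),
      u ^ (α - 1) * (F (x - u) - F y)) = (N : ℝ) ^ (-α) * (F y *
      (Real.Gamma α * binCoef α n - powIncr α n)) - ∫ u in ((n : ℝ) / N)..((n + 1 : ℕ) / N : ℝ),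
      u ^ (α - 1) * (F (x - u) - F y) by ring]
  refine (abs_sub _ _).trans (add_le_add ?_ h2)
  rw [abs_mul, abs_of_nonneg hNa, abs_mul]
  exact mul_le_mul_of_nonneg_left (mul_le_mul_of_nonneg_right (hM _) (abs_nonneg _)) hNa

lemma abs_sum_binCoef_mul_sub_integral_le {α : ℝ} (hα : 0 < α) (hα1 : α < 1) {F : ℝ → ℝ}
    {M K x : ℝ} (hx0 : 0 < x) (hx1 : x < 1)
    (hM : ∀ t, |F t| ≤ M) (hK : ∀ s t, |F s - F t| ≤ K * |s - t|) {N k : ℕ} (hN : 0 < N)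
    (hkx : (k : ℝ) ≤ N * x) (hxk : N * x < k + 1) :
    |Real.Gamma α * ((N : ℝ) ^ (-α) * ∑ i ∈ range (k + 1), binCoef α (k - i) * F (i / N)) -
        ∫ t in (0 : ℝ)..x, (x - t) ^ (α - 1) * F t| ≤
      (N : ℝ) ^ (-α) * (M * (|Real.Gamma α - 1 / α| + 1 + 1 / α)) + K / N * (1 / α) := by
  have hN0 : (0 : ℝ) < N := by exact_mod_cast hN
  have hK0 : 0 ≤ K := by simpa using (abs_nonneg _).trans (hK 1 0)
  have hM0 : 0 ≤ M := (abs_nonneg _).trans (hM 0)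
  have hNa : 0 ≤ (N : ℝ) ^ (-α) := by positivity
  have hFc := continuous_of_abs_sub_le hK
  have hint : ∀ a b, IntervalIntegrable (fun u => u ^ (α - 1) * F (x - u)) volume a b :=
    fun a b => intervalIntegrable_rpow_mul hα (by fun_prop) a b
  have hkN : k + 1 ≤ N := by
    have : (k : ℝ) < N := hkx.trans_lt (by nlinarith)
    exact_mod_cast this
  have hadj := intervalIntegral.sum_integral_adjacent_intervals (μ := volume)
    (a := fun n : ℕ => (n : ℝ) / N) (n := k + 1) fun n _ => hint _ _
  have hsplit := intervalIntegral.integral_add_adjacent_intervals (hint 0 x)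
    (hint x ((k + 1 : ℕ) / N))
  simp only [Nat.cast_zero, zero_div] at hadj
  have hxk' : x ≤ ((k + 1 : ℕ) : ℝ) / N := by rw [le_div_iff₀ hN0]; push_cast; linarith
  have hkx' : (k : ℝ) / N ≤ x := by rw [div_le_iff₀ hN0]; linarith
  have htail : |∫ u in x..((k + 1 : ℕ) / N : ℝ), u ^ (α - 1) * F (x - u)| ≤
      M * ((N : ℝ) ^ (-α) * (1 / α)) := by
    refine (abs_integral_rpow_mul_le hα (C := M) hx0.le hxk' fun u _ => hM _).trans ?_
    refine mul_le_mul_of_nonneg_left ?_ hM0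
    refine le_trans ?_ (mul_le_mul_of_nonneg_left (powIncr_le hα hα1 k) hNa)
    rw [← integral_rpow_cell hα hN k, ← intervalIntegral.integral_add_adjacent_intervals
      (a := (k : ℝ) / N)
      (b := x) (intervalIntegral.intervalIntegrable_rpow' (by linarith))
      (intervalIntegral.intervalIntegrable_rpow' (by linarith))]
    exact le_add_of_nonneg_left (intervalIntegral.integral_nonneg hkx' fun u hu =>
      Real.rpow_nonneg ((by positivity : (0 : ℝ) ≤ (k : ℝ) / N).trans hu.1) _)
  have hsum : |Real.Gamma α * ((N : ℝ) ^ (-α) *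
      ∑ i ∈ range (k + 1), binCoef α (k - i) * F (i / N)) -
      ∫ u in (0 : ℝ)..((k + 1 : ℕ) / N : ℝ), u ^ (α - 1) * F (x - u)| ≤
      (N : ℝ) ^ (-α) * (M * (|Real.Gamma α - 1 / α| + 1)) + K / N * (1 / α) := by
    have hrefl := sum_range_reflect (fun i => binCoef α (k - i) * F (i / N)) (k + 1)
    rw [← hadj, ← hrefl, mul_sum, mul_sum, ← sum_sub_distrib]
    refine (abs_sum_le_sum_abs _ _).trans ?_
    refine (sum_le_sum (g := fun n => (N : ℝ) ^ (-α) *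
      (M * |Real.Gamma α * binCoef α n - powIncr α n|) +
        K / N * ((N : ℝ) ^ (-α) * powIncr α n)) fun n hn => ?_).trans ?_
    · have hn' : n ≤ k := by simpa [Nat.lt_succ_iff] using hn
      have := abs_cell_sub_le hα hM hK hN hkx hxk hn'
      rwa [Nat.add_sub_cancel, Nat.sub_sub_self hn', mul_left_comm (Real.Gamma α),
        ← mul_assoc (Real.Gamma α)]
    · rw [sum_add_distrib, ← mul_sum, ← mul_sum, ← mul_sum, ← mul_sum, sum_powIncr hα]
      refine add_le_add (mul_le_mul_of_nonneg_left (mul_le_mul_of_nonneg_left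
        (sum_abs_Gamma_mul_binCoef_sub_le hα hα1 k) hM0) hNa)
        (mul_le_mul_of_nonneg_left ?_ (by positivity))
      rw [Real.rpow_neg hN0.le, ← mul_div_assoc, inv_mul_eq_div]
      refine div_le_div_of_nonneg_right ?_ hα.le
      rw [div_le_one (by positivity)]
      exact Real.rpow_le_rpow (by positivity) (by exact_mod_cast hkN) hα.le
  rw [integral_sub_rpow_mul]
  have := (abs_add_le _ _).trans (add_le_add hsum htail)
  rw [← hsplit] at this
  calc _ = _ := by congr 1; ring
    _ ≤ _ := this
    _ = _ := by ring

lemma tendsto_sum_invKer_mul {α : ℝ} (hα : 0 < α) (hα1 : α < 1) {F : ℝ → ℝ}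
    {M K x : ℝ} (hx0 : 0 < x) (hx1 : x < 1)
    (hM : ∀ t, |F t| ≤ M) (hK : ∀ s t, |F s - F t| ≤ K * |s - t|) :
    Tendsto (fun N : ℕ => (N : ℝ) ^ (-α) *
        ∑ l ∈ range (N + 1), invKer α ⌊(N : ℝ) * x⌋₊ l * F (l / N)) atTop
      (nhds (1 / ((2 : ℝ) ^ α * Real.Gamma α) *
        ∫ t in (0 : ℝ)..x, (x - t) ^ (α - 1) * F t)) := by
  have hK0 : 0 ≤ K := by simpa using (abs_nonneg _).trans (hK 1 0)
  have hM0 : 0 ≤ M := (abs_nonneg _).trans (hM 0)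
  have hG := Real.Gamma_pos_of_pos hα
  have hNa : Tendsto (fun N : ℕ => (N : ℝ) ^ (-α)) atTop (nhds 0) :=
    (tendsto_rpow_neg_atTop hα).comp tendsto_natCast_atTop_atTop
  have hKN : Tendsto (fun N : ℕ => K / (N : ℝ)) atTop (nhds 0) :=
    tendsto_const_div_atTop_nhds_zero_nat K
  have hfl : ∀ N : ℕ, (⌊(N : ℝ) * x⌋₊ : ℝ) ≤ N * x := fun N => Nat.floor_le (by positivity)
  have hkN : ∀ N : ℕ, ⌊(N : ℝ) * x⌋₊ ≤ N := fun N => by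
    have : (⌊(N : ℝ) * x⌋₊ : ℝ) ≤ N := (hfl N).trans (mul_le_of_le_one_right (by positivity) hx1.le)
    exact_mod_cast this
  have hgap : Tendsto (fun N : ℕ => N + 1 - ⌊(N : ℝ) * x⌋₊) atTop atTop := by
    refine tendsto_natCast_atTop_iff (R := ℝ).1 ?_
    refine tendsto_atTop_mono (fun N => ?_)
      (tendsto_natCast_atTop_atTop.atTop_mul_const (sub_pos.2 hx1))
    rw [Nat.cast_sub ((hkN N).trans N.le_succ)]
    push_cast
    linarith [hfl N]
  have hbin : Tendsto (fun N : ℕ => binCoef α (N + 1 - ⌊(N : ℝ) * x⌋₊)) atTop (nhds 0) :=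
    (tendsto_binCoef hα hα1).comp hgap
  set S : ℕ → ℝ := fun N => ∑ s ∈ range (N + 1), binCoef α s
  have hS : ∀ N : ℕ, 0 < N → (N : ℝ) ^ (-α) * S N ≤ 2 / (α * Real.Gamma α) := fun N hN => by
    have hN0 : (0 : ℝ) < N := by exact_mod_cast hN
    rw [Real.rpow_neg hN0.le, inv_mul_le_iff₀ (by positivity), mul_comm]
    exact sum_binCoef_le hα hα1 hN
  have hS0 : ∀ N, 0 ≤ S N := fun N => sum_nonneg fun _ _ => (binCoef_pos hα _).le
  have h1 : Tendsto (fun N : ℕ => (N : ℝ) ^ (-α) *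
      (∑ l ∈ range (N + 1), invKer α ⌊(N : ℝ) * x⌋₊ l * F (l / N) - (2 : ℝ) ^ (-α) *
        ∑ i ∈ range (⌊(N : ℝ) * x⌋₊ + 1), binCoef α (⌊(N : ℝ) * x⌋₊ - i) * F (i / N)))
      atTop (nhds 0) := by
    have hlim : Tendsto (fun N : ℕ => (M * binCoef α (N + 1 - ⌊(N : ℝ) * x⌋₊) +
        K * (2 / (α * Real.Gamma α)) * (N : ℝ) ^ (-(1 - α))) * (2 / (α * Real.Gamma α)))
        atTop (nhds 0) := by
      have := (tendsto_rpow_neg_atTop (by linarith : 0 < 1 - α)).comp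
        (tendsto_natCast_atTop_atTop (R := ℝ))
      simpa using ((hbin.const_mul M).add (this.const_mul (K * (2 / (α * Real.Gamma α))))).mul_const
        (2 / (α * Real.Gamma α))
    refine squeeze_zero_norm' ?_ hlim
    filter_upwards [eventually_gt_atTop 0] with N hN
    have hN0 : (0 : ℝ) < N := by exact_mod_cast hN
    have hb := (binCoef_pos hα (N + 1 - ⌊(N : ℝ) * x⌋₊)).le
    rw [Real.norm_eq_abs, abs_mul, abs_of_nonneg (by positivity)]
    have e : K / N * S N = K * (N : ℝ) ^ (-(1 - α)) * ((N : ℝ) ^ (-α) * S N) := by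
      have : (N : ℝ) ^ (-(1 - α)) * (N : ℝ) ^ (-α) = (N : ℝ)⁻¹ := by
        rw [← Real.rpow_add hN0, ← Real.rpow_neg_one]; congr 1; ring
      rw [div_eq_mul_inv, ← this]; ring
    calc _ ≤ (N : ℝ) ^ (-α) * ((M * binCoef α (N + 1 - ⌊(N : ℝ) * x⌋₊) + K / N * S N) * S N) :=
          mul_le_mul_of_nonneg_left (abs_sum_invKer_mul_sub_le hα hα1 hM hK hN (hkN N))
            (by positivity)
      _ = (M * binCoef α (N + 1 - ⌊(N : ℝ) * x⌋₊) + K / N * S N) * ((N : ℝ) ^ (-α) * S N) := by ring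
      _ ≤ _ := by
        refine mul_le_mul (add_le_add le_rfl ?_) (hS N hN) (mul_nonneg (by positivity) (hS0 N))
          (by positivity)
        rw [e, mul_right_comm]
        exact mul_le_mul_of_nonneg_right (mul_le_mul_of_nonneg_left (hS N hN) hK0) (by positivity)
  have h2 : Tendsto (fun N : ℕ => Real.Gamma α * ((N : ℝ) ^ (-α) *
      ∑ i ∈ range (⌊(N : ℝ) * x⌋₊ + 1), binCoef α (⌊(N : ℝ) * x⌋₊ - i) * F (i / N))) atTop
      (nhds (∫ t in (0 : ℝ)..x, (x - t) ^ (α - 1) * F t)) := by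
    rw [tendsto_iff_norm_sub_tendsto_zero]
    have hlim := (hNa.mul_const (M * (|Real.Gamma α - 1 / α| + 1 + 1 / α))).add
      (hKN.mul_const (1 / α))
    simp only [zero_mul, add_zero] at hlim
    refine squeeze_zero' (Eventually.of_forall fun _ => norm_nonneg _) ?_ hlim
    filter_upwards [eventually_gt_atTop 0] with N hN
    exact abs_sum_binCoef_mul_sub_integral_le hα hα1 hx0 hx1 hM hK hN (hfl N)
      (Nat.lt_floor_add_one _)
  have h3 := h1.add (h2.const_mul ((2 : ℝ) ^ (-α) * (Real.Gamma α)⁻¹))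
  rw [zero_add] at h3
  convert h3 using 2 with N
  · field_simp
    ring
  · rw [Real.rpow_neg (by norm_num), one_div, mul_inv]

lemma sum_rpow_neg_le {g : ℝ} (hg : 0 < g) (hg1 : g < 1) (m : ℕ) :
    ∑ j ∈ range m, (j + 1 : ℝ) ^ (-g) ≤ (m : ℝ) ^ (1 - g) / (1 - g) := by
  rw [← sum_powIncr (by linarith)]
  refine sum_le_sum fun j _ => ?_
  rcases j.eq_zero_or_pos with rfl | hj
  · have : 0 < 1 - g := by linarith
    simp only [powIncr, Nat.cast_zero, zero_add, Real.one_rpow, Real.zero_rpow this.ne', sub_zero]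
    rw [le_div_iff₀ this]; linarith
  · simpa using (powIncr_mem (α := 1 - g) (by linarith) (by linarith) hj).1

lemma sum_ite_div_rpow_neg_le {g ε : ℝ} (hg : 0 < g) (hg1 : g < 1) (hε : 0 < ε) {N : ℕ}
    (hN : 0 < N) :
    ∑ l ∈ range (N + 1), (if 0 < l ∧ (l : ℝ) < ε * N then ((l : ℝ) / N) ^ (-g) else 0) ≤
      N * (ε ^ (1 - g) / (1 - g)) := by
  have hN0 : (0 : ℝ) < N := by exact_mod_cast hN
  have hg' : 0 < 1 - g := by linarith
  rw [sum_range_succ']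
  simp only [lt_irrefl, false_and, if_false, add_zero, Nat.succ_pos, true_and, ← sum_filter]
  calc _ ≤ ∑ j ∈ range ⌊ε * N⌋₊, (((j + 1 : ℕ) : ℝ) / N) ^ (-g) := by
        refine sum_le_sum_of_subset_of_nonneg (fun j hj => ?_) fun _ _ _ => by positivity
        rw [mem_range, Nat.lt_iff_add_one_le]
        exact Nat.le_floor (mem_filter.1 hj).2.le
    _ = (N : ℝ) ^ g * ∑ j ∈ range ⌊ε * N⌋₊, (j + 1 : ℝ) ^ (-g) := by
        rw [mul_sum]
        refine sum_congr rfl fun j _ => ?_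
        rw [Real.div_rpow (by positivity) hN0.le, Real.rpow_neg hN0.le]
        push_cast; field_simp
    _ ≤ (N : ℝ) ^ g * ((ε * N) ^ (1 - g) / (1 - g)) := by
        refine mul_le_mul_of_nonneg_left ((sum_rpow_neg_le hg hg1 _).trans ?_) (by positivity)
        exact div_le_div_of_nonneg_right (Real.rpow_le_rpow (by positivity)
          (Nat.floor_le (by positivity)) hg'.le) hg'.le
    _ = _ := by
        rw [Real.mul_rpow hε.le hN0.le]
        have : (N : ℝ) ^ g * (N : ℝ) ^ (1 - g) = N := by
          rw [← Real.rpow_add hN0]; simp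
        linear_combination (ε ^ (1 - g) / (1 - g)) * this

/-- The truncation of `f` which is constant on `(-∞, ε]` and on `[1 - ε, ∞)`. -/
noncomputable def trunc (f : ℝ → ℝ) (ε t : ℝ) : ℝ := f (max ε (min t (1 - ε)))

lemma trunc_of_mem {f : ℝ → ℝ} {ε t : ℝ} (h1 : ε ≤ t) (h2 : t ≤ 1 - ε) : trunc f ε t = f t := by
  rw [trunc, min_eq_left h2, max_eq_right h1]

lemma exists_trunc_bounds {f : ℝ → ℝ} (hlip : LocLip01 f) {ε : ℝ} (hε : 0 < ε) (hε2 : ε ≤ 1 / 2) :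
    ∃ M K : ℝ, (∀ t, |trunc f ε t| ≤ M) ∧
      ∀ s t, |trunc f ε s - trunc f ε t| ≤ K * |s - t| := by
  obtain ⟨K, hK⟩ := hlip ε (1 - ε) hε (by linarith) (by linarith)
  have hmem : ∀ t, max ε (min t (1 - ε)) ∈ Set.Icc ε (1 - ε) := fun t =>
    ⟨le_max_left _ _, max_le (by linarith) (min_le_right _ _)⟩
  have hclamp : ∀ s t, |max ε (min s (1 - ε)) - max ε (min t (1 - ε))| ≤ |s - t| := fun s t => by
    rw [max_comm ε, max_comm ε]
    exact (abs_max_sub_max_le_abs _ _ _).trans (abs_inf_sub_inf_le_abs _ _ _)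
  have hK' : ∀ s t, |trunc f ε s - trunc f ε t| ≤ |K| * |max ε (min s (1 - ε)) -
      max ε (min t (1 - ε))| := fun s t =>
    (hK _ (hmem s) _ (hmem t)).trans (mul_le_mul_of_nonneg_right (le_abs_self K) (abs_nonneg _))
  refine ⟨|f ε| + |K|, |K|, fun t => ?_, fun s t =>
    (hK' s t).trans (mul_le_mul_of_nonneg_left (hclamp s t) (abs_nonneg _))⟩
  have h1 : trunc f ε ε = f ε := trunc_of_mem le_rfl (by linarith)
  have h2 := hK' t ε
  rw [h1, min_eq_left (by linarith : ε ≤ 1 - ε), max_self] at h2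
  have h3 : |max ε (min t (1 - ε)) - ε| ≤ 1 := by
    have := hmem t
    rw [abs_le]; constructor <;> linarith [this.1, this.2]
  calc |trunc f ε t| = |f ε + (trunc f ε t - f ε)| := by ring_nf
    _ ≤ |f ε| + |trunc f ε t - f ε| := abs_add_le _ _
    _ ≤ _ := by nlinarith [abs_nonneg K]

lemma exists_abs_le {α : ℝ} (hα : 0 < α) (hα1 : α < 1) {f : ℝ → ℝ} (hlip : LocLip01 f)
    (hmem : MemL1Class α f) : ∃ g C : ℝ, 1 / 2 < g ∧ g < 1 / (1 + α) ∧ 0 ≤ C ∧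
      ∀ t, 0 < t → t < 1 → |f t| ≤ C * (t ^ (-g) + (1 - t) ^ (-g)) := by
  obtain ⟨γ, hγ0, hγ1, h0, h1⟩ := hmem
  obtain ⟨g, hg1, hg2⟩ : ∃ g, max (1 - α) (1 / 2) < g ∧ g < 1 / (1 + α) := by
    refine exists_between (max_lt ?_ ?_)
    · rw [lt_div_iff₀ (by linarith)]; nlinarith
    · rw [lt_div_iff₀ (by linarith)]; linarith
  have hγg : γ ≤ g := hγ1.trans ((le_max_left _ _).trans hg1.le)
  have hg0 : 1 / 2 < g := (le_max_right _ _).trans_lt hg1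
  have key : ∀ h : ℝ → ℝ, h =O[nhdsWithin 0 (Set.Ioi 0)] (fun t : ℝ => t ^ (-γ)) →
      ∃ c u : ℝ, 0 ≤ c ∧ 0 < u ∧ ∀ t, 0 < t → t < u → t < 1 → |h t| ≤ c * t ^ (-g) := fun h hh => by
    obtain ⟨c, hc, hb⟩ := hh.exists_nonneg
    obtain ⟨u, hu, hsub⟩ := mem_nhdsGT_iff_exists_Ioo_subset.1 hb.bound
    refine ⟨c, u, hc, hu, fun t ht htu ht1 => ?_⟩
    have := hsub ⟨ht, htu⟩
    simp only [Set.mem_ofPred_eq, Real.norm_eq_abs, abs_of_pos (Real.rpow_pos_of_pos ht _)] at this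
    exact this.trans (mul_le_mul_of_nonneg_left
      (Real.rpow_le_rpow_of_exponent_ge ht ht1.le (by linarith)) hc)
  obtain ⟨c₀, u₀, hc₀, hu₀, hb₀⟩ := key _ h0
  obtain ⟨c₁, u₁, hc₁, hu₁, hb₁⟩ := key _ h1
  set δ := min (1 / 2) (min u₀ u₁) with hδ
  have hδ0 : 0 < δ := by positivity
  have hδ1 : δ ≤ 1 / 2 := min_le_left _ _
  have hδu₀ : δ ≤ u₀ := (min_le_right _ _).trans (min_le_left _ _)
  have hδu₁ : δ ≤ u₁ := (min_le_right _ _).trans (min_le_right _ _)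
  obtain ⟨M, K, hM, -⟩ := exists_trunc_bounds hlip hδ0 hδ1
  have hM0 : 0 ≤ M := (abs_nonneg _).trans (hM 0)
  refine ⟨g, c₀ + c₁ + M, hg0, hg2, by positivity, fun t ht ht1 => ?_⟩
  have hp0 : 0 < t ^ (-g) := Real.rpow_pos_of_pos ht _
  have hp1 : 0 < (1 - t) ^ (-g) := Real.rpow_pos_of_pos (by linarith) _
  rcases lt_or_ge t δ with h | h
  · have := hb₀ t ht (h.trans_le hδu₀) ht1
    nlinarith [mul_nonneg (add_nonneg hc₁ hM0) hp0.le,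
      mul_nonneg (add_nonneg (add_nonneg hc₀ hc₁) hM0) hp1.le]
  rcases lt_or_ge (1 - t) δ with h' | h'
  · have := hb₁ (1 - t) (by linarith) (h'.trans_le hδu₁) (by linarith)
    rw [sub_sub_cancel] at this
    nlinarith [mul_nonneg (add_nonneg hc₀ hM0) hp1.le,
      mul_nonneg (add_nonneg (add_nonneg hc₀ hc₁) hM0) hp0.le]
  · have := hM t
    rw [trunc_of_mem h (by linarith)] at this
    have h2 : 1 ≤ t ^ (-g) := Real.one_le_rpow_of_pos_of_le_one_of_nonpos ht ht1.le (by linarith)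
    nlinarith [mul_nonneg (add_nonneg hc₀ hc₁) hp0.le, mul_le_mul_of_nonneg_left h2 hM0,
      mul_nonneg (add_nonneg (add_nonneg hc₀ hc₁) hM0) hp1.le]

lemma abs_sub_trunc_le {f : ℝ → ℝ} {g C ε : ℝ} (hg : 0 < g) (hC : 0 ≤ C) (hε2 : ε ≤ 1 / 2)
    (hf : ∀ t, 0 < t → t < 1 → |f t| ≤ C * (t ^ (-g) + (1 - t) ^ (-g))) {t : ℝ} (ht : 0 < t)
    (hε : t < ε) : |f t - trunc f ε t| ≤ 4 * C * t ^ (-g) := by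
  have e : trunc f ε t = f ε := by
    rw [trunc, max_eq_left (min_le_of_left_le hε.le)]
  have mono : ∀ s, t ≤ s → s ^ (-g) ≤ t ^ (-g) := fun s hs =>
    Real.rpow_le_rpow_of_nonpos ht hs (by linarith)
  rw [e]
  refine (abs_sub _ _).trans ?_
  have h1 := hf t ht (by linarith)
  have h2 := hf ε (ht.trans hε) (by linarith)
  have h3 := mul_le_mul_of_nonneg_left (add_le_add (add_le_add (mono (1 - t) (by linarith))
    (mono ε hε.le)) (mono (1 - ε) (by linarith))) hC
  linarith

lemma trunc_one_sub (f : ℝ → ℝ) {ε : ℝ} (hε2 : ε ≤ 1 / 2) (t : ℝ) :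
    trunc (fun s => f (1 - s)) ε (1 - t) = trunc f ε t := by
  simp only [trunc]
  congr 1
  rcases le_total t ε with h | h <;> rcases le_total t (1 - ε) with h' | h' <;>
  grind

lemma abs_sub_trunc_le' {f : ℝ → ℝ} {g C ε : ℝ} (hg : 0 < g) (hC : 0 ≤ C) (hε2 : ε ≤ 1 / 2)
    (hf : ∀ t, 0 < t → t < 1 → |f t| ≤ C * (t ^ (-g) + (1 - t) ^ (-g))) {t : ℝ} (ht : t < 1)
    (hε : 1 - ε < t) : |f t - trunc f ε t| ≤ 4 * C * (1 - t) ^ (-g) := by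
  have := abs_sub_trunc_le (f := fun s => f (1 - s)) (t := 1 - t) hg hC hε2
    (fun s hs hs1 => by simpa [add_comm] using hf (1 - s) (by linarith) (by linarith))
    (by linarith) (by linarith)
  simpa [trunc_one_sub f hε2] using this

lemma tendsto_of_approx {u : ℕ → ℝ} {ℓ : ℝ}
    (h : ∀ δ > 0, ∃ (v : ℕ → ℝ) (m : ℝ), Tendsto v atTop (nhds m) ∧ |m - ℓ| ≤ δ ∧
      ∀ᶠ N in atTop, |u N - v N| ≤ δ) : Tendsto u atTop (nhds ℓ) := by
  rw [Metric.tendsto_nhds]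
  intro δ hδ
  obtain ⟨v, m, hv, hm, hu⟩ := h (δ / 3) (by positivity)
  filter_upwards [hu, Metric.tendsto_nhds.1 hv (δ / 4) (by positivity)] with N h1 h2
  rw [Real.dist_eq] at h2 ⊢
  rw [abs_le] at h1 hm
  rw [abs_lt] at h2 ⊢
  constructor <;> linarith [h1.1, h1.2, h2.1, h2.2, hm.1, hm.2]

lemma abs_invKer_le_of_dist {α : ℝ} (hα : 0 < α) (hα1 : α < 1) {c : ℝ} (hc : 0 < c) {N k l : ℕ}
    (hN : 0 < N) (h : c * N ≤ |(k : ℝ) - l|) :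
    |invKer α k l| ≤ (Real.Gamma α)⁻¹ * c ^ (α - 1) * (N : ℝ) ^ (α - 1) := by
  have hN0 : (0 : ℝ) < N := by exact_mod_cast hN
  have hd : ((k - l + (l - k) : ℕ) : ℝ) = |(k : ℝ) - l| := by
    rcases le_total k l with hkl | hkl
    · rw [Nat.sub_eq_zero_of_le hkl, zero_add, Nat.cast_sub hkl, abs_sub_comm, abs_of_nonneg]
      exact sub_nonneg.2 (by exact_mod_cast hkl)
    · rw [Nat.sub_eq_zero_of_le hkl, add_zero, Nat.cast_sub hkl, abs_of_nonneg]
      exact sub_nonneg.2 (by exact_mod_cast hkl)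
  have hpos : (0 : ℝ) < (k - l + (l - k) : ℕ) := by
    rw [hd]; exact (by positivity : 0 < c * N).trans_le h
  refine (abs_invKer_le hα hα1 k l).trans
    ((binCoef_le_rpow hα hα1 (by exact_mod_cast hpos)).trans ?_)
  rw [mul_assoc, ← Real.mul_rpow hc.le hN0.le]
  refine mul_le_mul_of_nonneg_left ?_ (inv_nonneg.2 (Real.Gamma_pos_of_pos hα).le)
  exact Real.rpow_le_rpow_of_nonpos (by positivity) (by rwa [hd]) (by linarith)

lemma abs_sum_invKer_mul_trunc_le {α : ℝ} (hα : 0 < α) (hα1 : α < 1) {f : ℝ → ℝ} {g C ε x M : ℝ}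
    (hx0 : 0 < x) (hx1 : x < 1) (hg : 0 < g) (hg1 : g < 1) (hC : 0 ≤ C)
    (hf : ∀ t, 0 < t → t < 1 → |f t| ≤ C * (t ^ (-g) + (1 - t) ^ (-g)))
    (hε : 0 < ε) (hεx : ε ≤ x / 2) (hεx' : ε ≤ (1 - x) / 2) (hM : ∀ t, |trunc f ε t| ≤ M) {N : ℕ}
    (hN : 4 ≤ N * x) :
    |(N : ℝ) ^ (-α) * ∑ l ∈ range (N + 1),
        invKer α ⌊(N : ℝ) * x⌋₊ l * (Xvec f N l - trunc f ε (l / N))| ≤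
      (Real.Gamma α)⁻¹ * (min x (1 - x) / 4) ^ (α - 1) *
        (2 * M / N + 8 * C * (ε ^ (1 - g) / (1 - g))) := by
  have hM0 : 0 ≤ M := (abs_nonneg _).trans (hM 0)
  have hN' : 0 < N := by
    rcases N.eq_zero_or_pos with rfl | h
    · norm_num at hN
    · exact h
  have hN0 : (0 : ℝ) < N := by exact_mod_cast hN'
  set k := ⌊(N : ℝ) * x⌋₊ with hk
  have hk1 : (k : ℝ) ≤ N * x := Nat.floor_le (by positivity)
  have hk2 : (N : ℝ) * x < k + 1 := Nat.lt_floor_add_one _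
  set c := min x (1 - x) / 4 with hc
  have hcx : c ≤ x / 4 := div_le_div_of_nonneg_right (min_le_left _ _) (by norm_num)
  have hcx' : c ≤ (1 - x) / 4 := div_le_div_of_nonneg_right (min_le_right _ _) (by norm_num)
  have hc0 : 0 < c := div_pos (lt_min hx0 (by linarith)) (by norm_num)
  set A := (Real.Gamma α)⁻¹ * c ^ (α - 1) with hA
  have hA0 : 0 ≤ A := mul_nonneg (inv_nonneg.2 (Real.Gamma_pos_of_pos hα).le) (by positivity)
  have hker : ∀ l : ℕ, ((l : ℝ) ≤ ε * N ∨ (1 - ε) * N ≤ l) →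
      |invKer α k l| ≤ A * (N : ℝ) ^ (α - 1) := fun l hl => by
    refine abs_invKer_le_of_dist hα hα1 hc0 hN' ?_
    have e1 : c * N ≤ x / 4 * N := mul_le_mul_of_nonneg_right hcx hN0.le
    have e2 : c * N ≤ (1 - x) / 4 * N := mul_le_mul_of_nonneg_right hcx' hN0.le
    have e3 : ε * N ≤ x / 2 * N := mul_le_mul_of_nonneg_right hεx hN0.le
    have e4 : ε * N ≤ (1 - x) / 2 * N := mul_le_mul_of_nonneg_right hεx' hN0.le
    have e5 : 0 ≤ (1 - x) * N := mul_nonneg (by linarith) hN0.le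
    rcases hl with h | h
    · exact le_trans (by linarith) (le_abs_self _)
    · exact le_trans (by linarith) (neg_le_abs _)
  set w : ℕ → ℝ := fun l => if 0 < l ∧ (l : ℝ) < ε * N then ((l : ℝ) / N) ^ (-g) else 0 with hw
  have hw0 : ∀ l, 0 ≤ w l := fun l => by simp only [hw]; split_ifs <;> positivity
  have hterm : ∀ l ∈ range (N + 1), |invKer α k l * (Xvec f N l - trunc f ε (l / N))| ≤
      A * (N : ℝ) ^ (α - 1) * (((if l = 0 then M else 0) + (if l = N then M else 0)) +
        4 * C * (w l + w (N - l))) := fun l hl => by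
    have hlN : l ≤ N := by simpa [Nat.lt_succ_iff] using hl
    have hP : 0 ≤ 4 * C * (w l + w (N - l)) := by have := hw0 l; have := hw0 (N - l); positivity
    have hAN : 0 ≤ A * (N : ℝ) ^ (α - 1) := by positivity
    rw [abs_mul]
    by_cases h0 : l = 0
    · subst h0
      refine mul_le_mul (hker 0 (Or.inl (by simp; positivity))) ?_ (abs_nonneg _) hAN
      have := hM ((0 : ℕ) / N)
      simp only [Xvec, true_or, if_true, zero_sub, abs_neg]
      split_ifs <;> linarith
    by_cases h1 : l = N
    · subst h1
      refine mul_le_mul (hker l (Or.inr (by nlinarith))) ?_ (abs_nonneg _) hAN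
      have := hM ((l : ℕ) / l)
      simp only [Xvec, or_true, if_true, zero_sub, abs_neg]
      split_ifs; linarith
    have hl0 : 0 < l := Nat.pos_of_ne_zero h0
    have hlN' : l < N := lt_of_le_of_ne hlN h1
    have ht0 : (0 : ℝ) < l / N := by positivity
    have ht1 : (l : ℝ) / N < 1 := by rw [div_lt_one hN0]; exact_mod_cast hlN'
    simp only [h0, h1, if_false, zero_add, Xvec, or_self]
    by_cases h2 : (l : ℝ) < ε * N
    · refine mul_le_mul (hker l (Or.inl h2.le)) ?_ (abs_nonneg _) hAN
      refine (abs_sub_trunc_le hg hC (by linarith) hf ht0 (by rwa [div_lt_iff₀ hN0])).trans ?_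
      refine mul_le_mul_of_nonneg_left ?_ (by positivity)
      have : w l = ((l : ℝ) / N) ^ (-g) := if_pos ⟨hl0, h2⟩
      rw [this]
      exact le_add_of_nonneg_right (hw0 _)
    by_cases h3 : ((N - l : ℕ) : ℝ) < ε * N
    · have h3' := h3
      rw [Nat.cast_sub hlN] at h3'
      refine mul_le_mul (hker l (Or.inr (by linarith))) ?_ (abs_nonneg _) hAN
      refine (abs_sub_trunc_le' hg hC (by linarith) hf ht1
        (by rw [lt_div_iff₀ hN0]; linarith)).trans ?_
      refine mul_le_mul_of_nonneg_left ?_ (by positivity)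
      have : w (N - l) = (1 - (l : ℝ) / N) ^ (-g) := by
        rw [hw]; simp only
        rw [if_pos ⟨by omega, h3⟩, Nat.cast_sub hlN, sub_div, div_self hN0.ne']
      rw [this]
      exact le_add_of_nonneg_left (hw0 _)
    · rw [trunc_of_mem (by rw [le_div_iff₀ hN0]; linarith), sub_self, abs_zero, mul_zero]
      · positivity
      · rw [Nat.cast_sub hlN] at h3
        rw [div_le_iff₀ hN0]; linarith
  have hsumw := sum_ite_div_rpow_neg_le hg hg1 hε hN'
  have hsumw' : ∑ l ∈ range (N + 1), w (N - l) = ∑ l ∈ range (N + 1), w l := by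
    simpa using sum_range_reflect w (N + 1)
  rw [abs_mul, abs_of_nonneg (by positivity)]
  calc _ ≤ (N : ℝ) ^ (-α) * ∑ l ∈ range (N + 1), A * (N : ℝ) ^ (α - 1) *
        (((if l = 0 then M else 0) + (if l = N then M else 0)) + 4 * C * (w l + w (N - l))) :=
        mul_le_mul_of_nonneg_left ((abs_sum_le_sum_abs _ _).trans (sum_le_sum hterm))
          (by positivity)
    _ = A * (N : ℝ)⁻¹ * (2 * M + 8 * C * ∑ l ∈ range (N + 1), w l) := by
        have e : (N : ℝ) ^ (-α) * (N : ℝ) ^ (α - 1) = (N : ℝ)⁻¹ := by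
          rw [← Real.rpow_add hN0, ← Real.rpow_neg_one]; congr 1; ring
        rw [← mul_sum, sum_add_distrib, sum_add_distrib, ← mul_sum, sum_add_distrib, hsumw',
          sum_ite_eq', sum_ite_eq', if_pos (by simp), if_pos (by simp), ← e]
        ring
    _ ≤ A * (N : ℝ)⁻¹ * (2 * M + 8 * C * (N * (ε ^ (1 - g) / (1 - g)))) := by
        gcongr
    _ = _ := by field_simp

lemma continuousOn_of_locLip {f : ℝ → ℝ} (hlip : LocLip01 f) : ContinuousOn f (Set.Ioo 0 1) := by
  intro t ht
  obtain ⟨ε, hε0, hε⟩ : ∃ ε, 0 < ε ∧ ε < min t (1 - t) :=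
    exists_between (lt_min ht.1 (by linarith [ht.2]))
  have h1 := hε.trans_le (min_le_left _ _)
  have h2 := hε.trans_le (min_le_right _ _)
  obtain ⟨M, K, -, hK⟩ := exists_trunc_bounds hlip hε0 (by linarith)
  refine ((continuous_of_abs_sub_le hK).continuousAt.congr ?_).continuousWithinAt
  filter_upwards [Ioo_mem_nhds h1 (by linarith : t < 1 - ε)] with s hs
  exact trunc_of_mem hs.1.le hs.2.le

lemma abs_integral_sub_trunc_le {α : ℝ} (hα : 0 < α) (hα1 : α < 1) {f : ℝ → ℝ} {g C ε x : ℝ}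
    (hlip : LocLip01 f) (hx0 : 0 < x) (hg : 0 < g) (hg1 : g < 1) (hC : 0 ≤ C)
    (hf : ∀ t, 0 < t → t < 1 → |f t| ≤ C * (t ^ (-g) + (1 - t) ^ (-g)))
    (hε : 0 < ε) (hεx : ε ≤ x / 2) (hεx' : ε ≤ (1 - x) / 2) :
    |(∫ t in (0 : ℝ)..x, (x - t) ^ (α - 1) * trunc f ε t) -
        ∫ t in (0 : ℝ)..x, (x - t) ^ (α - 1) * f t| ≤
      4 * C * (x / 2) ^ (α - 1) * (ε ^ (1 - g) / (1 - g)) := by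
  obtain ⟨M, K, -, hK⟩ := exists_trunc_bounds hlip hε (by linarith)
  have hFc := continuous_of_abs_sub_le hK
  have hint : IntervalIntegrable (fun t => (x - t) ^ (α - 1) * trunc f ε t) volume 0 x := by
    refine IntervalIntegrable.mul_continuousOn ?_ hFc.continuousOn
    simpa using ((intervalIntegral.intervalIntegrable_rpow' (a := 0) (b := x)
      (by linarith : -1 < α - 1)).comp_sub_left x).symm
  set B := 4 * C * (x / 2) ^ (α - 1) with hB
  set h : ℝ → ℝ := fun t => (x - t) ^ (α - 1) * (f t - trunc f ε t) with hh
  have hb : ∀ t ∈ Set.Ioc 0 ε, ‖h t‖ ≤ B * t ^ (-g) := fun t ht => by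
    have h1 : (x - t) ^ (α - 1) ≤ (x / 2) ^ (α - 1) :=
      Real.rpow_le_rpow_of_nonpos (by positivity) (by linarith [ht.2]) (by linarith)
    have h2 : |f t - trunc f ε t| ≤ 4 * C * t ^ (-g) := by
      rcases ht.2.lt_or_eq with h | h
      · exact abs_sub_trunc_le hg hC (by linarith) hf ht.1 h
      · rw [trunc_of_mem h.ge (by linarith), sub_self, abs_zero]
        have := Real.rpow_nonneg ht.1.le (-g)
        positivity
    rw [Real.norm_eq_abs, abs_mul, abs_of_nonneg (Real.rpow_nonneg (by linarith [ht.2]) _), hB,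
      mul_right_comm, mul_comm]
    exact mul_le_mul h2 h1 (Real.rpow_nonneg (by linarith [ht.2]) _) ((abs_nonneg _).trans h2)
  have hz : ∀ t ∈ Set.Icc ε x, h t = 0 := fun t ht => by
    simp only [hh]
    rw [trunc_of_mem ht.1 (by linarith [ht.2]), sub_self, mul_zero]
  have hdom : IntervalIntegrable (fun t : ℝ => B * t ^ (-g)) volume 0 ε :=
    (intervalIntegral.intervalIntegrable_rpow' (by linarith)).const_mul B
  have hi1 : IntervalIntegrable h volume 0 ε := by
    refine hdom.mono_fun' ?_ ?_
    · refine ContinuousOn.aestronglyMeasurable ?_ measurableSet_uIoc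
      rw [Set.uIoc_of_le hε.le]
      refine ContinuousOn.mul (fun t ht => ?_) (((continuousOn_of_locLip hlip).mono
        fun t ht => ⟨ht.1, by linarith [ht.2]⟩).sub hFc.continuousOn)
      exact ((continuousAt_const.sub continuousAt_id).rpow_const
        (Or.inl (by have := ht.2; simp; linarith))).continuousWithinAt
    · rw [Set.uIoc_of_le hε.le]
      exact (ae_restrict_mem measurableSet_Ioc).mono hb
  have hi2 : IntervalIntegrable h volume ε x := by
    refine (intervalIntegrable_const (c := (0 : ℝ))).congr ?_
    rw [Set.uIoc_of_le (by linarith)]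
    exact fun t ht => (hz t ⟨ht.1.le, ht.2⟩).symm
  have hzero : ∫ t in ε..x, h t = 0 := by
    rw [intervalIntegral.integral_congr (g := fun _ => (0 : ℝ))]
    · simp
    · rw [Set.uIcc_of_le (by linarith)]; exact hz
  have e : ∫ t in (0 : ℝ)..x, (x - t) ^ (α - 1) * f t =
      (∫ t in (0 : ℝ)..x, (x - t) ^ (α - 1) * trunc f ε t) + ∫ t in (0 : ℝ)..ε, h t := by
    have hadj := intervalIntegral.integral_add_adjacent_intervals hi1 hi2
    rw [hzero, add_zero] at hadj
    rw [hadj, ← intervalIntegral.integral_add hint (hi1.trans hi2)]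
    exact intervalIntegral.integral_congr fun t _ => by simp only [hh]; ring
  rw [e, sub_add_cancel_left, abs_neg, ← Real.norm_eq_abs]
  refine (intervalIntegral.norm_integral_le_of_norm_le hε.le (ae_of_all _ hb) hdom).trans ?_
  rw [intervalIntegral.integral_const_mul, integral_rpow (Or.inl (by linarith)),
    Real.zero_rpow (by linarith), sub_zero, neg_add_eq_sub]

lemma exists_sum_sq_Xvec_le {f : ℝ → ℝ} {g C : ℝ} (hg : 1 / 2 < g)
    (hf : ∀ t, 0 < t → t < 1 → |f t| ≤ C * (t ^ (-g) + (1 - t) ^ (-g))) :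
    ∃ D : ℝ, 0 ≤ D ∧ ∀ N : ℕ, 0 < N →
      ∑ l ∈ range (N + 1), Xvec f N l ^ 2 ≤ D * (N : ℝ) ^ (2 * g) := by
  set Z := ∑' n : ℕ, (n : ℝ) ^ (-(2 * g))
  have hsum : Summable fun n : ℕ => (n : ℝ) ^ (-(2 * g)) :=
    Real.summable_nat_rpow.2 (by linarith)
  have hZ0 : 0 ≤ Z := tsum_nonneg fun n => by positivity
  refine ⟨C ^ 2 * (4 * Z), by positivity, fun N hN => ?_⟩
  have hN0 : (0 : ℝ) < N := by exact_mod_cast hN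
  set v : ℕ → ℝ := fun l => ((l : ℝ) / N) ^ (-(2 * g)) with hv
  have hv0 : ∀ l, 0 ≤ v l := fun l => by positivity
  have hvs : ∑ l ∈ range (N + 1), v l ≤ (N : ℝ) ^ (2 * g) * Z := by
    have e : ∀ l, v l = (N : ℝ) ^ (2 * g) * (l : ℝ) ^ (-(2 * g)) := fun l => by
      simp only [hv]
      rw [Real.div_rpow (by positivity) hN0.le, Real.rpow_neg hN0.le]; field_simp
    simp_rw [e]
    rw [← mul_sum]
    exact mul_le_mul_of_nonneg_left (hsum.sum_le_tsum _ fun n _ => by positivity) (by positivity)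
  have hrefl : ∑ l ∈ range (N + 1), v (N - l) = ∑ l ∈ range (N + 1), v l := by
    simpa using sum_range_reflect v (N + 1)
  have hterm : ∀ l ∈ range (N + 1), Xvec f N l ^ 2 ≤ C ^ 2 * (2 * (v l + v (N - l))) := by
    intro l hl
    have hlN : l ≤ N := by simpa [Nat.lt_succ_iff] using hl
    have := hv0 l
    have := hv0 (N - l)
    rw [Xvec]
    split_ifs with h
    · rw [zero_pow two_ne_zero]; positivity
    · push Not at h
      have ht0 : (0 : ℝ) < l / N := div_pos (by exact_mod_cast Nat.pos_of_ne_zero h.1) hN0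
      have ht1 : (l : ℝ) / N < 1 := by
        rw [div_lt_one hN0]; exact_mod_cast lt_of_le_of_ne hlN h.2
      have h1 := pow_le_pow_left₀ (abs_nonneg _) (hf _ ht0 ht1) 2
      rw [sq_abs, mul_pow] at h1
      have e1 : v l = (((l : ℝ) / N) ^ (-g)) ^ 2 := by
        rw [← Real.rpow_natCast, ← Real.rpow_mul ht0.le, hv]; simp only; congr 1; push_cast; ring
      have e2 : v (N - l) = ((1 - (l : ℝ) / N) ^ (-g)) ^ 2 := by
        rw [← Real.rpow_natCast, ← Real.rpow_mul (by linarith), hv]; simp only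
        rw [Nat.cast_sub hlN, sub_div, div_self hN0.ne']
        congr 1; push_cast; ring
      rw [e1, e2]
      exact h1.trans (mul_le_mul_of_nonneg_left add_sq_le (sq_nonneg C))
  refine (sum_le_sum hterm).trans ?_
  rw [← mul_sum, ← mul_sum, sum_add_distrib, hrefl]
  nlinarith [mul_le_mul_of_nonneg_left hvs (sq_nonneg C)]

lemma tendsto_sum_invKer_mul_Xvec {α : ℝ} (hα : 0 < α) (hα1 : α < 1) {f : ℝ → ℝ} {g C x : ℝ}
    (hlip : LocLip01 f) (hx0 : 0 < x) (hx1 : x < 1) (hg : 0 < g) (hg1 : g < 1) (hC : 0 ≤ C)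
    (hf : ∀ t, 0 < t → t < 1 → |f t| ≤ C * (t ^ (-g) + (1 - t) ^ (-g))) :
    Tendsto (fun N : ℕ => (N : ℝ) ^ (-α) *
        ∑ l ∈ range (N + 1), invKer α ⌊(N : ℝ) * x⌋₊ l * Xvec f N l) atTop
      (nhds (1 / ((2 : ℝ) ^ α * Real.Gamma α) *
        ∫ t in (0 : ℝ)..x, (x - t) ^ (α - 1) * f t)) := by
  refine tendsto_of_approx fun δ hδ => ?_
  have hG := Real.Gamma_pos_of_pos hα
  set A := (Real.Gamma α)⁻¹ * (min x (1 - x) / 4) ^ (α - 1)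
  set P := 1 / ((2 : ℝ) ^ α * Real.Gamma α) with hP
  have hP0 : 0 ≤ P := by positivity
  have hpow : Tendsto (fun ε : ℝ => ε ^ (1 - g) / (1 - g)) (nhdsWithin 0 (Set.Ioi 0)) (nhds 0) := by
    have := ((Real.continuous_rpow_const (q := 1 - g) (by linarith)).tendsto 0).div_const (1 - g)
    rw [Real.zero_rpow (by linarith), zero_div] at this
    exact this.mono_left nhdsWithin_le_nhds
  have ht1 : Tendsto (fun ε : ℝ => P * (4 * C * (x / 2) ^ (α - 1) * (ε ^ (1 - g) / (1 - g))))
      (nhdsWithin 0 (Set.Ioi 0)) (nhds 0) := by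
    simpa using (hpow.const_mul (4 * C * (x / 2) ^ (α - 1))).const_mul P
  have ht2 : Tendsto (fun ε : ℝ => A * (8 * C * (ε ^ (1 - g) / (1 - g))))
      (nhdsWithin 0 (Set.Ioi 0)) (nhds 0) := by
    simpa using (hpow.const_mul (8 * C)).const_mul A
  have hx1' : 0 < 1 - x := by linarith
  obtain ⟨ε, hε1, hε2, hε, hεs⟩ := ((ht1.eventually_lt_const hδ).and
    ((ht2.eventually_lt_const hδ).and (Ioo_mem_nhdsGT
      (show (0 : ℝ) < min (x / 2) ((1 - x) / 2) by positivity)))).exists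
  have hεx := hεs.le.trans (min_le_left _ _)
  have hεx' := hεs.le.trans (min_le_right _ _)
  obtain ⟨M, K, hM, hK⟩ := exists_trunc_bounds hlip hε (by linarith)
  refine ⟨_, _, tendsto_sum_invKer_mul hα hα1 hx0 hx1 hM hK, ?_, ?_⟩
  · rw [← mul_sub, abs_mul, abs_of_nonneg hP0]
    exact (mul_le_mul_of_nonneg_left (abs_integral_sub_trunc_le hα hα1 hlip hx0 hg hg1 hC hf
      hε hεx hεx') hP0).trans hε1.le
  · have hlim : Tendsto (fun N : ℕ => A * (2 * M / N + 8 * C * (ε ^ (1 - g) / (1 - g)))) atTop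
        (nhds (A * (8 * C * (ε ^ (1 - g) / (1 - g))))) := by
      simpa using ((tendsto_const_div_atTop_nhds_zero_nat (2 * M)).add_const
        (8 * C * (ε ^ (1 - g) / (1 - g)))).const_mul A
    filter_upwards [hlim.eventually_lt_const hε2,
      (tendsto_natCast_atTop_atTop.atTop_mul_const hx0).eventually_ge_atTop 4] with N hN hN4
    refine le_trans (le_of_eq ?_) ((abs_sum_invKer_mul_trunc_le hα hα1 hx0 hx1 hg hg1 hC hf hε hεx
      hεx' hM hN4).trans hN.le)
    rw [← mul_sub, ← sum_sub_distrib]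
    simp_rw [mul_sub]

lemma tendsto_inv_limMat_sub {α : ℝ} (hα : 0 < α) (hα1 : α < 1) {f : ℝ → ℝ} {g C x : ℝ}
    (hx0 : 0 < x) (hx1 : x < 1) (hg : 1 / 2 < g) (hg1 : g < 1 / (1 + α))
    (hf : ∀ t, 0 < t → t < 1 → |f t| ≤ C * (t ^ (-g) + (1 - t) ^ (-g))) :
    Tendsto (fun N : ℕ => (((N : ℝ) ^ (-α) : ℝ) : ℂ) *
        ∑ l : Fin (N + 1), (limMat α N)⁻¹ (rowIdx N x) l * ((Xvec f N (l : ℕ) : ℝ) : ℂ) -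
      (((N : ℝ) ^ (-α) * ∑ l ∈ range (N + 1), invKer α ⌊(N : ℝ) * x⌋₊ l * Xvec f N l : ℝ) : ℂ))
      atTop (nhds 0) := by
  obtain ⟨C₁, hC₁, h1⟩ := sum_dist_mul_le hα hα1 hx0 hx1
  obtain ⟨C₂, hC₂, h2⟩ := exists_norm_sq_le hα hα1
  obtain ⟨D, hD, h3⟩ := exists_sum_sq_Xvec_le hg hf
  set s := 2 * α / (1 + α) with hs
  have hs0 : 0 ≤ s := by positivity
  set E := Real.sqrt (C₂ * 2 ^ s * D) with hE
  have hexp : 0 < 1 / (1 + α) - g := by linarith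
  have hlim : Tendsto (fun N : ℕ => C₁ * E * (N : ℝ) ^ (-(1 / (1 + α) - g))) atTop (nhds 0) := by
    simpa using ((tendsto_rpow_neg_atTop hexp).comp
      (tendsto_natCast_atTop_atTop (R := ℝ))).const_mul (C₁ * E)
  refine squeeze_zero_norm' ?_ hlim
  filter_upwards [eventually_gt_atTop 0] with N hN
  have hN0 : (0 : ℝ) < N := by exact_mod_cast hN
  have hk1 : (⌊(N : ℝ) * x⌋₊ : ℝ) ≤ N * x := Nat.floor_le (by positivity)
  have hkN : ⌊(N : ℝ) * x⌋₊ ≤ N := by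
    have : (⌊(N : ℝ) * x⌋₊ : ℝ) ≤ N := hk1.trans (mul_le_of_le_one_right hN0.le hx1.le)
    exact_mod_cast this
  have hrow : ((rowIdx N x : Fin (N + 1)) : ℕ) = ⌊(N : ℝ) * x⌋₊ := by
    simp only [rowIdx, Int.floor_toNat, min_eq_left hkN]
  set X : Fin (N + 1) → ℂ := fun l => ((Xvec f N (l : ℕ) : ℝ) : ℂ) with hX
  set w := (limMat α N)⁻¹.mulVec X with hw
  have hwX : (limMat α N).mulVec w = X := by
    rw [hw, Matrix.mulVec_mulVec, Matrix.mul_nonsing_inv _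
      (isUnit_iff_ne_zero.2 (det_limMat_ne_zero hα hα1 N)), Matrix.one_mulVec]
  set B := E * (N : ℝ) ^ (s / 2 + g) with hB
  have hB0 : 0 ≤ B := by positivity
  have hwB : ∀ l, ‖w l‖ ≤ B := fun l => by
    refine (abs_le_of_sq_le_sq' ?_ hB0).2
    have hXs : ∑ k, ‖X k‖ ^ 2 ≤ D * (N : ℝ) ^ (2 * g) := by
      refine le_trans (le_of_eq ?_) (h3 N hN)
      rw [← Fin.sum_univ_eq_sum_range (fun l => Xvec f N l ^ 2)]
      simp [hX]
    have hN1 : (N + 1 : ℝ) ^ s ≤ 2 ^ s * (N : ℝ) ^ s := by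
      rw [← Real.mul_rpow (by norm_num) hN0.le]
      refine Real.rpow_le_rpow (by positivity) ?_ hs0
      have : (1 : ℝ) ≤ N := by exact_mod_cast hN
      linarith
    calc ‖w l‖ ^ 2 ≤ C₂ * (N + 1 : ℝ) ^ s * ∑ k, ‖X k‖ ^ 2 := h2 N w X hwX l
      _ ≤ C₂ * (2 ^ s * (N : ℝ) ^ s) * (D * (N : ℝ) ^ (2 * g)) := by gcongr
      _ = (C₂ * 2 ^ s * D) * ((N : ℝ) ^ s * (N : ℝ) ^ (2 * g)) := by ring
      _ = B ^ 2 := by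
        rw [hB, mul_pow, hE, Real.sq_sqrt (by positivity), ← Real.rpow_add hN0,
          ← Real.rpow_natCast, ← Real.rpow_mul hN0.le]
        congr 2; push_cast; ring
  have hmain := norm_sub_sum_invKer_le hα hα1 hwX (rowIdx N x) hwB
  rw [hrow] at hmain
  have hwk : ∑ l : Fin (N + 1), (limMat α N)⁻¹ (rowIdx N x) l * X l = w (rowIdx N x) := rfl
  have hsum : ((∑ l ∈ range (N + 1), invKer α ⌊(N : ℝ) * x⌋₊ l * Xvec f N l : ℝ) : ℂ) =
      ∑ l : Fin (N + 1), (invKer α ⌊(N : ℝ) * x⌋₊ l : ℂ) * X l := by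
    rw [← Fin.sum_univ_eq_sum_range (fun l => invKer α ⌊(N : ℝ) * x⌋₊ l * Xvec f N l)]
    push_cast
    rfl
  rw [hwk, Complex.ofReal_mul, hsum, ← mul_sub, norm_mul, Complex.norm_real, Real.norm_eq_abs,
    abs_of_nonneg (by positivity)]
  calc _ ≤ (N : ℝ) ^ (-α) * (C₁ * (N : ℝ) ^ (α - 1) * B) :=
        mul_le_mul_of_nonneg_left (hmain.trans (mul_le_mul_of_nonneg_right (h1 N _ hN hk1) hB0))
          (by positivity)
    _ = C₁ * E * ((N : ℝ) ^ (-α) * (N : ℝ) ^ (α - 1) * (N : ℝ) ^ (s / 2 + g)) := by rw [hB]; ring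
    _ = _ := by
      rw [← Real.rpow_add hN0, ← Real.rpow_add hN0]
      congr 2
      rw [hs]; field_simp; ring

end FractionalToeplitz

/-- The fractional integral `J_α(f)(x)`, defined as the iterated limit of
`N^{-α} Σ_l (T_{N,α,R}^{-1})_{⌊Nx⌋+1, l+1} X_{N,l}`, exists and equals
`(1/(2^α Γ(α))) ∫₀^x (x-t)^{α-1} f(t) dt`. -/
theorem fractional_integral_exists (α : ℝ) (hα : α ∈ Set.Ioo (0 : ℝ) 1) (f : ℝ → ℝ)
    (hlip : LocLip01 f) (hmem : MemL1Class α f) (x : ℝ) (hx : x ∈ Set.Ioo (0 : ℝ) 1) :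
    ∃ L : ℕ → ℂ,
      (∀ᶠ N : ℕ in atTop,
        Tendsto
          (fun R : ℝ => (((N : ℝ) ^ (-α) : ℝ) : ℂ) *
            ∑ l : Fin (N + 1), (TNmat α R N)⁻¹ (rowIdx N x) l * ((Xvec f N (l : ℕ) : ℝ) : ℂ))
          (nhdsWithin 1 (Set.Iio 1)) (nhds (L N))) ∧
      Tendsto L atTop
        (nhds (((1 / ((2 : ℝ) ^ α * Real.Gamma α) *
          ∫ t in (0 : ℝ)..x, (x - t) ^ (α - 1) * f t : ℝ) : ℂ))) := by
  obtain ⟨g, C, hg, hg1, hC, hf⟩ := FractionalToeplitz.exists_abs_le hα.1 hα.2 hlip hmem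
  have hg1' : g < 1 := hg1.trans (by rw [div_lt_one] <;> linarith [hα.1])
  refine ⟨fun N => (((N : ℝ) ^ (-α) : ℝ) : ℂ) * ∑ l : Fin (N + 1),
    (FractionalToeplitz.limMat α N)⁻¹ (rowIdx N x) l * ((Xvec f N (l : ℕ) : ℝ) : ℂ),
    Eventually.of_forall fun N => ?_, ?_⟩
  · exact (tendsto_finsetSum _ fun l _ => (FractionalToeplitz.tendsto_inv_TNmat α hα.1 hα.2 N
      (FractionalToeplitz.det_limMat_ne_zero hα.1 hα.2 N) _ _).mul_const _).const_mul _
  · have h1 := FractionalToeplitz.tendsto_inv_limMat_sub hα.1 hα.2 hx.1 hx.2 hg hg1 hf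
    have h2 := FractionalToeplitz.tendsto_sum_invKer_mul_Xvec hα.1 hα.2 hlip hx.1 hx.2
      (by linarith) hg1' hC hf
    have h3 := h1.add ((Complex.continuous_ofReal.tendsto _).comp h2)
    simpa only [Function.comp_def, sub_add_cancel, zero_add] using h3
end
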